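/- arXiv:1909.06829 — 4 statements merged into one kernel-verified Lean document; each statement's English description precedes it below -/
import Mathlib

section
/- Let A be a finite set of real numbers with A ⊆ [1,∞) and let Z = (⨁_{p∈A} ℓ_p) ⊕ c₀. If (x_j)_{j∈J} is an unconditional basis of Z, then there is a partition of J into sets (J_p)_{p∈A} and J_∞ such that for every p ∈ A the closed linear span of {x_j : j ∈ J_p} in Z is isomorphic (linearly homeomorphic) to ℓ_p, and the closed linear span of {x_j : j ∈ J_∞} is isomorphic to c₀. (This is the case A ⊆ [1,∞] of the paper's Main Theorem, with the convention that ℓ_∞ means c₀.) -/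
open scoped ENNReal ZeroAtInfty

noncomputable section

/-- The sequence space `ℓ_p` of real sequences, for a real exponent `p`. -/
abbrev ellp (p : ℝ) : Type := lp (fun _ : ℕ => ℝ) (ENNReal.ofReal p)

instance (p : {q : ℝ // 1 ≤ q}) : Fact ((1 : ℝ≥0∞) ≤ ENNReal.ofReal p.1) :=
  ⟨ENNReal.one_le_ofReal.mpr p.2⟩


theorem Finset.sum_inter_add_sum_sdiff_aux {J Z : Type*} [AddCommMonoid Z] [DecidableEq J] {f : J → Z}
    (F s : Finset J) : ∑ j ∈ F ∩ s, f j + ∑ j ∈ F \ s, f j = ∑ j ∈ F, f j := by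
  rw [← Finset.sum_union (Finset.disjoint_left.2 (by simp +contextual))]
  congr 1; ext j; by_cases h : j ∈ s <;> simp [h]

theorem summable_bdd_aux {J Z : Type*} [NormedAddCommGroup Z] (f : J → Z) (hf : Summable f) :
    ∃ C, ∀ F : Finset J, ‖∑ j ∈ F, f j‖ ≤ C := by
  classical
  obtain ⟨s, hs⟩ := hf.vanishing (Metric.ball_mem_nhds (0 : Z) one_pos)
  refine ⟨(∑ j ∈ s, ‖f j‖) + 1, fun F => ?_⟩
  have h1 := hs (F \ s) Finset.sdiff_disjoint
  rw [mem_ball_zero_iff] at h1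
  rw [← Finset.sum_inter_add_sum_sdiff_aux F s]
  refine (norm_add_le _ _).trans (add_le_add ?_ h1.le)
  refine (norm_sum_le _ _).trans ?_
  exact Finset.sum_le_sum_of_subset_of_nonneg Finset.inter_subset_right (fun _ _ _ => norm_nonneg _)

theorem basis_finite_bound {J Z : Type*} [NormedAddCommGroup Z] [NormedSpace ℝ Z] [CompleteSpace Z]
    (x : J → Z) (c : J → Z → ℝ) (hc : ∀ f, HasSum (fun j => c j f • x j) f)
    (huniq : ∀ f (a : J → ℝ), HasSum (fun j => a j • x j) f → a = fun j => c j f)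
    (hx0 : ∀ j, x j ≠ 0) :
    (∀ j f g, c j (f + g) = c j f + c j g) ∧ (∀ j (t : ℝ) f, c j (t • f) = t * c j f) ∧
    ∃ C : ℝ, 1 ≤ C ∧ ∀ (F : Finset J) f, ‖∑ j ∈ F, c j f • x j‖ ≤ C * ‖f‖ := by
  classical
  have hadd : ∀ j f g, c j (f + g) = c j f + c j g := by
    intro j f g
    have := huniq (f + g) (fun j => c j f + c j g) (by
      simpa only [add_smul] using (hc f).add (hc g))
    exact (congrFun this j).symm
  have hsmul : ∀ j (t : ℝ) f, c j (t • f) = t * c j f := by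
    intro j t f
    have := huniq (t • f) (fun j => t * c j f) (by
      simpa only [mul_smul] using (hc f).const_smul t)
    exact (congrFun this j).symm
  refine ⟨hadd, hsmul, ?_⟩
  have hmem : ∀ f, Memℓp (fun F : Finset J => ∑ j ∈ F, c j f • x j) (∞ : ℝ≥0∞) := by
    intro f
    obtain ⟨C, hC⟩ := summable_bdd_aux _ (hc f).summable
    exact memℓp_infty ⟨C, by rintro _ ⟨F, rfl⟩; exact hC F⟩
  let T : Z →ₗ[ℝ] lp (fun _ : Finset J => Z) (∞ : ℝ≥0∞) :=
    { toFun := fun f => ⟨fun F => ∑ j ∈ F, c j f • x j, hmem f⟩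
      map_add' := by
        intro f g
        ext F
        simp [hadd, add_smul, Finset.sum_add_distrib]
        rfl
      map_smul' := by
        intro t f
        ext F
        simp [hsmul, mul_smul, Finset.smul_sum] }
  have hT : ∀ f F, (T f : Finset J → Z) F = ∑ j ∈ F, c j f • x j := fun f F => rfl
  have hcont : Continuous T := by
    apply LinearMap.continuous_of_seq_closed_graph
    intro u f s hu hs
    have hcoord : ∀ F, Filter.Tendsto (fun n => ∑ j ∈ F, c j (u n) • x j) Filter.atTop
        (nhds (s F)) := by
      intro F
      rw [tendsto_iff_norm_sub_tendsto_zero] at hs ⊢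
      refine squeeze_zero (fun _ => norm_nonneg _) (fun n => ?_) hs
      have := lp.norm_apply_le_norm (p := ∞) (by simp) (T (u n) - s) F
      simpa [hT] using this
    have hex : ∀ j, ∃ b : ℝ, s {j} = b • x j := by
      intro j
      have hcl : IsClosed ((Submodule.span ℝ {x j} : Submodule ℝ Z) : Set Z) :=
        Submodule.closed_of_finiteDimensional _
      have : s {j} ∈ (Submodule.span ℝ {x j} : Submodule ℝ Z) := by
        refine hcl.mem_of_tendsto (hcoord {j}) (Filter.Eventually.of_forall fun n => ?_)
        simp only [Finset.sum_singleton, SetLike.mem_coe]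
        exact Submodule.smul_mem _ _ (Submodule.mem_span_singleton_self _)
      obtain ⟨b, hb⟩ := Submodule.mem_span_singleton.1 this
      exact ⟨b, hb.symm⟩
    choose b hb using hex
    have hsF : ∀ F, s F = ∑ j ∈ F, b j • x j := by
      intro F
      refine tendsto_nhds_unique (hcoord F) ?_
      refine tendsto_finsetSum _ (fun j _ => ?_)
      rw [← hb j]
      simpa using hcoord {j}
    have hsum : HasSum (fun j => b j • x j) f := by
      rw [HasSum, SummationFilter.unconditional_filter, Metric.tendsto_atTop]
      intro ε hε
      have h1 := (Metric.tendsto_atTop.1 hs) (ε / 3) (by positivity)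
      have h2 := (Metric.tendsto_atTop.1 hu) (ε / 3) (by positivity)
      obtain ⟨n1, h1⟩ := h1
      obtain ⟨n2, h2⟩ := h2
      set n := max n1 n2
      have h1 := h1 n (le_max_left _ _)
      have h2 := h2 n (le_max_right _ _)
      obtain ⟨F0, h3⟩ := (Metric.tendsto_atTop.1 (by simpa only [HasSum, SummationFilter.unconditional_filter] using hc (u n))) (ε / 3) (by positivity)
      refine ⟨F0, fun F hF => ?_⟩
      have h3 := h3 F hF
      rw [← hsF F]
      have h4 := lp.norm_apply_le_norm (p := ∞) (by simp) (T (u n) - s) F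
      rw [← dist_eq_norm (T (u n)) s] at h4
      have h5 : dist (∑ j ∈ F, c j (u n) • x j) (s F) ≤ dist (T (u n)) s := by
        rw [dist_eq_norm]; simpa [hT] using h4
      have h6 := dist_triangle4 (s F) (∑ j ∈ F, c j (u n) • x j) (u n) f
      rw [dist_comm (s F) (∑ j ∈ F, c j (u n) • x j)] at h6
      have h1' : dist (T (u n)) s < ε / 3 := h1
      linarith
    have := huniq f b hsum
    ext F
    rw [hsF F, hT, this]
  let T' : Z →L[ℝ] lp (fun _ : Finset J => Z) (∞ : ℝ≥0∞) := ⟨T, hcont⟩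
  refine ⟨max ‖T'‖ 1, le_max_right _ _, fun F f => ?_⟩
  have h1 := lp.norm_apply_le_norm (p := ∞) (by simp) (T' f) F
  calc _ ≤ ‖T' f‖ := h1
    _ ≤ ‖T'‖ * ‖f‖ := T'.le_opNorm f
    _ ≤ _ := by gcongr; exact le_max_left _ _

structure UB (J Z : Type*) [NormedAddCommGroup Z] [NormedSpace ℝ Z] (x : J → Z) where
  c : J → Z →L[ℝ] ℝ
  M : Set J → Z →L[ℝ] Z
  C : ℝ
  hC : 1 ≤ C
  bi : ∀ j k, j ≠ k → c j (x k) = 0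
  bi' : ∀ j, c j (x j) = 1
  sum : ∀ f, HasSum (fun j => c j f • x j) f
  sumM : ∀ S f, HasSum (S.indicator (fun j => c j f • x j)) (M S f)
  normM : ∀ S, ‖M S‖ ≤ C

theorem exists_UB {J Z : Type*} [NormedAddCommGroup Z] [NormedSpace ℝ Z] [CompleteSpace Z]
    (x : J → Z) (hx : ∀ f : Z, ∃! a : J → ℝ, HasSum (fun j => a j • x j) f) :
    Nonempty (UB J Z x) := by
  classical
  choose a ha hu using hx
  have hx1 : ∀ k, (fun j => if j = k then (1 : ℝ) else 0) = a (x k) := by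
    intro k
    refine hu (x k) _ ?_
    convert hasSum_ite_eq k (x k) using 2 with j
    by_cases h : j = k <;> simp [h]
  have hx0 : ∀ j, x j ≠ 0 := by
    intro k hk
    have h1 := hx1 k
    have h2 := hu (x k) (fun _ => 0) (by simp [hk])
    have h3 := congrFun (h1.trans h2.symm) k
    simp at h3
  obtain ⟨hadd, hsmul, C, hC1, hC⟩ := basis_finite_bound x (fun j f => a f j) ha
    (fun f b hb => hu f b hb) hx0
  have hs : ∀ (S : Set J) f, Summable (S.indicator (fun j => a f j • x j)) :=
    fun S f => (ha f).summable.indicator S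
  let M : Set J → Z →L[ℝ] Z := fun S =>
    LinearMap.mkContinuous
      { toFun := fun f => ∑' j, S.indicator (fun j => a f j • x j) j
        map_add' := by
          intro f g
          rw [← (hs S f).tsum_add (hs S g)]
          congr 1; ext j
          by_cases h : j ∈ S <;> simp [h, hadd, add_smul]
        map_smul' := by
          intro t f
          simp only [RingHom.id_apply]
          rw [← (hs S f).tsum_const_smul]
          congr 1; ext j
          by_cases h : j ∈ S <;> simp [h, hsmul, mul_smul] } C (by
        intro f
        refine le_of_tendsto (hs S f).hasSum.norm (Filter.Eventually.of_forall fun F => ?_)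
        have := hC (F.filter (· ∈ S)) f
        rw [Finset.sum_filter] at this
        have h2 : (fun j => if j ∈ S then a f j • x j else 0) =
            S.indicator (fun j => a f j • x j) := by
          ext j; by_cases h : j ∈ S <;> simp [h]
        rw [← h2]
        exact this)
  have hM : ∀ S f, HasSum (S.indicator (fun j => a f j • x j)) (M S f) :=
    fun S f => (hs S f).hasSum
  refine ⟨⟨fun j => LinearMap.mkContinuous ⟨⟨fun f => a f j, hadd j⟩, hsmul j⟩ (C / ‖x j‖) ?_,
    M, C, hC1, ?_, ?_, ha, hM, ?_⟩⟩
  · intro f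
    have := hC {j} f
    simp only [Finset.sum_singleton, norm_smul] at this
    have h0 := norm_pos_iff.2 (hx0 j)
    show ‖a f j‖ ≤ _
    rw [div_mul_eq_mul_div, le_div_iff₀ h0]
    exact this
  · intro j k h
    show a (x k) j = 0
    rw [← hx1]; simp [h]
  · intro j
    show a (x j) j = 1
    rw [← hx1]; simp
  · intro S
    exact LinearMap.mkContinuous_norm_le _ (by linarith) _

namespace UB
variable {J Z : Type*} [NormedAddCommGroup Z] [NormedSpace ℝ Z] {x : J → Z} (B : UB J Z x)

theorem M_singleton (j : J) (f : Z) : B.M {j} f = B.c j f • x j := by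
  classical
  refine (B.sumM {j} f).unique ?_
  convert hasSum_ite_eq j (B.c j f • x j) using 2 with k
  by_cases h : k = j <;> simp [h]

theorem c_M (S : Set J) (f : Z) (j : J) : B.c j (B.M S f) = S.indicator (fun j => B.c j f) j := by
  classical
  refine (((B.sumM S f).mapL (B.c j))).unique ?_
  convert hasSum_ite_eq j (S.indicator (fun j => B.c j f) j) using 2 with k
  by_cases h : k = j
  · subst h
    by_cases hk : k ∈ S <;> simp [hk, B.bi']
  · by_cases hk : k ∈ S <;> simp [hk, h, B.bi j k (Ne.symm h)]

theorem ext_c {f g : Z} (h : ∀ j, B.c j f = B.c j g) : f = g := by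
  refine (B.sum f).unique ?_
  simpa only [h] using B.sum g

theorem M_mul (S T : Set J) : B.M S * B.M T = B.M (S ∩ T) := by
  ext f
  refine B.ext_c fun j => ?_
  rw [mul_apply_eq_comp, c_M, c_M]
  by_cases h : j ∈ S <;> by_cases h' : j ∈ T <;> simp [h, h', c_M]

theorem M_idem (S : Set J) : B.M S * B.M S = B.M S := by rw [M_mul, Set.inter_self]

theorem M_union {S T : Set J} (hd : Disjoint S T) : B.M (S ∪ T) = B.M S + B.M T := by
  ext f
  refine B.ext_c fun j => ?_
  rw [add_apply, map_add, c_M, c_M, c_M, Set.indicator_union_of_disjoint hd]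

theorem M_univ : B.M Set.univ = 1 := by
  ext f
  refine B.ext_c fun j => ?_
  rw [c_M]; simp

theorem M_empty : B.M ∅ = 0 := by
  ext f
  refine B.ext_c fun j => ?_
  rw [c_M]; simp

/-- tail smallness at a fixed vector -/
theorem tail (f : Z) {ε : ℝ} (hε : 0 < ε) :
    ∃ J0 : Finset J, ∀ S : Finset J, Disjoint S J0 → ‖B.M S f‖ < ε := by
  obtain ⟨s, hs⟩ := (B.sum f).summable.vanishing (Metric.ball_mem_nhds (0 : Z) hε)
  refine ⟨s, fun S hS => ?_⟩
  have h := hs S hS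
  rw [mem_ball_zero_iff] at h
  have : B.M S f = ∑ j ∈ S, B.c j f • x j := by
    refine (B.sumM S f).unique ?_
    have := hasSum_sum_of_ne_finset_zero (L := SummationFilter.unconditional J) (f := (S : Set J).indicator (fun j => B.c j f • x j))
      (s := S) (by intro b hb; simp [hb])
    convert this using 1
    refine Finset.sum_congr rfl fun j hj => ?_
    simp [hj]
  rwa [this]

/-- limits -/
theorem M_tendsto (S : Set J) (f : Z) [DecidablePred (· ∈ S)] :
    Filter.Tendsto (fun F : Finset J => B.M (F.filter (· ∈ S) : Finset J) f) Filter.atTop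
      (nhds (B.M S f)) := by
  have h := B.sumM S f
  rw [HasSum, SummationFilter.unconditional_filter] at h
  convert h using 2 with F
  refine B.ext_c fun j => ?_
  rw [c_M, map_sum]
  classical
  have : ∀ i ∈ F, B.c j (S.indicator (fun j => B.c j f • x j) i) =
      if i = j then S.indicator (fun j => B.c j f) j else 0 := by
    intro i _
    by_cases h : i = j
    · subst h
      by_cases hk : i ∈ S <;> simp [hk, B.bi']
    · by_cases hk : i ∈ S <;> simp [hk, h, B.bi j i (Ne.symm h)]
  rw [Finset.sum_congr rfl this]
  by_cases h1 : j ∈ F <;> by_cases h2 : j ∈ S <;> simp [h1, h2]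

end UB


theorem norm_pow_aux {R : Type*} [NormedRing R] (L : R) (m : ℕ) : ‖L ^ m‖ ≤ ‖(1 : R)‖ * ‖L‖ ^ m := by
  induction m with
  | zero => simp
  | succ m ih =>
    rw [pow_succ, pow_succ, ← mul_assoc]
    exact (norm_mul_le _ _).trans (by gcongr)

theorem nilp_aux {R I : Type*} [Ring R] [Fintype I] [DecidableEq I] (E : I → R) (r : I → ℝ)
    (idem : ∀ i, E i * E i = E i) (orth : ∀ i k, i ≠ k → E i * E k = 0)
    (M : R) (P : I → I → Prop) [∀ k l, Decidable (P k l)] (hP : ∀ k l, P k l → r k < r l)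
    (L : R) (hL : L = ∑ k, ∑ l, if P k l then E k * M * E l else 0) (hsum : ∑ i, E i = 1) :
    L ^ (Fintype.card I) = 0 := by
  have hk : ∀ k, E k * L = ∑ l, if P k l then E k * M * E l else 0 := by
    intro k
    rw [hL, Finset.mul_sum, Finset.sum_eq_single k]
    · rw [Finset.mul_sum]
      refine Finset.sum_congr rfl fun l _ => ?_
      split_ifs
      · rw [← mul_assoc, ← mul_assoc, idem]
      · simp
    · intro b _ hb
      rw [Finset.mul_sum]
      refine Finset.sum_eq_zero fun l _ => ?_
      split_ifs
      · rw [← mul_assoc, ← mul_assoc, orth _ _ hb.symm]; simp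
      · simp
    · simp
  have key : ∀ m k, (Finset.univ.filter (fun l => r k < r l)).card < m → E k * L ^ m = 0 := by
    intro m
    induction m with
    | zero => intro k hk; omega
    | succ m ih =>
      intro k hkm
      rw [pow_succ', ← mul_assoc, hk, Finset.sum_mul]
      refine Finset.sum_eq_zero fun l _ => ?_
      split_ifs with h
      · rw [mul_assoc, ih l, mul_zero]
        have hlt := hP k l h
        have : (Finset.univ.filter (fun j => r l < r j)) ⊂
            (Finset.univ.filter (fun j => r k < r j)) := by
          refine (Finset.ssubset_iff_of_subset ?_).2 ⟨l, by simpa using hlt, by simp⟩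
          intro j hj
          simp only [Finset.mem_filter, Finset.mem_univ, true_and] at hj ⊢
          exact hlt.trans hj
        have := Finset.card_lt_card this
        omega
      · simp
  rw [← one_mul (L ^ _), ← hsum, Finset.sum_mul]
  refine Finset.sum_eq_zero fun k _ => key _ _ ?_
  rw [← Finset.card_univ]
  refine Finset.card_lt_card ?_
  refine (Finset.ssubset_iff_of_subset (Finset.filter_subset _ _)).2 ⟨k, by simp, by simp⟩

theorem left_inv_aux {R I : Type*} [NormedRing R] [HasSummableGeomSeries R] [Fintype I]
    [DecidableEq I] (E : I → R) (r : I → ℝ) (hr : Function.Injective r)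
    (idem : ∀ i, E i * E i = E i) (orth : ∀ i k, i ≠ k → E i * E k = 0) (hsum : ∑ i, E i = 1)
    (hE : ∀ i, ‖E i‖ ≤ 1) (C : ℝ) (hC : 1 ≤ C) :
    ∃ δ > 0, ∀ M : R, M * M = M → ‖M‖ ≤ C → ∀ i, (∀ k l, r l < r k → ‖E k * M * E l‖ ≤ δ) →
      (∀ k, k ≠ i → ‖E k * M * E k‖ ≤ δ) → ∃ V, V * (M * E i * M) = M := by
  set N : ℝ := (Fintype.card I : ℝ) with hN
  have hN0 : 0 ≤ N := by positivity
  set K : ℝ := ∑ m ∈ Finset.range (Fintype.card I), ‖(1 : R)‖ * (N * N * C) ^ m with hK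
  have hK0 : 0 ≤ K := by positivity
  refine ⟨1 / ((K + 1) * (N * N + 1)), by positivity, ?_⟩
  set δ := 1 / ((K + 1) * (N * N + 1)) with hδ
  have hδ0 : 0 < δ := by positivity
  intro M hM hMC i h1 h2
  classical
  set F : R := 1 - E i with hF
  have hFF : F * F = F := by rw [hF]; simp [mul_sub, sub_mul, idem]
  have hFs : F = ∑ k, if k ≠ i then E k else 0 := by
    rw [hF, ← hsum, ← Finset.sum_erase_eq_sub (Finset.mem_univ i), ← Finset.sum_filter]
    congr 1; ext k; simp
  have hFMF : F * M * F = ∑ k, ∑ l, if k ≠ i ∧ l ≠ i then E k * M * E l else 0 := by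
    rw [hFs, Finset.sum_mul, Finset.sum_mul]
    refine Finset.sum_congr rfl fun k _ => ?_
    rw [Finset.mul_sum]
    refine Finset.sum_congr rfl fun l _ => ?_
    by_cases hk : k = i <;> by_cases hl : l = i <;> simp [hk, hl]
  set L : R := ∑ k, ∑ l, if (k ≠ i ∧ l ≠ i) ∧ r k < r l then E k * M * E l else 0 with hL
  set D : R := ∑ k, ∑ l, if (k ≠ i ∧ l ≠ i) ∧ ¬ r k < r l then E k * M * E l else 0 with hD
  have hLD : F * M * F = L + D := by
    rw [hFMF, hL, hD, ← Finset.sum_add_distrib]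
    refine Finset.sum_congr rfl fun k _ => ?_
    rw [← Finset.sum_add_distrib]
    refine Finset.sum_congr rfl fun l _ => ?_
    by_cases h : k ≠ i ∧ l ≠ i <;> by_cases h' : r k < r l <;> simp only [h, h'] <;> simp
  have hnil := nilp_aux E r idem orth M (fun k l => (k ≠ i ∧ l ≠ i) ∧ r k < r l)
    (fun k l h => h.2) L hL hsum
  have hEME : ∀ k l, ‖E k * M * E l‖ ≤ C := by
    intro k l
    calc _ ≤ ‖E k‖ * ‖M‖ * ‖E l‖ := (norm_mul_le _ _).trans (by gcongr; exact norm_mul_le _ _)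
      _ ≤ 1 * C * 1 := by gcongr <;> apply hE
      _ = C := by ring
  have hsumb : ∀ (f : I → I → R) (c : ℝ), (∀ k l, ‖f k l‖ ≤ c) → ‖∑ k, ∑ l, f k l‖ ≤ N * N * c := by
    intro f c hf
    refine (norm_sum_le_of_le _ (fun k _ => norm_sum_le_of_le _ (fun l _ => hf k l))).trans ?_
    simp [hN, mul_assoc]
  have hLn : ‖L‖ ≤ N * N * C := by
    refine hsumb _ _ fun k l => ?_
    split_ifs
    · exact hEME k l
    · simp; linarith
  have hDn : ‖D‖ ≤ N * N * δ := by
    refine hsumb _ _ fun k l => ?_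
    split_ifs with h
    · rcases lt_or_eq_of_le (not_lt.1 h.2) with h3 | h3
      · exact h1 k l h3
      · rw [hr h3]
        exact h2 k h.1.1
    · simp [hδ0.le]
  set G : R := ∑ m ∈ Finset.range (Fintype.card I), L ^ m with hG
  have hGL : G * (1 - L) = 1 := by
    rw [hG]
    have := geom_sum_mul_neg L (Fintype.card I)
    rw [this, hnil, sub_zero]
  have hGn : ‖G‖ ≤ K := by
    rw [hG, hK]
    refine norm_sum_le_of_le _ fun m _ => ?_
    refine (norm_pow_aux L m).trans ?_
    gcongr
  have hGD : ‖G * D‖ < 1 := by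
    calc _ ≤ ‖G‖ * ‖D‖ := norm_mul_le _ _
      _ ≤ K * (N * N * δ) := by gcongr
      _ < 1 := by
        rw [hδ, ← mul_assoc, mul_one_div, div_lt_one (by positivity)]
        nlinarith [mul_nonneg hN0 hN0]
  obtain ⟨⟨u, v, huv, hvu⟩, hu⟩ := isUnit_one_sub_of_norm_lt_one hGD
  simp only at hu
  subst hu
  set V0 := v * G with hV0
  have hV : V0 * (1 - F * M * F) = 1 := by
    have : G * (1 - F * M * F) = 1 - G * D := by
      rw [hLD, ← sub_sub, mul_sub, hGL]
    rw [hV0, mul_assoc, this, hvu]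
  refine ⟨1 + M * F * V0 * (F * M), ?_⟩
  have e1 : M * E i * M = M - M * F * M := by
    rw [hF]; simp only [mul_sub, sub_mul, mul_one, hM]; abel
  have e2 : F * M * (M - M * F * M) = (1 - F * M * F) * (F * M) := by
    simp only [mul_sub, sub_mul, one_mul]
    have a1 : F * M * M = F * M := by rw [mul_assoc, hM]
    have a2 : F * M * (M * F * M) = F * M * F * M := by
      rw [← mul_assoc, ← mul_assoc, a1]
    have a3 : F * M * F * (F * M) = F * M * F * M := by
      rw [mul_assoc (F * M) F, ← mul_assoc F F, hFF]; simp only [mul_assoc]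
    rw [a1, a2, a3]
  rw [e1, add_mul, one_mul, mul_assoc (M * F * V0), e2, mul_assoc (M * F), ← mul_assoc V0, hV,
    one_mul]
  have a4 : M * F * (F * M) = M * F * M := by
    rw [mul_assoc M F, ← mul_assoc F F, hFF]; simp only [mul_assoc]
  rw [a4]; abel


theorem UB.norm_le_of_finite {J Z : Type*} [NormedAddCommGroup Z] [NormedSpace ℝ Z] {x : J → Z}
    (B : UB J Z x) (P Q : Z →L[ℝ] Z) (S : Set J) (δ : ℝ) (hδ : 0 ≤ δ)
    (h : ∀ F : Finset J, (F : Set J) ⊆ S → ‖P * B.M F * Q‖ ≤ δ) : ‖P * B.M S * Q‖ ≤ δ := by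
  classical
  refine ContinuousLinearMap.opNorm_le_bound _ hδ fun f => ?_
  have h1 := (P.continuous.tendsto _).comp (B.M_tendsto S (Q f))
  refine le_of_tendsto h1.norm (Filter.Eventually.of_forall fun F => ?_)
  have h2 := h (F.filter (· ∈ S)) (by intro j; simp)
  exact (ContinuousLinearMap.le_opNorm (P * B.M (F.filter (· ∈ S) : Finset J) * Q) f).trans
    (by gcongr)

theorem split_core {J Z I : Type*} [NormedAddCommGroup Z] [NormedSpace ℝ Z] {x : J → Z}
    (B : UB J Z x) [Fintype I] [DecidableEq I] [Nonempty I] (E : I → Z →L[ℝ] Z) (r : I → ℝ)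
    (hr : Function.Injective r)
    (idem : ∀ i, E i * E i = E i) (hsum : ∑ i, E i = 1)
    (hE : ∀ i, ‖E i‖ ≤ 1)
    (hsmall : ∀ k l, r l < r k → ∀ δ > 0, ∃ J0 : Finset J, ∀ S : Finset J, Disjoint S J0 →
      ‖E k * B.M S * E l‖ ≤ δ) (δ' : ℝ) (hδ' : 0 < δ') :
    ∃ (J0 : Finset J) (idx : J → I), ∀ i, ∀ S : Set J, (∀ j ∈ S, j ∉ J0 ∧ idx j = i) →
      (∀ k l, r l < r k → ‖E k * B.M S * E l‖ ≤ δ') ∧ ∀ k, k ≠ i → ‖E k * B.M S * E k‖ ≤ δ' := by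
  classical
  set N : ℝ := (Fintype.card I : ℝ) with hN
  have hN1 : 1 ≤ N := by rw [hN]; exact_mod_cast Fintype.card_pos
  have hC := B.hC
  set C := B.C
  set η : ℝ := min (δ' / 2) (1 / (8 * N)) with hη
  have hη0 : 0 < η := by positivity
  have hη1 : 2 * η ≤ δ' := by
    have := min_le_left (δ' / 2) (1 / (8 * N)); linarith
  have hη2 : N * η ≤ 1 / 8 := by
    have h := min_le_right (δ' / 2) (1 / (8 * N))
    calc N * η ≤ N * (1 / (8 * N)) := by gcongr
      _ = 1 / 8 := by field_simp
  have hη3 : η ≤ 1 / 8 := le_trans (by nlinarith) hη2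
  set δ : ℝ := min δ' (η / (N * C)) with hδ
  have hδ0 : 0 < δ := by positivity
  have hδη : N * (C * δ) ≤ η := by
    calc N * (C * δ) ≤ N * (C * (η / (N * C))) := by gcongr; exact min_le_right _ _
      _ = η := by field_simp
  -- the finite exceptional set
  have hJ0 : ∃ J0 : Finset J, ∀ k l, r l < r k → ∀ S : Finset J, Disjoint S J0 →
      ‖E k * B.M S * E l‖ ≤ δ := by
    choose! f hf using fun k l (h : r l < r k) => hsmall k l h δ hδ0
    refine ⟨Finset.univ.biUnion fun k => Finset.univ.biUnion fun l => f k l, ?_⟩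
    intro k l h S hS
    refine hf k l h S (hS.mono_right ?_)
    intro j hj
    simp only [Finset.mem_biUnion, Finset.mem_univ, true_and]
    exact ⟨k, l, hj⟩
  obtain ⟨J0, hJ0⟩ := hJ0
  have hEME : ∀ (S : Set J) k l, ‖E k * B.M S * E l‖ ≤ C := by
    intro S k l
    calc _ ≤ ‖E k‖ * ‖B.M S‖ * ‖E l‖ := (norm_mul_le _ _).trans (by gcongr; exact norm_mul_le _ _)
      _ ≤ 1 * C * 1 := by gcongr <;> first | apply hE | apply B.normM
      _ = C := by ring
  -- almost idempotent
  have hidem : ∀ (i : I) (S : Finset J), Disjoint S J0 →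
      ‖E i * B.M S * E i * (E i * B.M S * E i) - E i * B.M S * E i‖ ≤ η := by
    intro i S hS
    have e : E i * B.M S * E i * (E i * B.M S * E i) - E i * B.M S * E i =
        - ∑ k ∈ Finset.univ.erase i, (E i * B.M S * E k) * (E k * B.M S * E i) := by
      have h1 : ∀ k, (E i * B.M S * E k) * (E k * B.M S * E i) =
          E i * B.M S * E k * B.M S * E i := by
        intro k
        calc _ = E i * B.M S * (E k * E k) * B.M S * E i := by simp only [mul_assoc]
          _ = _ := by rw [idem]
      have h2 : E i * B.M S * E i = ∑ k, (E i * B.M S * E k) * (E k * B.M S * E i) := by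
        simp_rw [h1]
        rw [← Finset.sum_mul, ← Finset.sum_mul, ← Finset.mul_sum, hsum, mul_one,
          mul_assoc (E i) (B.M S) (B.M S), B.M_idem]
      conv_lhs => rw [sub_eq_add_neg]; arg 2; rw [h2]
      rw [← Finset.add_sum_erase _ _ (Finset.mem_univ i)]
      abel
    rw [e, norm_neg]
    refine le_trans ?_ hδη
    refine (norm_sum_le_of_le (n := fun _ => C * δ) (Finset.univ.erase i)
      fun k hk => ?_).trans ?_
    · have hne : k ≠ i := Finset.ne_of_mem_erase hk
      refine (norm_mul_le _ _).trans ?_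
      rcases lt_or_gt_of_ne (fun h => hne (hr h)) with h | h
      · rw [mul_comm]
        gcongr
        · exact hEME _ _ _
        · exact hJ0 i k h S hS
      · gcongr
        · exact hEME _ _ _
        · exact hJ0 k i h S hS
    · rw [Finset.sum_const, nsmul_eq_mul]
      gcongr
      rw [hN, ← Finset.card_univ]
      exact_mod_cast Finset.card_le_card (Finset.erase_subset _ _)
  set e : I → J → ℝ := fun i j => B.c j (E i (x j)) with he
  have hR : ∀ i j f, (E i * B.M {j} * E i) f = B.c j (E i f) • E i (x j) := by
    intro i j f
    simp only [mul_apply_eq_comp, B.M_singleton, map_smul]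
  have hEE : ∀ i f, E i (E i f) = E i f := by
    intro i f
    rw [← mul_apply_eq_comp, idem]
  have hatom : ∀ i j, j ∉ J0 → ‖E i * B.M {j} * E i‖ * |e i j - 1| ≤ η ∧
      |e i j| ≤ ‖E i * B.M {j} * E i‖ := by
    intro i j hj
    constructor
    · have h1 := hidem i {j} (by simpa using hj)
      have h2 : E i * B.M {j} * E i * (E i * B.M {j} * E i) - E i * B.M {j} * E i =
          (e i j - 1) • (E i * B.M {j} * E i) := by
        ext f
        simp only [sub_apply, mul_apply_eq_comp (E i * B.M {j} * E i), hR, smul_apply, map_smul,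
          hEE, he, smul_smul]
        rw [← sub_smul]
        congr 1
        simp only [smul_eq_mul]
        ring
      rw [Finset.coe_singleton, h2, norm_smul, mul_comm] at h1
      exact h1
    · by_cases h0 : E i (x j) = 0
      · simp [he, h0]
      · have h1 := ContinuousLinearMap.le_opNorm (E i * B.M {j} * E i) (E i (x j))
        rw [hR, hEE, norm_smul] at h1
        exact le_of_mul_le_mul_right h1 (norm_pos_iff.2 h0)
  have hesum : ∀ j, ∑ i, e i j = 1 := by
    intro j
    simp only [he]
    rw [← map_sum, ← sum_apply, hsum]
    exact B.bi' j
  have hdich : ∀ i j, j ∉ J0 → ‖E i * B.M {j} * E i‖ ≤ 2 * η ∨ 1 - 2 * η ≤ e i j := by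
    intro i j hj
    obtain ⟨h1, h2⟩ := hatom i j hj
    by_cases h : 1 / 2 ≤ |e i j - 1|
    · left; nlinarith [norm_nonneg (E i * B.M {j} * E i)]
    · right
      push Not at h
      have h3 := abs_lt.1 h
      have h4 : 1 / 2 ≤ |e i j| := by rw [abs_of_nonneg] <;> linarith
      have h5 : |e i j - 1| ≤ 2 * η := by nlinarith [abs_nonneg (e i j - 1)]
      linarith [(abs_le.1 h5).1]
  have hlow : ∀ i j, j ∉ J0 → - (2 * η) ≤ e i j := by
    intro i j hj
    rcases hdich i j hj with h | h
    · have := (hatom i j hj).2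
      linarith [neg_abs_le (e i j)]
    · linarith
  have hidx : ∀ j, j ∉ J0 → ∃ i, 1 - 2 * η ≤ e i j := by
    intro j hj
    by_contra! h
    have h1 : ∑ i, e i j ≤ ∑ i : I, 2 * η := by
      refine Finset.sum_le_sum fun i _ => ?_
      rcases hdich i j hj with h' | h'
      · exact (le_abs_self _).trans ((hatom i j hj).2.trans h')
      · exact absurd h' (not_le.2 (h i))
    rw [hesum, Finset.sum_const, nsmul_eq_mul, Finset.card_univ] at h1
    nlinarith
  have hsmallatom : ∀ j, j ∉ J0 → ∀ i k, 1 - 2 * η ≤ e i j → k ≠ i →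
      ‖E k * B.M {j} * E k‖ ≤ 2 * η := by
    intro j hj i k hi hk
    rcases hdich k j hj with h | h
    · exact h
    exfalso
    have h1 := hesum j
    rw [← Finset.add_sum_erase _ _ (Finset.mem_univ i),
      ← Finset.add_sum_erase _ _ (Finset.mem_erase.2 ⟨hk, Finset.mem_univ k⟩)] at h1
    have h2 : ∑ l ∈ (Finset.univ.erase i).erase k, (- (2 * η)) ≤
        ∑ l ∈ (Finset.univ.erase i).erase k, e l j :=
      Finset.sum_le_sum fun l _ => hlow l j hj
    rw [Finset.sum_const, nsmul_eq_mul] at h2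
    have h3 : (((Finset.univ.erase i).erase k).card : ℝ) ≤ N := by
      rw [hN, ← Finset.card_univ]
      exact_mod_cast Finset.card_le_card
        ((Finset.erase_subset _ _).trans (Finset.erase_subset _ _))
    nlinarith
  choose! idx hidx using hidx
  refine ⟨J0, idx, fun i S hS => ⟨fun k l hkl => ?_, fun k hk => ?_⟩⟩
  · refine B.norm_le_of_finite _ _ _ _ hδ'.le fun F hF => ?_
    refine (hJ0 k l hkl F ?_).trans (min_le_left _ _)
    exact Finset.disjoint_left.2 fun j hj => (hS j (hF hj)).1
  · refine B.norm_le_of_finite _ _ _ _ hδ'.le fun F hF => le_trans ?_ hη1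
    induction F using Finset.induction_on with
    | empty => simp [B.M_empty]; positivity
    | insert j F hj ih =>
      rw [Finset.coe_insert, Set.insert_subset_iff] at hF
      have ih := ih hF.2
      have hj0 := hS j hF.1
      have h1 := hsmallatom j hj0.1 i k (hj0.2 ▸ hidx j hj0.1) hk
      have hdis : Disjoint (insert j F) J0 := by
        refine Finset.disjoint_left.2 fun j' hj' => ?_
        rcases Finset.mem_insert.1 hj' with h | h
        · rw [h]; exact hj0.1
        · exact (hS j' (hF.2 h)).1
      have h2 := hidem k (insert j F) hdis
      have h3 : B.M ((insert j F : Finset J) : Set J) = B.M {j} + B.M F := by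
        rw [Finset.coe_insert, Set.insert_eq, B.M_union (by simpa using hj)]
      have h4 : ‖E k * B.M ((insert j F : Finset J) : Set J) * E k‖ ≤ 4 * η := by
        rw [h3, mul_add, add_mul]
        refine (norm_add_le _ _).trans ?_
        linarith
      set Rk := E k * B.M ((insert j F : Finset J) : Set J) * E k
      have h5 : ‖Rk‖ ≤ ‖Rk‖ * ‖Rk‖ + η := by
        calc ‖Rk‖ = ‖Rk * Rk - (Rk * Rk - Rk)‖ := by congr 1; abel
          _ ≤ ‖Rk * Rk‖ + ‖Rk * Rk - Rk‖ := norm_sub_le _ _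
          _ ≤ _ := add_le_add (norm_mul_le _ _) h2
      nlinarith [norm_nonneg Rk]


theorem avg_aux {V W : Type*} [NormedAddCommGroup V] [NormedSpace ℝ V] [NormedAddCommGroup W]
    [NormedSpace ℝ W] (T : ℕ → V →L[ℝ] W) (y : ℕ → V) (F : Finset ℕ) :
    ∀ (A : V →L[ℝ] W) (b : V), ∃ ε : ℕ → ℝ, (∀ n, ε n = 1 ∨ ε n = -1) ∧
      ‖A b + ∑ n ∈ F, T n (y n)‖ ≤ ‖(A + ∑ n ∈ F, ε n • T n) (b + ∑ n ∈ F, ε n • y n)‖ := by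
  classical
  induction F using Finset.induction_on with
  | empty => intro A b; exact ⟨fun _ => 1, by simp, by simp⟩
  | insert k F hk ih =>
    intro A b
    have hmain : ∃ t : ℝ, (t = 1 ∨ t = -1) ∧ ‖A b + ∑ n ∈ insert k F, T n (y n)‖ ≤
        ‖(A + t • T k) (b + t • y k) + ∑ n ∈ F, T n (y n)‖ := by
      set s := ∑ n ∈ F, T n (y n)
      have h1 : (2 : ℝ) • (A b + ∑ n ∈ insert k F, T n (y n)) =
          ((A + (1 : ℝ) • T k) (b + (1 : ℝ) • y k) + s) +
          ((A + (-1 : ℝ) • T k) (b + (-1 : ℝ) • y k) + s) := by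
        rw [Finset.sum_insert hk]
        simp only [add_apply, smul_apply, map_add, map_smul]
        module
      have h2 := norm_add_le ((A + (1 : ℝ) • T k) (b + (1 : ℝ) • y k) + s)
        ((A + (-1 : ℝ) • T k) (b + (-1 : ℝ) • y k) + s)
      rw [← h1, norm_smul, Real.norm_ofNat] at h2
      by_contra! h
      have h3 := h 1 (Or.inl rfl)
      have h4 := h (-1) (Or.inr rfl)
      linarith
    obtain ⟨t, ht, h⟩ := hmain
    obtain ⟨ε, hε, h'⟩ := ih (A + t • T k) (b + t • y k)
    refine ⟨Function.update ε k t, ?_, h.trans (h'.trans (le_of_eq ?_))⟩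
    · intro n
      by_cases hn : n = k
      · subst hn; simpa using ht
      · simpa [hn] using hε n
    · rw [Finset.sum_insert hk, Finset.sum_insert hk, Function.update_self, add_assoc, add_assoc]
      have e1 : ∑ n ∈ F, Function.update ε k t n • T n = ∑ n ∈ F, ε n • T n :=
        Finset.sum_congr rfl fun n hn => by
          rw [Function.update_of_ne (by rintro rfl; exact hk hn)]
      have e2 : ∑ n ∈ F, Function.update ε k t n • y n = ∑ n ∈ F, ε n • y n :=
        Finset.sum_congr rfl fun n hn => by
          rw [Function.update_of_ne (by rintro rfl; exact hk hn)]
      rw [e1, e2]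

theorem pow_contra {c C s r : ℝ} (hc : 0 < c) (hrs : r < s)
    (h : ∀ K : ℕ, 1 ≤ K → c * (K : ℝ) ^ s ≤ C * (K : ℝ) ^ r) : False := by
  have h1 : Filter.Tendsto (fun K : ℕ => (K : ℝ) ^ (s - r)) Filter.atTop Filter.atTop :=
    (tendsto_rpow_atTop (sub_pos.2 hrs)).comp tendsto_natCast_atTop_atTop
  obtain ⟨K, hK1, hK⟩ := ((h1.eventually_gt_atTop (C / c)).and
    (Filter.eventually_ge_atTop 1)).exists
  have h2 := h K hK
  have hK0 : (0 : ℝ) < K := by exact_mod_cast hK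
  have h3 : (K : ℝ) ^ s = (K : ℝ) ^ (s - r) * (K : ℝ) ^ r := by
    rw [← Real.rpow_add hK0]; congr 1; ring
  rw [h3, ← mul_assoc] at h2
  have h4 := le_of_mul_le_mul_right h2 (Real.rpow_pos_of_pos hK0 r)
  rw [div_lt_iff₀ hc] at hK1
  linarith

structure SeqSp (W : Type*) [NormedAddCommGroup W] [NormedSpace ℝ W] (r : ℝ) where
  ev : W →ₗ[ℝ] (ℕ → ℝ)
  inj : Function.Injective ev
  mono : ∀ (w : W) (v : ℕ → ℝ), (∀ i, |v i| ≤ |ev w i|) → ∃ v', ev v' = v ∧ ‖v'‖ ≤ ‖w‖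
  unit : ∀ F : Finset ℕ, F.Nonempty →
    ∃ w, ev w = (F : Set ℕ).indicator 1 ∧ ‖w‖ = (F.card : ℝ) ^ r
  dens : ∀ w, ∀ ε > 0, ∃ m, ∀ w', (∀ i, i < m → ev w' i = 0) → (∀ i, |ev w' i| ≤ |ev w i|) → ‖w'‖ ≤ ε
  P1 : ∀ D : ℕ → Set ℕ, Pairwise (Function.onFun Disjoint D) → ∀ w, ∀ y : ℕ → W,
    (∀ n, ev (y n) = (D n).indicator (ev w)) → ∃ v, (ev v = fun n => ‖y n‖) ∧ ‖v‖ ≤ ‖w‖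
  P2 : ∀ D : ℕ → Set ℕ, Pairwise (Function.onFun Disjoint D) → ∀ w : ℕ → ℝ,
    (∀ i, w i ≠ 0 → ∃ n, i ∈ D n) → ∀ y : ℕ → W, (∀ n, ev (y n) = (D n).indicator w) →
    ∀ v, (∀ n, ‖y n‖ ≤ |ev v n|) → ∃ w', ev w' = w ∧ ‖w'‖ ≤ ‖v‖
  pull : ∀ σ : ℕ → ℕ, Function.Injective σ → ∀ w, ∃ w', ev w' = ev w ∘ σ ∧ ‖w'‖ ≤ ‖w‖
  push : ∀ σ : ℕ → ℕ, Function.Injective σ → ∀ w, ∃ w', (∀ i, ev w' (σ i) = ev w i) ∧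
    (∀ i, i ∉ Set.range σ → ev w' i = 0) ∧ ‖w'‖ ≤ ‖w‖

namespace SeqSp
variable {W : Type*} [NormedAddCommGroup W] [NormedSpace ℝ W] {r : ℝ} (H : SeqSp W r)

theorem ext' {v w : W} (h : ∀ i, H.ev v i = H.ev w i) : v = w := H.inj (funext h)

theorem mkOp {V : Type*} [NormedAddCommGroup V] [NormedSpace ℝ V] (f : V →ₗ[ℝ] (ℕ → ℝ)) (c : ℝ)
    (hc : 0 ≤ c) (h : ∀ v, ∃ w', H.ev w' = f v ∧ ‖w'‖ ≤ c * ‖v‖) :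
    ∃ T : V →L[ℝ] W, (∀ v, H.ev (T v) = f v) ∧ ‖T‖ ≤ c := by
  choose g hg hgn using h
  refine ⟨LinearMap.mkContinuous ⟨⟨g, ?_⟩, ?_⟩ c hgn, hg, LinearMap.mkContinuous_norm_le _ hc _⟩
  · intro a b; apply H.inj; rw [map_add, hg, hg, hg, map_add]
  · intro t a; apply H.inj; simp [hg]

theorem exists_proj (D : Set ℕ) : ∃ T : W →L[ℝ] W, (∀ w, H.ev (T w) = D.indicator (H.ev w)) ∧
    ‖T‖ ≤ 1 := by
  classical
  refine H.mkOp ⟨⟨fun w => D.indicator (H.ev w), ?_⟩, ?_⟩ 1 zero_le_one fun w => ?_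
  · intro a b; rw [map_add]; exact Set.indicator_add' _ _ _
  · intro t a
    change D.indicator (H.ev (t • a)) = t • D.indicator (H.ev a)
    rw [map_smul]; ext i; by_cases h : i ∈ D <;> simp [h]
  · simp only [one_mul]
    refine H.mono w _ fun i => ?_
    by_cases h : i ∈ D <;> simp [h]

noncomputable def proj (D : Set ℕ) : W →L[ℝ] W := (H.exists_proj D).choose
theorem ev_proj (D : Set ℕ) (w : W) : H.ev (H.proj D w) = D.indicator (H.ev w) :=
  (H.exists_proj D).choose_spec.1 w
theorem norm_proj (D : Set ℕ) : ‖H.proj D‖ ≤ 1 := (H.exists_proj D).choose_spec.2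
theorem norm_proj_le (D : Set ℕ) (w : W) : ‖H.proj D w‖ ≤ ‖w‖ := by
  simpa using ContinuousLinearMap.le_of_opNorm_le _ (H.norm_proj D) w

noncomputable def e (n : ℕ) : W := (H.unit {n} (Finset.singleton_nonempty n)).choose
theorem ev_e (n i : ℕ) : H.ev (H.e n) i = if i = n then 1 else 0 := by
  have := (H.unit {n} (Finset.singleton_nonempty n)).choose_spec.1
  rw [e, this]
  by_cases h : i = n <;> simp [h]
theorem norm_e (n : ℕ) : ‖H.e n‖ = 1 := by
  have := (H.unit {n} (Finset.singleton_nonempty n)).choose_spec.2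
  rw [e, this]; simp

theorem abs_ev_le (w : W) (i : ℕ) : |H.ev w i| ≤ ‖w‖ := by
  classical
  have h1 : H.proj {i} w = H.ev w i • H.e i := by
    apply H.ext'; intro k
    rw [ev_proj, map_smul, Pi.smul_apply, ev_e]
    by_cases h : k = i <;> simp [h]
  have := H.norm_proj_le {i} w
  rwa [h1, norm_smul, norm_e, mul_one] at this

theorem proj_Iio (m : ℕ) (w : W) : H.proj (Set.Iio m) w = ∑ i ∈ Finset.range m, H.ev w i • H.e i := by
  apply H.ext'; intro k
  rw [ev_proj, map_sum, Finset.sum_apply]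
  simp only [map_smul, Pi.smul_apply, ev_e]
  by_cases h : k < m <;> simp [h]

theorem upper (D : ℕ → Set ℕ) (hD : Pairwise (Function.onFun Disjoint D)) (y : ℕ → W)
    (hy : ∀ n i, i ∉ D n → H.ev (y n) i = 0) (hn : ∀ n, ‖y n‖ ≤ 1) (F : Finset ℕ)
    (hF : F.Nonempty) : ‖∑ n ∈ F, y n‖ ≤ (F.card : ℝ) ^ r := by
  classical
  obtain ⟨v, hv, hvn⟩ := H.unit F hF
  have hdis : ∀ n k i, i ∈ D n → i ∈ D k → k = n := by
    intro n k i h1 h2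
    by_contra h
    exact Set.disjoint_left.1 (hD h) h2 h1
  obtain ⟨w, hw, hwn⟩ := H.P2 D hD (H.ev (∑ n ∈ F, y n)) (by
      intro i hi
      by_contra! h
      apply hi
      rw [map_sum, Finset.sum_apply]
      exact Finset.sum_eq_zero fun n _ => hy n i (h n)) (fun n => if n ∈ F then y n else 0) (by
      intro n
      ext i
      rw [map_sum]
      by_cases h : i ∈ D n
      · rw [Set.indicator_of_mem h, Finset.sum_apply]
        have : ∀ k ∈ F, H.ev (y k) i = if k = n then H.ev (y n) i else 0 := by
          intro k _
          by_cases hk : k = n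
          · simp [hk]
          · rw [if_neg hk]; exact hy k i fun h' => hk (hdis n k i h h')
        rw [Finset.sum_congr rfl this]
        by_cases hF : n ∈ F <;> simp [hF]
      · rw [Set.indicator_of_notMem h]
        by_cases hF : n ∈ F <;> simp [hF, hy n i h]) v (by
      intro n
      rw [hv]
      by_cases hF : n ∈ F <;> simp [hF, hn n])
  rw [← H.inj hw, ← hvn]; exact hwn

theorem lower (D : ℕ → Set ℕ) (hD : Pairwise (Function.onFun Disjoint D)) (y : ℕ → W)
    (hy : ∀ n i, i ∉ D n → H.ev (y n) i = 0) (c : ℝ) (hc : 0 < c) (hn : ∀ n, c ≤ ‖y n‖)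
    (F : Finset ℕ) (hF : F.Nonempty) : c * (F.card : ℝ) ^ r ≤ ‖∑ n ∈ F, y n‖ := by
  classical
  obtain ⟨v, hv, hvn⟩ := H.unit F hF
  have hdis : ∀ n k i, i ∈ D n → i ∈ D k → k = n := by
    intro n k i h1 h2
    by_contra h
    exact Set.disjoint_left.1 (hD h) h2 h1
  obtain ⟨u, hu, hun⟩ := H.P1 D hD (∑ n ∈ F, y n) (fun n => if n ∈ F then y n else 0) (by
      intro n
      ext i
      rw [map_sum]
      by_cases h : i ∈ D n
      · rw [Set.indicator_of_mem h, Finset.sum_apply]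
        have : ∀ k ∈ F, H.ev (y k) i = if k = n then H.ev (y n) i else 0 := by
          intro k _
          by_cases hk : k = n
          · simp [hk]
          · rw [if_neg hk]; exact hy k i fun h' => hk (hdis n k i h h')
        rw [Finset.sum_congr rfl this]
        by_cases hF : n ∈ F <;> simp [hF]
      · rw [Set.indicator_of_notMem h]
        by_cases hF : n ∈ F <;> simp [hF, hy n i h])
  obtain ⟨t, ht, htn⟩ := H.mono u (c • H.ev v) (by
    intro i
    rw [hu, hv]
    by_cases hF : i ∈ F <;> simp [hF, abs_of_pos hc, hn i])
  have : t = c • v := H.inj (by rw [ht, map_smul])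
  rw [this, norm_smul, Real.norm_of_nonneg hc.le, hvn] at htn
  exact htn.trans hun

theorem norm_sum_proj (D : ℕ → Set ℕ) (hD : Pairwise (Function.onFun Disjoint D)) (ε : ℕ → ℝ)
    (hε : ∀ n, ε n = 1 ∨ ε n = -1) (F : Finset ℕ) (w : W) :
    ‖∑ n ∈ F, ε n • H.proj (D n) w‖ ≤ ‖w‖ := by
  classical
  have hdis : ∀ n k i, i ∈ D n → i ∈ D k → k = n := by
    intro n k i h1 h2
    by_contra h
    exact Set.disjoint_left.1 (hD h) h2 h1
  obtain ⟨v, hv, hvn⟩ := H.mono w (H.ev (∑ n ∈ F, ε n • H.proj (D n) w)) (by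
    intro i
    rw [map_sum, Finset.sum_apply]
    simp only [map_smul, Pi.smul_apply, ev_proj, smul_eq_mul]
    by_cases h : ∃ n ∈ F, i ∈ D n
    · obtain ⟨n, hn, hi⟩ := h
      rw [Finset.sum_eq_single n]
      · rcases hε n with h | h <;> simp [h, hi]
      · intro k _ hk
        rw [Set.indicator_of_notMem (fun h' => hk (hdis n k i hi h')), mul_zero]
      · exact fun h => absurd hn h
    · push Not at h
      rw [Finset.sum_eq_zero]
      · simp
      · intro k hk
        rw [Set.indicator_of_notMem (h k hk), mul_zero])
  rw [← H.inj hv]; exact hvn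

theorem three (m m' : ℕ) (h : m ≤ m') (w : W) :
    w = H.proj (Set.Iio m) w + H.proj (Set.Ico m m') w + H.proj (Set.Ici m') w := by
  apply H.ext'; intro i
  simp only [map_add, Pi.add_apply, ev_proj]
  simp only [Set.indicator, Set.mem_Iio, Set.mem_Ico, Set.mem_Ici]
  by_cases h1 : i < m
  · rw [if_pos h1, if_neg (by omega), if_neg (by omega)]; simp
  · by_cases h2 : i < m'
    · rw [if_neg h1, if_pos (by omega), if_neg (by omega)]; simp
    · rw [if_neg h1, if_neg (by omega), if_pos (by omega)]; simp

theorem tailproj (w : W) (ε : ℝ) (hε : 0 < ε) : ∃ m, ∀ m', m ≤ m' → ‖H.proj (Set.Ici m') w‖ ≤ ε := by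
  obtain ⟨m, hm⟩ := H.dens w ε hε
  refine ⟨m, fun m' h => hm _ (fun i hi => ?_) (fun i => ?_)⟩
  · rw [ev_proj, Set.indicator_of_notMem]; simp; omega
  · rw [ev_proj]; by_cases h : i ∈ Set.Ici m' <;> simp [Set.indicator, h]

theorem lemA {s : ℝ} (H : SeqSp W s) (hrs : r < s) (hs : s ≤ 1) (z : ℕ → W) (δ : ℝ) (hδ : 0 < δ)
    (hz : ∀ n, δ ≤ ‖z n‖) (C : ℝ) (h : ∀ F : Finset ℕ, F.Nonempty → ∀ ε : ℕ → ℝ,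
      (∀ n, ε n = 1 ∨ ε n = -1) → ‖∑ n ∈ F, ε n • z n‖ ≤ C * (F.card : ℝ) ^ r) : False := by
  classical
  have hco : ∀ i, Filter.Tendsto (fun n => H.ev (z n) i) Filter.atTop (nhds 0) := by
    intro i
    by_contra hcon
    rw [Metric.tendsto_atTop] at hcon
    push Not at hcon
    obtain ⟨η, hη, hcon⟩ := hcon
    have hinf : {n | η ≤ |H.ev (z n) i|}.Infinite := by
      rw [Set.infinite_iff_exists_gt]
      intro a
      obtain ⟨n, hn, hn'⟩ := hcon (a + 1)
      exact ⟨n, by simpa using hn', by omega⟩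
    refine pow_contra (c := η) (C := C) (s := 1) (r := r) hη (by linarith) fun K hK => ?_
    obtain ⟨F, hF, hFc⟩ := hinf.exists_subset_card_eq K
    have hne : F.Nonempty := Finset.card_pos.1 (by omega)
    have h1 := h F hne (fun n => if 0 ≤ H.ev (z n) i then 1 else -1)
      (fun n => by by_cases h : 0 ≤ H.ev (z n) i <;> simp [h])
    rw [hFc] at h1
    refine le_trans ?_ h1
    refine le_trans ?_ (H.abs_ev_le _ i)
    refine le_trans ?_ (le_abs_self _)
    rw [map_sum, Finset.sum_apply, Real.rpow_one, ← hFc, mul_comm, ← nsmul_eq_mul]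
    refine Finset.card_nsmul_le_sum _ _ _ fun n hn => ?_
    have h2 : η ≤ |H.ev (z n) i| := hF hn
    rw [map_smul, Pi.smul_apply, smul_eq_mul]
    split_ifs with h3
    · rw [abs_of_nonneg h3] at h2; linarith
    · rw [abs_of_neg (not_le.1 h3)] at h2; linarith
  have hstep : ∀ a : ℕ × ℕ, ∃ b : ℕ × ℕ, a.1 ≤ b.1 ∧ a.2 < b.2 ∧
      δ / 2 ≤ ‖H.proj (Set.Ico a.2 b.2) (z b.1)‖ := by
    rintro ⟨N, m⟩
    have h1 : Filter.Tendsto (fun n => H.proj (Set.Iio m) (z n)) Filter.atTop (nhds 0) := by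
      simp only [proj_Iio]
      rw [show (0 : W) = ∑ i ∈ Finset.range m, (0 : ℝ) • H.e i by simp]
      exact tendsto_finsetSum _ fun i _ => (hco i).smul_const _
    have h2 := h1.norm
    rw [norm_zero] at h2
    obtain ⟨n, hn1, hn2⟩ := ((h2.eventually_lt_const (show 0 < δ / 4 by linarith)).and
      (Filter.eventually_ge_atTop N)).exists
    obtain ⟨m', hm'⟩ := H.tailproj (z n) (δ / 4) (by linarith)
    refine ⟨(n, max m' (m + 1)), hn2, by simp, ?_⟩
    have h3 := hm' (max m' (m + 1)) (le_max_left _ _)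
    have h4 := H.three m (max m' (m + 1)) (by omega) (z n)
    have h5 := norm_add₃_le (a := H.proj (Set.Iio m) (z n))
      (b := H.proj (Set.Ico m (max m' (m + 1))) (z n)) (c := H.proj (Set.Ici (max m' (m + 1))) (z n))
    rw [← h4] at h5
    have h6 := hz n
    dsimp only
    linarith
  choose g hg1 hg2 hg3 using hstep
  let a : ℕ → ℕ × ℕ := fun k => (fun p => ((g p).1 + 1, (g p).2))^[k] (0, 0)
  have ha : ∀ k, a (k + 1) = ((g (a k)).1 + 1, (g (a k)).2) := fun k =>
    Function.iterate_succ_apply' _ _ _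
  let m : ℕ → ℕ := fun k => (a k).2
  let nn : ℕ → ℕ := fun k => (g (a k)).1
  have hm : StrictMono m := strictMono_nat_of_lt_succ fun k => by
    simp only [m, ha]; exact hg2 _
  have hnn : StrictMono nn := strictMono_nat_of_lt_succ fun k => by
    have := hg1 (a (k + 1))
    rw [ha] at this
    simp only [nn]
    rw [ha]; omega
  have hD : Pairwise (Function.onFun Disjoint fun k => Set.Ico (m k) (m (k + 1))) :=
    hm.monotone.pairwise_disjoint_on_Ico_succ
  refine pow_contra (c := δ / 2) (C := C) (s := s) (r := r) (by linarith) hrs fun K hK => ?_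
  have hne : (Finset.range K).Nonempty := by simpa using (by omega : K ≠ 0)
  have h1 := H.lower _ hD (fun k => H.proj (Set.Ico (m k) (m (k + 1))) (z (nn k)))
    (fun n i hi => by rw [ev_proj, Set.indicator_of_notMem hi]) (δ / 2) (by linarith)
    (fun k => by
      have := hg3 (a k)
      simpa only [m, nn, ha] using this) (Finset.range K) hne
  rw [Finset.card_range] at h1
  refine h1.trans ?_
  obtain ⟨ε, hε, h2⟩ := avg_aux (fun k => H.proj (Set.Ico (m k) (m (k + 1)))) (fun k => z (nn k))
    (Finset.range K) 0 0
  simp only [zero_apply, zero_add] at h2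
  refine h2.trans ?_
  rw [sum_apply]
  simp only [smul_apply]
  refine (H.norm_sum_proj _ hD ε hε _ _).trans ?_
  have h3 := h ((Finset.range K).image nn) (hne.image _) (fun n => ε (Function.invFun nn n))
    (fun n => hε _)
  rw [Finset.card_image_of_injective _ hnn.injective, Finset.card_range,
    Finset.sum_image hnn.injective.injOn] at h3
  simpa only [Function.leftInverse_invFun hnn.injective _] using h3

end SeqSp


theorem UB.M_biUnion {J Z : Type*} [NormedAddCommGroup Z] [NormedSpace ℝ Z] {x : J → Z}
    (B : UB J Z x) (S : ℕ → Finset J) (hS : Pairwise (Function.onFun Disjoint S)) (F : Finset ℕ) :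
    ∑ n ∈ F, B.M (S n) = B.M (⋃ n ∈ F, (S n : Set J)) := by
  classical
  induction F using Finset.induction_on with
  | empty => simp [B.M_empty]
  | insert k F hk ih =>
    rw [Finset.sum_insert hk, ih, Finset.set_biUnion_insert, B.M_union]
    rw [Set.disjoint_iUnion₂_right]
    intro n hn
    rw [Finset.disjoint_coe]
    exact hS (by rintro rfl; exact hk hn)

theorem UB.sign {J Z : Type*} [NormedAddCommGroup Z] [NormedSpace ℝ Z] {x : J → Z}
    (B : UB J Z x) (S : ℕ → Finset J) (hS : Pairwise (Function.onFun Disjoint S)) (F : Finset ℕ)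
    (ε : ℕ → ℝ) (hε : ∀ n, ε n = 1 ∨ ε n = -1) :
    ‖∑ n ∈ F, ε n • B.M (S n)‖ ≤ 2 * B.C := by
  classical
  have h : ∑ n ∈ F, ε n • B.M (S n) =
      ∑ n ∈ F with ε n = 1, B.M (S n) - ∑ n ∈ F with ¬ ε n = 1, B.M (S n) := by
    rw [← Finset.sum_filter_add_sum_filter_not F (fun n => ε n = 1), sub_eq_add_neg,
      ← Finset.sum_neg_distrib]
    congr 1
    · refine Finset.sum_congr rfl fun n hn => ?_
      rw [(Finset.mem_filter.1 hn).2, one_smul]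
    · refine Finset.sum_congr rfl fun n hn => ?_
      rw [(hε n).resolve_left (Finset.mem_filter.1 hn).2, neg_smul, one_smul]
  rw [h, B.M_biUnion S hS, B.M_biUnion S hS]
  refine (norm_sub_le _ _).trans ?_
  have := B.normM (⋃ n ∈ F.filter (fun n => ε n = 1), (S n : Set J))
  have := B.normM (⋃ n ∈ F.filter (fun n => ¬ ε n = 1), (S n : Set J))
  linarith

theorem key_lemma {J Z W W' : Type*} [NormedAddCommGroup Z] [NormedSpace ℝ Z]
    [NormedAddCommGroup W] [NormedSpace ℝ W] [NormedAddCommGroup W'] [NormedSpace ℝ W']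
    {x : J → Z} (B : UB J Z x) {s r : ℝ} (Hk : SeqSp W s) (Hl : SeqSp W' r) (hrs : r < s)
    (hs : s ≤ 1) (π : Z →L[ℝ] W) (ι : W' →L[ℝ] Z) (δ : ℝ) (hδ : 0 < δ) :
    ∃ J0 : Finset J, ∀ S : Finset J, Disjoint S J0 → ‖π ∘L B.M S ∘L ι‖ ≤ δ := by
  classical
  by_contra! hcon
  have step : ∀ a : Finset J × ℕ, ∃ (S : Finset J) (y : W') (m' : ℕ), Disjoint S a.1 ∧ a.2 < m' ∧
      (∀ i, i ∉ Set.Ico a.2 m' → Hl.ev y i = 0) ∧ ‖y‖ ≤ 1 ∧ δ / 2 ≤ ‖π (B.M S (ι y))‖ := by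
    rintro ⟨J0, m⟩
    set ε := δ / (4 * (‖π‖ + 1) * (m + 1)) with hε
    have hε0 : 0 < ε := by positivity
    choose J1 hJ1 using fun i => B.tail (ι (Hl.e i)) hε0
    obtain ⟨S, hS, hST⟩ := hcon (J0 ∪ (Finset.range m).biUnion J1)
    rw [Finset.disjoint_union_right, Finset.disjoint_biUnion_right] at hS
    set T := π ∘L B.M S ∘L ι with hT
    obtain ⟨w, hw, hTw⟩ := ContinuousLinearMap.exists_lt_apply_of_lt_opNorm T hST
    have h1 : ‖T (Hl.proj (Set.Iio m) w)‖ ≤ δ / 4 := by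
      rw [Hl.proj_Iio, map_sum]
      have : ∀ i ∈ Finset.range m, ‖T (Hl.ev w i • Hl.e i)‖ ≤ ‖π‖ * ε := by
        intro i hi
        rw [map_smul, norm_smul, Real.norm_eq_abs]
        have e1 : |Hl.ev w i| ≤ 1 := (Hl.abs_ev_le w i).trans hw.le
        have e2 : ‖T (Hl.e i)‖ ≤ ‖π‖ * ε :=
          (π.le_opNorm _).trans (by gcongr; exact (hJ1 i S (hS.2 i hi)).le)
        calc _ ≤ 1 * (‖π‖ * ε) := by gcongr
          _ = _ := one_mul _
      refine (norm_sum_le_of_le _ this).trans ?_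
      rw [Finset.sum_const, Finset.card_range, nsmul_eq_mul, hε]
      have h4 : (m : ℝ) * (‖π‖ * (δ / (4 * (‖π‖ + 1) * (m + 1)))) =
        (m / (m + 1)) * (‖π‖ / (‖π‖ + 1)) * (δ / 4) := by field_simp
      rw [h4]
      have a1 : (m : ℝ) / (m + 1) ≤ 1 := by rw [div_le_one (by positivity)]; linarith
      have a2 : ‖π‖ / (‖π‖ + 1) ≤ 1 := by rw [div_le_one (by positivity)]; linarith
      calc _ ≤ 1 * 1 * (δ / 4) := by gcongr
        _ = _ := by ring
    obtain ⟨m', hm'⟩ := Hl.tailproj w (δ / (4 * (‖T‖ + 1))) (by positivity)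
    set m2 := max m' (m + 1) with hm2
    have h2 : ‖T (Hl.proj (Set.Ici m2) w)‖ ≤ δ / 4 := by
      refine (T.le_opNorm _).trans ?_
      calc _ ≤ ‖T‖ * (δ / (4 * (‖T‖ + 1))) := by gcongr; exact hm' _ (le_max_left _ _)
        _ = (‖T‖ / (‖T‖ + 1)) * (δ / 4) := by field_simp
        _ ≤ 1 * (δ / 4) := by
          gcongr
          rw [div_le_one (by positivity)]; linarith
        _ = _ := one_mul _
    refine ⟨S, Hl.proj (Set.Ico m m2) w, m2, hS.1, by simp [hm2], ?_, ?_, ?_⟩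
    · intro i hi
      rw [Hl.ev_proj, Set.indicator_of_notMem hi]
    · exact (Hl.norm_proj_le _ _).trans hw.le
    · change δ / 2 ≤ ‖T (Hl.proj (Set.Ico m m2) w)‖
      have h3 := Hl.three m m2 (by omega) w
      have h5 := norm_add₃_le (a := T (Hl.proj (Set.Iio m) w)) (b := T (Hl.proj (Set.Ico m m2) w))
        (c := T (Hl.proj (Set.Ici m2) w))
      rw [← map_add, ← map_add, ← h3] at h5
      linarith
  choose S y m' hS hm hsupp hy hbig using step
  let a : ℕ → Finset J × ℕ := fun k => (fun p => (p.1 ∪ S p, m' p))^[k] (∅, 0)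
  have ha : ∀ k, a (k + 1) = ((a k).1 ∪ S (a k), m' (a k)) := fun k =>
    Function.iterate_succ_apply' _ _ _
  have hmono : StrictMono fun k => (a k).2 := strictMono_nat_of_lt_succ fun k => by
    simp only [ha]; exact hm _
  have hD : Pairwise (Function.onFun Disjoint fun k => Set.Ico (a k).2 (a (k + 1)).2) :=
    hmono.monotone.pairwise_disjoint_on_Ico_succ
  have hJmono : Monotone fun k => (a k).1 := monotone_nat_of_le_succ fun k => by
    simp only [ha]; exact Finset.subset_union_left
  have hSd : Pairwise (Function.onFun Disjoint fun k => S (a k)) := by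
    rw [pairwise_disjoint_on]
    intro k l hkl
    refine (Disjoint.mono_right ?_ (hS (a l))).symm
    refine le_trans ?_ (hJmono (show k + 1 ≤ l from hkl))
    simp only [ha]
    exact Finset.subset_union_right
  refine Hk.lemA hrs hs (fun k => π (B.M (S (a k)) (ι (y (a k))))) (δ / 2) (by linarith)
    (fun k => hbig _) (‖π‖ * (2 * B.C) * ‖ι‖) fun F hF ε hε => ?_
  obtain ⟨ε', hε', h⟩ := avg_aux (fun k => ε k • (π ∘L B.M (S (a k)) ∘L ι)) (fun k => y (a k)) F 0 0
  simp only [zero_apply, zero_add, smul_apply, ContinuousLinearMap.comp_apply] at h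
  refine h.trans ?_
  have e1 : ∑ n ∈ F, ε' n • ε n • (π ∘L B.M (S (a n)) ∘L ι) =
      π ∘L (∑ n ∈ F, (ε' n * ε n) • B.M (S (a n))) ∘L ι := by
    ext w
    simp [sum_apply, smul_smul]
  rw [e1]
  have e2 := B.sign (fun k => S (a k)) hSd F (fun n => ε' n * ε n) (fun n => by
    rcases hε n with h | h <;> rcases hε' n with h' | h' <;> simp [h, h'])
  have e3 := Hl.upper _ hD (fun n => ε' n • y (a n)) (by
    intro n i hi
    rw [ha] at hi
    rw [map_smul, Pi.smul_apply, hsupp _ i hi, smul_zero]) (by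
    intro n
    rw [norm_smul]
    rcases hε' n with h | h <;> simp [h, hy]) F hF
  refine (ContinuousLinearMap.le_opNorm _ _).trans ?_
  refine mul_le_mul ?_ e3 (norm_nonneg _) (by have := B.hC; positivity)
  refine (ContinuousLinearMap.opNorm_comp_le _ _).trans ?_
  rw [mul_assoc]
  gcongr
  refine (ContinuousLinearMap.opNorm_comp_le _ _).trans ?_
  gcongr


namespace SeqSp
variable {W : Type*} [NormedAddCommGroup W] [NormedSpace ℝ W] {r : ℝ} (H : SeqSp W r)

theorem exists_pull (σ : ℕ → ℕ) (hσ : Function.Injective σ) :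
    ∃ T : W →L[ℝ] W, (∀ w i, H.ev (T w) i = H.ev w (σ i)) ∧ ‖T‖ ≤ 1 := by
  obtain ⟨T, hT, hn⟩ := H.mkOp ⟨⟨fun w => H.ev w ∘ σ, by intro a b; rw [map_add]; rfl⟩, by
    intro t a
    change H.ev (t • a) ∘ σ = _
    rw [map_smul]; rfl⟩ 1 zero_le_one (by
    intro w
    simp only [one_mul]
    exact H.pull σ hσ w)
  exact ⟨T, fun w i => by rw [hT]; rfl, hn⟩

theorem exists_push (σ : ℕ → ℕ) (hσ : Function.Injective σ) :
    ∃ T : W →L[ℝ] W, (∀ w i, H.ev (T w) (σ i) = H.ev w i) ∧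
      (∀ w i, i ∉ Set.range σ → H.ev (T w) i = 0) ∧ ‖T‖ ≤ 1 := by
  choose g hg1 hg2 hg3 using H.push σ hσ
  have hext : ∀ v v' : W, (∀ i, H.ev v (σ i) = H.ev v' (σ i)) →
      (∀ i, i ∉ Set.range σ → H.ev v i = H.ev v' i) → v = v' := by
    intro v v' h1 h2
    apply H.ext'
    intro i
    by_cases h : i ∈ Set.range σ
    · obtain ⟨j, rfl⟩ := h; exact h1 j
    · exact h2 i h
  refine ⟨LinearMap.mkContinuous ⟨⟨g, ?_⟩, ?_⟩ 1 (fun v => by rw [one_mul]; exact hg3 v), hg1, hg2,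
    LinearMap.mkContinuous_norm_le _ zero_le_one _⟩
  · intro a b
    refine hext _ _ (fun i => ?_) fun i hi => ?_
    · simp [hg1]
    · simp [hg2 _ i hi]
  · intro t a
    refine hext _ _ (fun i => ?_) fun i hi => ?_
    · simp [hg1]
    · simp [hg2 _ i hi]

theorem pair_inj (n : ℕ) : Function.Injective (fun m => Nat.pair n m) := by
  intro a b h
  simpa using h

noncomputable def pr (n : ℕ) : W →L[ℝ] W := (H.exists_pull _ (pair_inj n)).choose
theorem ev_pr (n : ℕ) (w : W) (i : ℕ) : H.ev (H.pr n w) i = H.ev w (Nat.pair n i) :=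
  (H.exists_pull _ (pair_inj n)).choose_spec.1 w i
theorem norm_pr (n : ℕ) (w : W) : ‖H.pr n w‖ ≤ ‖w‖ := by
  have h := ContinuousLinearMap.le_of_opNorm_le _ (H.exists_pull _ (pair_inj n)).choose_spec.2 w
  rw [one_mul] at h
  exact h

theorem ext_pr {v w : W} (h : ∀ n, H.pr n v = H.pr n w) : v = w := by
  apply H.ext'
  intro i
  have := H.ev_pr (Nat.unpair i).1 v (Nat.unpair i).2
  rw [h, ev_pr, Nat.pair_unpair] at this
  exact this.symm

theorem exists_ampl (T : W →L[ℝ] W) : ∃ T' : W →L[ℝ] W, ∀ n w, H.pr n (T' w) = T (H.pr n w) := by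
  obtain ⟨T', hT', -⟩ := H.mkOp (V := W)
    ⟨⟨fun w i => H.ev (T (H.pr (Nat.unpair i).1 w)) (Nat.unpair i).2, by
      intro a b; ext i; simp⟩, by intro t a; ext i; simp⟩ ‖T‖ (norm_nonneg _) (by
    intro w
    have hD : Pairwise (Function.onFun Disjoint fun n => {i : ℕ | (Nat.unpair i).1 = n}) := by
      intro n k h
      rw [Function.onFun, Set.disjoint_left]
      rintro i rfl h'
      exact h h'
    choose ps hp1 hp2 hp3 using fun n => H.exists_push _ (pair_inj n)
    have hrange : ∀ n i, i ∉ {i : ℕ | (Nat.unpair i).1 = n} →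
        i ∉ Set.range (fun m => Nat.pair n m) := by
      rintro n i hi ⟨m, rfl⟩
      exact hi (by simp)
    obtain ⟨v, hv, hvn⟩ := H.P1 _ hD w (fun n => H.proj {i : ℕ | (Nat.unpair i).1 = n} w)
      (fun n => H.ev_proj _ _)
    obtain ⟨w', hw', hwn⟩ := H.P2 _ hD
      (fun i => H.ev (T (H.pr (Nat.unpair i).1 w)) (Nat.unpair i).2) (fun i _ => ⟨_, rfl⟩)
      (fun n => ps n (T (H.pr n w))) (by
        intro n
        ext i
        by_cases hi : i ∈ {i : ℕ | (Nat.unpair i).1 = n}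
        · rw [Set.indicator_of_mem hi]
          obtain rfl : (Nat.unpair i).1 = n := hi
          have := hp1 (Nat.unpair i).1 (T (H.pr (Nat.unpair i).1 w)) (Nat.unpair i).2
          rwa [Nat.pair_unpair] at this
        · rw [Set.indicator_of_notMem hi]
          exact hp2 n _ i (hrange n i hi)) (‖T‖ • v) (by
        intro n
        have e1 : H.pr n w = H.pr n (H.proj {i : ℕ | (Nat.unpair i).1 = n} w) := by
          apply H.ext'; intro i
          rw [ev_pr, ev_pr, ev_proj, Set.indicator_of_mem]
          simp
        have e2 : ‖H.pr n w‖ ≤ ‖H.proj {i : ℕ | (Nat.unpair i).1 = n} w‖ := by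
          rw [e1]; exact H.norm_pr n _
        have e3 := ContinuousLinearMap.le_of_opNorm_le _ (hp3 n) (T (H.pr n w))
        rw [map_smul, hv]
        simp only [Pi.smul_apply, smul_eq_mul, abs_mul, abs_norm]
        rw [one_mul] at e3
        refine e3.trans ((T.le_opNorm _).trans ?_)
        gcongr)
    refine ⟨w', hw', hwn.trans ?_⟩
    rw [norm_smul, norm_norm]
    gcongr)
  refine ⟨T', fun n w => ?_⟩
  apply H.ext'; intro i
  rw [ev_pr, hT']
  simp

theorem lemma1 (H : SeqSp W r) {X : Type*} [NormedAddCommGroup X] [NormedSpace ℝ X] (a : X →L[ℝ] W)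
    (b : W →L[ℝ] X) (hba : ∀ x, b (a x) = x) : Nonempty ((X × W) ≃L[ℝ] W) := by
  obtain ⟨P, hP⟩ := H.exists_ampl (a ∘L b)
  obtain ⟨i0, hi1, hi2, -⟩ := H.exists_push _ (pair_inj 0)
  have hσ : Function.Injective fun i => Nat.pair ((Nat.unpair i).1 + 1) (Nat.unpair i).2 := by
    intro i j h
    simp only [Nat.pair_eq_pair, add_left_inj] at h
    rw [← Nat.pair_unpair i, ← Nat.pair_unpair j, h.1, h.2]
  obtain ⟨sh, hs1, hs2, -⟩ := H.exists_push _ hσ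
  obtain ⟨sh', hs', -⟩ := H.exists_pull _ hσ
  have i00 : ∀ w, H.pr 0 (i0 w) = w := by
    intro w; apply H.ext'; intro i; rw [ev_pr]; exact hi1 w i
  have i0s : ∀ n w, H.pr (n + 1) (i0 w) = 0 := by
    intro n w; apply H.ext'; intro i; rw [ev_pr, hi2]
    · simp
    · rintro ⟨m, hm⟩; simp at hm
  have s0 : ∀ w, H.pr 0 (sh w) = 0 := by
    intro w; apply H.ext'; intro i; rw [ev_pr, hs2]
    · simp
    · rintro ⟨m, hm⟩; simp at hm
  have ss : ∀ n w, H.pr (n + 1) (sh w) = H.pr n w := by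
    intro n w; apply H.ext'; intro i; rw [ev_pr, ev_pr]
    have := hs1 w (Nat.pair n i)
    simpa using this
  have s's : ∀ n w, H.pr n (sh' w) = H.pr (n + 1) w := by
    intro n w; apply H.ext'; intro i; rw [ev_pr, ev_pr, hs']
    simp
  let Φ : (X × W) →L[ℝ] W := i0 ∘L a ∘L ContinuousLinearMap.fst ℝ X W +
    (1 - P + sh ∘L P) ∘L ContinuousLinearMap.snd ℝ X W
  let Ψ : W →L[ℝ] X × W := (b ∘L H.pr 0).prod (1 - P + P ∘L sh')
  have hΦ : ∀ x w, Φ (x, w) = i0 (a x) + (w - P w + sh (P w)) := fun x w => rfl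
  have hΨ1 : ∀ w, (Ψ w).1 = b (H.pr 0 w) := fun w => rfl
  have hΨ2 : ∀ w, (Ψ w).2 = w - P w + P (sh' w) := fun w => rfl
  refine ⟨ContinuousLinearEquiv.equivOfInverse Φ Ψ ?_ ?_⟩
  · rintro ⟨x, w⟩
    refine Prod.ext ?_ ?_
    · rw [hΨ1]
      simp only [hΦ, map_add, map_sub, i00, hP, s0, ContinuousLinearMap.comp_apply, hba]
      simp
    · simp only [hΨ2]
      apply H.ext_pr
      rintro (_ | n) <;>
      simp only [hΦ, map_add, map_sub, i00, i0s, hP, s0, ss, s's, ContinuousLinearMap.comp_apply,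
        hba, map_zero] <;> abel
  · intro w
    have : Ψ w = ((Ψ w).1, (Ψ w).2) := rfl
    rw [this, hΦ, hΨ1, hΨ2]
    apply H.ext_pr
    rintro (_ | n) <;>
    simp only [map_add, map_sub, i00, i0s, hP, s0, ss, s's, ContinuousLinearMap.comp_apply,
      hba, map_zero] <;> abel

theorem tendsto_proj (v : W) :
    Filter.Tendsto (fun m => H.proj (Set.Iio m) v) Filter.atTop (nhds v) := by
  rw [Metric.tendsto_atTop]
  intro ε hε
  obtain ⟨m, hm⟩ := H.tailproj v (ε / 2) (by linarith)
  refine ⟨m, fun n hn => ?_⟩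
  have h1 := H.three n n le_rfl v
  have h2 : H.proj (Set.Ico n n) v = 0 := by
    apply H.ext'; intro i; rw [ev_proj]; simp
  rw [h2, add_zero] at h1
  have h3 : H.proj (Set.Iio n) v - v = - H.proj (Set.Ici n) v := by
    nth_rewrite 2 [h1]; abel
  rw [dist_eq_norm, h3, norm_neg]
  linarith [hm n hn]

theorem op_ext {V : Type*} [NormedAddCommGroup V] [NormedSpace ℝ V] {S T : W →L[ℝ] V}
    (h : ∀ i, S (H.e i) = T (H.e i)) : S = T := by
  ext v
  refine tendsto_nhds_unique ((S.continuous.tendsto v).comp (H.tendsto_proj v)) ?_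
  refine ((T.continuous.tendsto v).comp (H.tendsto_proj v)).congr fun m => ?_
  simp only [Function.comp_apply, proj_Iio, map_sum, map_smul, h]

theorem exists_U (D : ℕ → Set ℕ) (hD : Pairwise (Function.onFun Disjoint D)) (u : ℕ → W)
    (hu : ∀ n i, i ∉ D n → H.ev (u n) i = 0) (hn : ∀ n, ‖u n‖ = 1) :
    ∃ U Φ : W →L[ℝ] W, (∀ n, U (H.e n) = u n) ∧ (∀ v, Φ (U v) = v) ∧ ‖Φ‖ ≤ 1 := by
  classical
  have hdis : ∀ n k i, i ∈ D n → i ∈ D k → k = n := by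
    intro n k i h1 h2
    by_contra h
    exact Set.disjoint_left.1 (hD h) h2 h1
  choose φ hφn hφ using fun n => exists_dual_vector ℝ (u n) (by
    rw [hn]; exact one_ne_zero)
  obtain ⟨Φ, hΦ, hΦn⟩ := H.mkOp (V := W) ⟨⟨fun w n => φ n (H.proj (D n) w), by
      intro a b; ext i; simp⟩, by intro t a; ext i; simp⟩ 1 zero_le_one (by
    intro w
    obtain ⟨v, hv, hvn⟩ := H.P1 D hD w (fun n => H.proj (D n) w) (fun n => H.ev_proj _ _)
    obtain ⟨v', hv', hvn'⟩ := H.mono v (fun n => φ n (H.proj (D n) w)) (by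
      intro n
      rw [hv, abs_norm]
      have := (φ n).le_of_opNorm_le (hφn n).le (H.proj (D n) w)
      simpa using this)
    exact ⟨v', hv', by rw [one_mul]; exact hvn'.trans hvn⟩)
  let k : ℕ → ℕ := fun i => if h : ∃ n, i ∈ D n then h.choose else 0
  have hk : ∀ n i, i ∈ D n → k i = n := by
    intro n i hi
    have h : ∃ n, i ∈ D n := ⟨n, hi⟩
    simp only [k, dif_pos h]
    exact hdis _ _ i hi h.choose_spec
  obtain ⟨U, hU, -⟩ := H.mkOp (V := W) ⟨⟨fun w i => H.ev w (k i) * H.ev (u (k i)) i, by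
      intro a b; ext i; simp [add_mul]⟩, by intro t a; ext i; simp [mul_assoc]⟩ 1 zero_le_one (by
    intro v
    simp only [one_mul]
    refine H.P2 D hD _ ?_ (fun n => H.ev v n • u n) ?_ v ?_
    · intro i hi
      refine ⟨k i, ?_⟩
      by_contra h
      apply hi
      change H.ev v (k i) * H.ev (u (k i)) i = 0
      rw [hu _ _ h, mul_zero]
    · intro n
      ext i
      rw [map_smul]
      by_cases h : i ∈ D n
      · rw [Set.indicator_of_mem h, Pi.smul_apply, smul_eq_mul]
        change _ = H.ev v (k i) * H.ev (u (k i)) i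
        rw [hk n i h]
      · rw [Set.indicator_of_notMem h, Pi.smul_apply, hu n i h, smul_zero]
    · intro n
      rw [norm_smul, hn, mul_one, Real.norm_eq_abs])
  have hU' : ∀ v i, H.ev (U v) i = H.ev v (k i) * H.ev (u (k i)) i := fun v i => by rw [hU]; rfl
  have hΦ' : ∀ w n, H.ev (Φ w) n = φ n (H.proj (D n) w) := fun v i => by rw [hΦ]; rfl
  refine ⟨U, Φ, fun n => ?_, fun v => ?_, hΦn⟩
  · apply H.ext'; intro i
    rw [hU', ev_e]
    by_cases h : i ∈ D n
    · rw [hk n i h]; simp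
    · rw [hu n i h]
      split_ifs with h'
      · rw [h', hu n i h, mul_zero]
      · rw [zero_mul]
  · apply H.ext'; intro n
    rw [hΦ']
    have : H.proj (D n) (U v) = H.ev v n • u n := by
      apply H.ext'; intro i
      rw [ev_proj, map_smul, Pi.smul_apply]
      by_cases h : i ∈ D n
      · rw [Set.indicator_of_mem h, hU', hk n i h]; rfl
      · rw [Set.indicator_of_notMem h, hu n i h, smul_zero]
    rw [this, map_smul, hφ, hn]
    simp

theorem exists_blocks {X : Type*} [NormedAddCommGroup X] [NormedSpace ℝ X]
    (hX : ¬ FiniteDimensional ℝ X) (a : X →L[ℝ] W)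
    (b : W →L[ℝ] X) (hba : ∀ x, b (a x) = x) (m : ℕ) (η : ℝ) (hη : 0 < η) :
    ∃ (y : W) (m' : ℕ), m < m' ∧ a (b y) = y ∧ ‖H.proj (Set.Ico m m') y‖ = 1 ∧
      ‖y - H.proj (Set.Ico m m') y‖ ≤ η := by
  have h1 : ∃ x : X, x ≠ 0 ∧ ∀ i, i < m → H.ev (a x) i = 0 := by
    by_contra! hcon
    apply hX
    let f : X →ₗ[ℝ] (Fin m → ℝ) := LinearMap.pi fun i =>
      (LinearMap.proj (i : ℕ)) ∘ₗ H.ev ∘ₗ (a : X →ₗ[ℝ] W)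
    refine FiniteDimensional.of_injective f ?_
    rw [← LinearMap.ker_eq_bot, LinearMap.ker_eq_bot']
    intro x hx
    by_contra hx0
    obtain ⟨i, hi, hi'⟩ := hcon x hx0
    exact hi' (congrFun hx ⟨i, hi⟩)
  obtain ⟨x, hx0, hx⟩ := h1
  have hax : a x ≠ 0 := by
    intro h; apply hx0; rw [← hba x, h, map_zero]
  set z := a x with hz
  have hzn : 0 < ‖z‖ := norm_pos_iff.2 hax
  obtain ⟨m1, hm1⟩ := H.tailproj z (min (‖z‖ / 2) (η * (‖z‖ / 2))) (by positivity)
  set m' := max m1 (m + 1) with hm'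
  have h2 := hm1 m' (le_max_left _ _)
  have h3 := H.three m m' (by omega) z
  have h4 : H.proj (Set.Iio m) z = 0 := by
    rw [proj_Iio]
    exact Finset.sum_eq_zero fun i hi => by rw [hx i (Finset.mem_range.1 hi), zero_smul]
  rw [h4, zero_add] at h3
  set q := H.proj (Set.Ico m m') z with hq
  have h5 : ‖z‖ / 2 ≤ ‖q‖ := by
    have := norm_add_le q (H.proj (Set.Ici m') z)
    rw [← h3] at this
    have := h2.trans (min_le_left _ _)
    linarith
  have hq0 : 0 < ‖q‖ := by linarith
  refine ⟨‖q‖⁻¹ • z, m', by omega, ?_, ?_, ?_⟩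
  · rw [map_smul, map_smul, hz, hba]
  · rw [map_smul, ← hq, norm_smul, norm_inv, norm_norm, inv_mul_cancel₀ hq0.ne']
  · rw [map_smul, ← hq, ← smul_sub, norm_smul, norm_inv, norm_norm]
    have h6 : z - q = H.proj (Set.Ici m') z := by rw [sub_eq_iff_eq_add']; exact h3
    rw [h6, inv_mul_le_iff₀ hq0]
    refine (h2.trans (min_le_right _ _)).trans ?_
    rw [mul_comm]
    gcongr

theorem exists_evc (n : ℕ) : ∃ f : W →L[ℝ] ℝ, (∀ w, f w = H.ev w n) ∧ ‖f‖ ≤ 1 := by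
  have hb : ∀ w, ‖(LinearMap.proj n ∘ₗ H.ev : W →ₗ[ℝ] ℝ) w‖ ≤ 1 * ‖w‖ := fun w => by
    simpa using H.abs_ev_le w n
  exact ⟨LinearMap.mkContinuous _ 1 hb, fun w => rfl,
    LinearMap.mkContinuous_norm_le _ zero_le_one _⟩

theorem exists_K [CompleteSpace W] (d : ℕ → W) (hd : ∀ n, ‖d n‖ ≤ (1 / 2 : ℝ) / 2 / 2 ^ n) :
    ∃ K : W →L[ℝ] W, ‖K‖ ≤ 1 / 2 ∧ ∀ n, K (H.e n) = d n := by
  choose evc hevc hevn using H.exists_evc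
  obtain ⟨κ, hκa, hκ⟩ : ∃ κ : ℕ → W →L[ℝ] W, (∀ n w, κ n w = evc n w • d n) ∧
      ∀ n, ‖κ n‖ ≤ (1 / 2 : ℝ) / 2 / 2 ^ n := by
    refine ⟨fun n => (evc n).smulRight (d n), fun n w => rfl, fun n => ?_⟩
    rw [ContinuousLinearMap.norm_smulRight_apply]
    refine (mul_le_mul (hevn n) (hd n) (norm_nonneg _) zero_le_one).trans (le_of_eq ?_)
    rw [one_mul]
  have hsum := hasSum_geometric_two' (1 / 2 : ℝ)
  have hκs : Summable κ := Summable.of_norm_bounded hsum.summable hκ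
  have hbd : ‖∑' n, κ n‖ ≤ 1 / 2 := tsum_of_norm_bounded hsum hκ
  refine ⟨∑' n, κ n, hbd, fun n => ?_⟩
  have h1 : HasSum (fun k => κ k (H.e n)) ((∑' n, κ n) (H.e n)) :=
    (ContinuousLinearMap.apply ℝ W (H.e n)).hasSum hκs.hasSum
  have h2 : HasSum (fun k => κ k (H.e n)) (κ n (H.e n)) := by
    refine hasSum_single n fun k hk => ?_
    rw [hκa, hevc, ev_e, if_neg hk, zero_smul]
  rw [h1.unique h2, hκa, hevc, ev_e, if_pos rfl, one_smul]

theorem lemma2 (H : SeqSp W r) [CompleteSpace W] {X : Type*} [NormedAddCommGroup X] [NormedSpace ℝ X]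
    (hX : ¬ FiniteDimensional ℝ X) (a : X →L[ℝ] W)
    (b : W →L[ℝ] X) (hba : ∀ x, b (a x) = x) :
    ∃ (β : X →L[ℝ] W) (α : W →L[ℝ] X), ∀ w, β (α w) = w := by
  choose g m' hm hg hg1 hg2 using fun (p : ℕ × ℕ) =>
    H.exists_blocks hX a b hba p.2 ((1 / 2 : ℝ) / 2 / 2 ^ p.1) (by positivity)
  let s : ℕ → ℕ × ℕ := fun k => (fun p => (p.1 + 1, m' p))^[k] (0, 0)
  have hs : ∀ k, s (k + 1) = ((s k).1 + 1, m' (s k)) := fun k =>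
    Function.iterate_succ_apply' _ _ _
  have hs1 : ∀ k, (s k).1 = k := by
    intro k
    induction k with
    | zero => rfl
    | succ k ih => rw [hs]; simp [ih]
  have hmono : StrictMono fun k => (s k).2 := strictMono_nat_of_lt_succ fun k => by
    simp only [hs]; exact hm _
  have hD : Pairwise (Function.onFun Disjoint fun k => Set.Ico (s k).2 (s (k + 1)).2) :=
    hmono.monotone.pairwise_disjoint_on_Ico_succ
  set D : ℕ → Set ℕ := fun k => Set.Ico (s k).2 (s (k + 1)).2 with hDdef
  let y : ℕ → W := fun k => g (s k)
  let u : ℕ → W := fun k => H.proj (D k) (y k)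
  have hyu : ∀ k, ‖y k - u k‖ ≤ (1 / 2 : ℝ) / 2 / 2 ^ k := by
    intro k
    have := hg2 (s k)
    simp only [y, u, hDdef, hs]
    rw [hs1] at this
    exact this
  obtain ⟨U, Φ, hU, hΦ, hΦn⟩ := H.exists_U D hD u
    (fun n i hi => by simp only [u]; rw [ev_proj, Set.indicator_of_notMem hi])
    (fun n => by
      have := hg1 (s n)
      simp only [y, u, hDdef, hs]
      exact this)
  obtain ⟨K, hKn, hKe⟩ := H.exists_K (fun n => y n - u n) hyu
  let α := U + K
  have hα : (a ∘L b) ∘L α = α := by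
    apply H.op_ext
    intro n
    have : α (H.e n) = y n := by
      simp only [α, add_apply, hU, hKe]; abel
    rw [ContinuousLinearMap.comp_apply, this]
    exact hg _
  have hun : IsUnit (1 - (-(Φ * K))) := by
    apply isUnit_one_sub_of_norm_lt_one
    rw [norm_neg]
    refine (norm_mul_le _ _).trans_lt ?_
    calc _ ≤ 1 * (1 / 2 : ℝ) := by gcongr
      _ < 1 := by norm_num
  obtain ⟨R, hR⟩ := hun.exists_left_inv
  refine ⟨R ∘L Φ ∘L a, b ∘L α, fun w => ?_⟩
  have h1 : a (b (α w)) = α w := DFunLike.congr_fun hα w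
  have h2 := DFunLike.congr_fun hR w
  simp only [ContinuousLinearMap.comp_apply, h1]
  simp only [α, add_apply, map_add, hΦ]
  simpa using h2

theorem pelc (H : SeqSp W r) [CompleteSpace W] {X : Type*} [NormedAddCommGroup X] [NormedSpace ℝ X]
    (hX : ¬ FiniteDimensional ℝ X) (a : X →L[ℝ] W)
    (b : W →L[ℝ] X) (hba : ∀ x, b (a x) = x) : Nonempty (X ≃L[ℝ] W) := by
  obtain ⟨β, α, h⟩ := H.lemma2 hX a b hba
  obtain ⟨e1⟩ := H.lemma1 a b hba
  obtain ⟨e2⟩ := H.lemma1 (X := W) 1 1 (fun _ => rfl)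
  let e3 := ContinuousLinearEquiv.equivOfRightInverse β α h
  exact ⟨e3.trans <| (e2.symm.prodCongr (.refl ℝ _)).trans <|
    (ContinuousLinearEquiv.prodAssoc ℝ W W _).trans <|
    ((ContinuousLinearEquiv.refl ℝ W).prodCongr e3.symm).trans <|
    (ContinuousLinearEquiv.prodComm ℝ W X).trans e1⟩

theorem not_fd (H : SeqSp W r) : ¬ FiniteDimensional ℝ W := by
  intro h
  have hli : LinearIndependent ℝ H.e := by
    rw [linearIndependent_iff']
    intro s g hg i hi
    have := congrFun (congrArg H.ev hg) i
    rw [map_sum, Finset.sum_apply] at this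
    simpa [ev_e, hi] using this
  have := hli.finite
  exact not_finite ℕ

end SeqSp


section lpinst

theorem lp_toReal {q : ℝ} (hq : 1 ≤ q) : (ENNReal.ofReal q).toReal = q := ENNReal.toReal_ofReal (by linarith)

variable {q : ℝ} [hF : Fact ((1 : ℝ≥0∞) ≤ ENNReal.ofReal q)]

theorem lp_mk (hq : 1 ≤ q) (v : ℕ → ℝ) (A : ℝ) (hA : 0 ≤ A)
    (h : ∀ F : Finset ℕ, ∑ i ∈ F, |v i| ^ q ≤ A ^ q) :
    ∃ w : lp (fun _ : ℕ => ℝ) (ENNReal.ofReal q), (w : ℕ → ℝ) = v ∧ ‖w‖ ≤ A := by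
  have hm : Memℓp v (ENNReal.ofReal q) := by
    refine memℓp_gen' (C := A ^ q) fun s => ?_
    rw [lp_toReal hq]; exact h s
  refine ⟨⟨v, hm⟩, rfl, ?_⟩
  refine lp.norm_le_of_forall_sum_le (by rw [lp_toReal hq]; linarith) hA fun s => ?_
  rw [lp_toReal hq]; exact h s

theorem lp_sum_le (hq : 1 ≤ q) (w : lp (fun _ : ℕ => ℝ) (ENNReal.ofReal q)) (F : Finset ℕ) :
    ∑ i ∈ F, |w i| ^ q ≤ ‖w‖ ^ q := by
  have := lp.sum_rpow_le_norm_rpow (by rw [lp_toReal hq]; linarith) w F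
  rw [lp_toReal hq] at this
  exact this

theorem lp_hasSum (hq : 1 ≤ q) (w : lp (fun _ : ℕ => ℝ) (ENNReal.ofReal q)) :
    HasSum (fun i => |w i| ^ q) (‖w‖ ^ q) := by
  have := lp.hasSum_norm (by rw [lp_toReal hq]; linarith) w
  rw [lp_toReal hq] at this
  exact this

theorem lp_seqSp (hq : 1 ≤ q) :
    Nonempty (SeqSp (lp (fun _ : ℕ => ℝ) (ENNReal.ofReal q)) (1 / q)) := by
  classical
  have hq0 : 0 < q := by linarith
  refine ⟨SeqSp.mk ⟨⟨fun w => w, fun a b => rfl⟩, fun t a => rfl⟩ ?_ ?_ ?_ ?_ ?_ ?_ ?_ ?_⟩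
  · intro a b h
    exact Subtype.ext h
  · intro w v h
    refine lp_mk hq v ‖w‖ (norm_nonneg _) fun F => le_trans ?_ (lp_sum_le hq w F)
    exact Finset.sum_le_sum fun i _ => Real.rpow_le_rpow (abs_nonneg _) (h i) hq0.le
  · intro F hF
    have hc : ((F.card : ℝ) ^ (1 / q)) ^ q = F.card := by
      rw [← Real.rpow_mul (by positivity), one_div_mul_cancel hq0.ne', Real.rpow_one]
    have hs : ∀ i, |(F : Set ℕ).indicator (1 : ℕ → ℝ) i| ^ q = if i ∈ F then 1 else 0 := by
      intro i
      by_cases h : i ∈ F <;> simp [h, hq0.ne']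
    obtain ⟨w, hw, hwn⟩ := lp_mk hq ((F : Set ℕ).indicator 1) ((F.card : ℝ) ^ (1 / q))
      (by positivity) (by
        intro G
        rw [hc]
        simp only [hs]
        rw [Finset.sum_ite_mem, Finset.sum_const, nsmul_eq_mul, mul_one]
        exact_mod_cast Finset.card_le_card Finset.inter_subset_right)
    refine ⟨w, hw, le_antisymm hwn ?_⟩
    have h1 := lp_sum_le hq w F
    rw [hw] at h1
    simp only [hs] at h1
    rw [Finset.sum_ite_mem, Finset.sum_const, nsmul_eq_mul, mul_one, Finset.inter_self, ← hc] at h1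
    exact (Real.rpow_le_rpow_iff (by positivity) (norm_nonneg _) hq0).1 h1
  · intro w ε hε
    have h1 := (lp_hasSum hq w).summable
    rw [summable_iff_vanishing_norm] at h1
    obtain ⟨s, hs⟩ := h1 (ε ^ q) (by positivity)
    refine ⟨s.sup id + 1, fun w' h0 hle => ?_⟩
    obtain ⟨w2, hw2, hwn⟩ := lp_mk hq w' ε hε.le (by
      intro F
      have h2 := hs (F \ s) Finset.sdiff_disjoint
      rw [Real.norm_of_nonneg (Finset.sum_nonneg fun i _ => by positivity)] at h2
      refine le_trans ?_ h2.le
      rw [← Finset.sum_sdiff (Finset.inter_subset_left (s₁ := F) (s₂ := s)),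
        Finset.sdiff_inter_self_left]
      have h3 : ∑ i ∈ F ∩ s, |w' i| ^ q = 0 := by
        refine Finset.sum_eq_zero fun i hi => ?_
        have h4 : w' i = 0 := h0 i (by
          have := Finset.le_sup (f := id) (Finset.mem_inter.1 hi).2
          simp only [id] at this
          omega)
        rw [h4, abs_zero, Real.zero_rpow hq0.ne']
      rw [h3, add_zero]
      exact Finset.sum_le_sum fun i _ => Real.rpow_le_rpow (abs_nonneg _) (hle i) hq0.le)
    obtain rfl : w2 = w' := Subtype.ext hw2
    exact hwn
  · intro D hD w y hy
    obtain ⟨v, hv, hvn⟩ := lp_mk hq (fun n => ‖y n‖) ‖w‖ (norm_nonneg _) (by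
      intro F
      simp only [abs_norm]
      refine hasSum_le ?_ (hasSum_sum fun n (_ : n ∈ F) => lp_hasSum hq (y n)) (lp_hasSum hq w)
      intro i
      have hy' : ∀ n, (y n : ℕ → ℝ) i = (D n).indicator w i := fun n => congrFun (hy n) i
      simp only [hy']
      by_cases h : ∃ n ∈ F, i ∈ D n
      · obtain ⟨n, hn, hi⟩ := h
        rw [Finset.sum_eq_single n]
        · rw [Set.indicator_of_mem hi]
        · intro k _ hk
          rw [Set.indicator_of_notMem, abs_zero, Real.zero_rpow hq0.ne']
          exact fun h' => Set.disjoint_left.1 (hD hk) h' hi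
        · exact fun h => absurd hn h
      · push Not at h
        rw [Finset.sum_eq_zero]
        · positivity
        · intro k hk
          rw [Set.indicator_of_notMem (h k hk), abs_zero, Real.zero_rpow hq0.ne'])
    exact ⟨v, hv, hvn⟩
  · intro D hD w hw y hy v hv
    refine lp_mk hq w ‖v‖ (norm_nonneg _) fun F => ?_
    have hk : ∀ i, ∃ n, w i ≠ 0 → i ∈ D n := by
      intro i
      by_cases h : w i = 0
      · exact ⟨0, fun h' => absurd h h'⟩
      · obtain ⟨n, hn⟩ := hw i h
        exact ⟨n, fun _ => hn⟩
    choose k hk using hk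
    have h1 : ∑ n ∈ F.image k, ∑ i ∈ F, |y n i| ^ q ≤ ‖v‖ ^ q := by
      refine le_trans ?_ (lp_sum_le hq v (F.image k))
      refine Finset.sum_le_sum fun n _ => (lp_sum_le hq (y n) F).trans ?_
      exact Real.rpow_le_rpow (norm_nonneg _) (hv n) hq0.le
    refine le_trans ?_ h1
    rw [Finset.sum_comm]
    refine Finset.sum_le_sum fun i hi => ?_
    have h2 : |w i| ^ q = |y (k i) i| ^ q ∨ w i = 0 := by
      by_cases h : w i = 0
      · exact Or.inr h
      · left
        have h3 := congrFun (hy (k i)) i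
        rw [Set.indicator_of_mem (hk i h)] at h3
        rw [← h3]; rfl
    rcases h2 with h2 | h2
    · rw [h2]
      exact Finset.single_le_sum (f := fun n => |y n i| ^ q) (fun n _ => by positivity)
        (Finset.mem_image_of_mem k hi)
    · rw [h2, abs_zero, Real.zero_rpow hq0.ne']
      exact Finset.sum_nonneg fun n _ => by positivity
  · intro σ hσ w
    refine lp_mk hq _ ‖w‖ (norm_nonneg _) fun F => ?_
    refine le_trans (le_of_eq ?_) (lp_sum_le hq w (F.map ⟨σ, hσ⟩))
    rw [Finset.sum_map]; rfl
  · intro σ hσ w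
    obtain ⟨w', hw', hn⟩ := lp_mk hq (Function.extend σ w 0) ‖w‖ (norm_nonneg _) (by
      intro F
      refine le_trans (le_of_eq ?_) (lp_sum_le hq w (F.preimage σ hσ.injOn))
      rw [← Finset.sum_preimage σ F hσ.injOn]
      · simp only [hσ.extend_apply]
      · intro i _ hi
        rw [Function.extend_apply' _ _ _ hi]
        simp [hq0.ne'])
    refine ⟨w', fun i => ?_, fun i hi => ?_, hn⟩
    · change (w' : ℕ → ℝ) (σ i) = w i
      rw [hw', hσ.extend_apply]
    · change (w' : ℕ → ℝ) i = 0
      rw [hw', Function.extend_apply' _ _ _ hi]; rfl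

end lpinst

theorem c0_norm_le (w : C₀(ℕ, ℝ)) {A : ℝ} (hA : 0 ≤ A) : ‖w‖ ≤ A ↔ ∀ i, |w i| ≤ A := by
  rw [← ZeroAtInftyContinuousMap.norm_toBCF_eq_norm, BoundedContinuousFunction.norm_le hA]
  rfl

theorem c0_le_norm (w : C₀(ℕ, ℝ)) (i : ℕ) : |w i| ≤ ‖w‖ := (c0_norm_le w (norm_nonneg _)).1 le_rfl i

theorem c0_fin (w : C₀(ℕ, ℝ)) {ε : ℝ} (hε : 0 < ε) : {i | ε ≤ |w i|}.Finite := by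
  have h := w.zero_at_infty'
  rw [Filter.cocompact_eq_cofinite] at h
  have h1 := h.norm
  rw [norm_zero] at h1
  have h2 := h1.eventually_lt_const hε
  rw [Filter.eventually_cofinite] at h2
  refine h2.subset fun i hi => ?_
  exact not_lt.2 hi

theorem c0_mk (v : ℕ → ℝ) (A : ℝ) (hA : 0 ≤ A) (h : ∀ i, |v i| ≤ A)
    (h' : ∀ ε > 0, {i | ε ≤ |v i|}.Finite) : ∃ w : C₀(ℕ, ℝ), (w : ℕ → ℝ) = v ∧ ‖w‖ ≤ A := by
  have : Filter.Tendsto v (Filter.cocompact ℕ) (nhds 0) := by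
    rw [Filter.cocompact_eq_cofinite]
    rw [tendsto_zero_iff_norm_tendsto_zero, tendsto_order]
    refine ⟨fun a ha => Filter.Eventually.of_forall fun i => ha.trans_le (norm_nonneg _),
      fun a ha => ?_⟩
    rw [Filter.eventually_cofinite]
    refine (h' a ha).subset fun i hi => ?_
    exact not_lt.1 hi
  refine ⟨⟨⟨v, continuous_of_discreteTopology⟩, this⟩, rfl, ?_⟩
  rw [c0_norm_le _ hA]
  exact h

theorem c0_seqSp : Nonempty (SeqSp C₀(ℕ, ℝ) 0) := by
  classical
  refine ⟨SeqSp.mk ⟨⟨fun w => w, fun a b => rfl⟩, fun t a => rfl⟩ ?_ ?_ ?_ ?_ ?_ ?_ ?_ ?_⟩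
  · intro a b h
    exact DFunLike.coe_injective h
  · intro w v h
    exact c0_mk v ‖w‖ (norm_nonneg _) (fun i => (h i).trans (c0_le_norm w i))
      fun ε hε => (c0_fin w hε).subset fun i hi => le_trans hi (h i)
  · intro F hF
    rw [Real.rpow_zero]
    obtain ⟨w, hw, hn⟩ := c0_mk ((F : Set ℕ).indicator 1) 1 zero_le_one (by
      intro i
      by_cases h : i ∈ F <;> simp [h]) (by
      intro ε hε
      refine F.finite_toSet.subset fun i hi => ?_
      by_contra h
      rw [Set.mem_ofPred_eq, Set.indicator_of_notMem h, abs_zero] at hi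
      linarith)
    refine ⟨w, hw, le_antisymm hn ?_⟩
    obtain ⟨i, hi⟩ := hF
    have := c0_le_norm w i
    rw [hw] at this
    simpa [hi] using this
  · intro w ε hε
    have h1 := c0_fin w hε
    refine ⟨h1.toFinset.sup id + 1, fun w' h0 hle => ?_⟩
    rw [c0_norm_le _ hε.le]
    intro i
    by_cases h : ε ≤ |w i|
    · have h2 : w' i = 0 := h0 i (by
        have := Finset.le_sup (f := id) (h1.mem_toFinset.2 h)
        simp only [id] at this
        omega)
      rw [h2, abs_zero]; exact hε.le
    · exact (hle i).trans (not_le.1 h).le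
  · intro D hD w y hy
    have hy' : ∀ n i, y n i = (D n).indicator w i := fun n i => congrFun (hy n) i
    have hle : ∀ n, ‖y n‖ ≤ ‖w‖ := by
      intro n
      rw [c0_norm_le _ (norm_nonneg _)]
      intro i
      rw [hy']
      by_cases h : i ∈ D n
      · rw [Set.indicator_of_mem h]; exact c0_le_norm w i
      · rw [Set.indicator_of_notMem h, abs_zero]; exact norm_nonneg _
    refine c0_mk (fun n => ‖y n‖) ‖w‖ (norm_nonneg _) (fun n => by rw [abs_norm]; exact hle n) ?_
    intro ε hε
    refine ((c0_fin w (half_pos hε)).biUnion (t := fun i => {n | i ∈ D n}) ?_).subset ?_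
    · intro i _
      refine Set.Subsingleton.finite fun n hn k hk => ?_
      by_contra h
      exact Set.disjoint_left.1 (hD h) hn hk
    · intro n hn
      rw [Set.mem_ofPred_eq, abs_norm] at hn
      by_contra hcon
      simp only [Set.mem_iUnion, Set.mem_ofPred_eq, not_exists] at hcon
      have : ‖y n‖ ≤ ε / 2 := by
        rw [c0_norm_le _ (half_pos hε).le]
        intro i
        rw [hy']
        by_cases h : i ∈ D n
        · rw [Set.indicator_of_mem h]
          by_contra h2
          exact hcon i (not_le.1 h2).le h
        · rw [Set.indicator_of_notMem h, abs_zero]; exact (half_pos hε).le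
      linarith
  · intro D hD w hw y hy v hv
    have hwy : ∀ i, w i ≠ 0 → ∃ n, w i = y n i := by
      intro i hi
      obtain ⟨n, hn⟩ := hw i hi
      have h3 := congrFun (hy n) i
      rw [Set.indicator_of_mem hn] at h3
      exact ⟨n, h3.symm⟩
    refine c0_mk w ‖v‖ (norm_nonneg _) ?_ ?_
    · intro i
      by_cases h : w i = 0
      · rw [h, abs_zero]; exact norm_nonneg _
      · obtain ⟨n, hn⟩ := hwy i h
        rw [hn]
        exact (c0_le_norm _ _).trans ((hv n).trans (c0_le_norm v n))
    · intro ε hε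
      refine ((c0_fin v hε).biUnion (t := fun n => {i | ε ≤ |y n i|}) fun n _ =>
        c0_fin (y n) hε).subset ?_
      intro i hi
      have hi' : ε ≤ |w i| := hi
      have h0 : w i ≠ 0 := by
        intro h; rw [h, abs_zero] at hi'; linarith
      obtain ⟨n, hn⟩ := hwy i h0
      rw [hn] at hi'
      simp only [Set.mem_iUnion]
      exact ⟨n, hi'.trans ((c0_le_norm _ _).trans (hv n)), hi'⟩
  · intro σ hσ w
    exact c0_mk _ ‖w‖ (norm_nonneg _) (fun i => c0_le_norm w _)
      fun ε hε => ((c0_fin w hε).preimage (f := σ) hσ.injOn).subset fun i hi => hi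
  · intro σ hσ w
    obtain ⟨w', hw', hn⟩ := c0_mk (Function.extend σ w 0) ‖w‖ (norm_nonneg _) (by
      intro i
      by_cases hi : ∃ j, σ j = i
      · obtain ⟨j, rfl⟩ := hi
        rw [hσ.extend_apply]; exact c0_le_norm w j
      · rw [Function.extend_apply' _ _ _ hi]; simp) (by
      intro ε hε
      refine ((c0_fin w hε).image σ).subset fun i hi => ?_
      by_cases h : ∃ j, σ j = i
      · obtain ⟨j, rfl⟩ := h
        rw [Set.mem_ofPred_eq, hσ.extend_apply] at hi
        exact ⟨j, hi, rfl⟩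
      · rw [Set.mem_ofPred_eq, Function.extend_apply' _ _ _ h] at hi
        simp at hi; linarith)
    refine ⟨w', fun i => ?_, fun i hi => ?_, hn⟩
    · change (w' : ℕ → ℝ) (σ i) = w i
      rw [hw', hσ.extend_apply]
    · change (w' : ℕ → ℝ) i = 0
      rw [hw', Function.extend_apply' _ _ _ hi]; rfl


section fac
variable {Z : Type*} [NormedAddCommGroup Z] [NormedSpace ℝ Z]

def Fac (W : Type*) [NormedAddCommGroup W] [NormedSpace ℝ W] (T : Z →L[ℝ] Z) : Prop :=
  ∃ (a : Z →L[ℝ] W) (b : W →L[ℝ] Z), ∀ z, b (a z) = T z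

variable {W : Type*} [NormedAddCommGroup W] [NormedSpace ℝ W] {r : ℝ}

theorem Fac.add (H : SeqSp W r) {S T : Z →L[ℝ] Z} (hS : Fac W S) (hT : Fac W T) :
    Fac W (S + T) := by
  obtain ⟨a, b, h⟩ := hS
  obtain ⟨a', b', h'⟩ := hT
  obtain ⟨e⟩ := H.lemma1 (X := W) 1 1 (fun _ => rfl)
  refine ⟨(e : (W × W) →L[ℝ] W) ∘L (a.prod a'), (b.coprod b') ∘L (e.symm : W →L[ℝ] W × W), fun z => ?_⟩
  simp [h, h']

theorem Fac.rankOne (H : SeqSp W r) (f : Z →L[ℝ] ℝ) (x : Z) : Fac W (f.smulRight x) := by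
  obtain ⟨φ, hφ, -⟩ := H.exists_evc 0
  refine ⟨f.smulRight (H.e 0), φ.smulRight x, fun z => ?_⟩
  simp [hφ, H.ev_e]

theorem Fac.finite (H : SeqSp W r) {J : Type*} {x : J → Z} (B : UB J Z x) (G : Finset J) :
    Fac W (B.M G) := by
  classical
  induction G using Finset.induction_on with
  | empty => exact ⟨0, 0, fun z => by simp [B.M_empty]⟩
  | insert j G hj ih =>
    rw [Finset.coe_insert, Set.insert_eq, B.M_union (by simpa using hj)]
    refine Fac.add H ?_ ih
    have : B.M {j} = (B.c j).smulRight (x j) := by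
      ext z; rw [B.M_singleton]; rfl
    rw [this]
    exact Fac.rankOne H _ _

end fac

section span
variable {J Z : Type*} [NormedAddCommGroup Z] [NormedSpace ℝ Z] {x : J → Z} (B : UB J Z x)

theorem UB.M_x {S : Set J} {j : J} (hj : j ∈ S) : B.M S (x j) = x j := by
  refine B.ext_c fun k => ?_
  rw [B.c_M]
  by_cases h : k ∈ S
  · rw [Set.indicator_of_mem h]
  · rw [Set.indicator_of_notMem h, B.bi]
    rintro rfl; exact h hj

theorem UB.M_mem (S : Set J) (f : Z) :
    B.M S f ∈ (Submodule.span ℝ (x '' S)).topologicalClosure := by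
  have h := B.sumM S f
  refine (Submodule.isClosed_topologicalClosure _).mem_of_tendsto h
    (Filter.Eventually.of_forall fun F => ?_)
  refine Submodule.sum_mem _ fun j _ => ?_
  by_cases hj : j ∈ S
  · rw [Set.indicator_of_mem hj]
    exact Submodule.smul_mem _ _ (Submodule.le_topologicalClosure _
      (Submodule.subset_span ⟨j, hj, rfl⟩))
  · rw [Set.indicator_of_notMem hj]; exact Submodule.zero_mem _

theorem UB.M_eq (S : Set J) (f : Z) (hf : f ∈ (Submodule.span ℝ (x '' S)).topologicalClosure) :
    B.M S f = f := by
  have h : (Submodule.span ℝ (x '' S)).topologicalClosure ≤ (B.M S - 1).ker := by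
    refine Submodule.topologicalClosure_minimal _ ?_ (ContinuousLinearMap.isClosed_ker _)
    rw [Submodule.span_le]
    rintro _ ⟨j, hj, rfl⟩
    simp [B.M_x hj]
  have h1 := h hf
  simpa [sub_eq_zero] using h1

theorem UB.not_fd (B : UB J Z x) (S : Set J) (hS : S.Infinite) :
    ¬ FiniteDimensional ℝ (Submodule.span ℝ (x '' S)).topologicalClosure := by
  classical
  intro hfd
  let v : S → (Submodule.span ℝ (x '' S)).topologicalClosure := fun j =>
    ⟨x j, Submodule.le_topologicalClosure _ (Submodule.subset_span ⟨j, j.2, rfl⟩)⟩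
  have hli : LinearIndependent ℝ v := by
    rw [linearIndependent_iff']
    intro s g hg i hi
    have h1 := congrArg (fun z : (Submodule.span ℝ (x '' S)).topologicalClosure =>
      B.c i (z : Z)) hg
    simp only [AddSubmonoidClass.coe_finsetSum, map_sum] at h1
    rw [Finset.sum_eq_single i] at h1
    · simpa [v, B.bi'] using h1
    · intro k _ hk
      simp [v, B.bi i k (fun h => hk (Subtype.ext h.symm))]
    · exact fun h => absurd hi h
  have := hli.finite
  exact hS (Set.toFinite S)

theorem UB.iso {W : Type*} [NormedAddCommGroup W] [NormedSpace ℝ W] [CompleteSpace W] {r : ℝ}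
    (H : SeqSp W r) (S : Set J) (hS : S.Infinite) (hf : Fac W (B.M S)) :
    Nonempty ((Submodule.span ℝ (x '' S)).topologicalClosure ≃L[ℝ] W) := by
  obtain ⟨a, b, h⟩ := hf
  refine H.pelc (B.not_fd S hS) (a ∘L Submodule.subtypeL _)
    ((B.M S ∘L b).codRestrict _ fun w => B.M_mem S _) fun z => ?_
  apply Subtype.ext
  change B.M S (b (a z)) = z
  rw [h, B.M_eq S z z.2, B.M_eq S z z.2]

end span

theorem abstract_main {J Z I : Type*} [NormedAddCommGroup Z] [NormedSpace ℝ Z] [CompleteSpace Z]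
    [Fintype I] [DecidableEq I] [Nonempty I] (W : I → Type*) [∀ i, NormedAddCommGroup (W i)]
    [∀ i, NormedSpace ℝ (W i)] [∀ i, CompleteSpace (W i)] (r : I → ℝ) (hr : Function.Injective r)
    (hr1 : ∀ i, r i ≤ 1) (H : ∀ i, SeqSp (W i) (r i)) (ι : ∀ i, W i →L[ℝ] Z)
    (π : ∀ i, Z →L[ℝ] W i) (hιn : ∀ i, ‖ι i‖ ≤ 1) (hπn : ∀ i, ‖π i‖ ≤ 1)
    (hπι : ∀ i w, π i (ι i w) = w) (horth : ∀ i k, i ≠ k → ∀ w, π i (ι k w) = 0)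
    (hsum : ∀ z, ∑ i, ι i (π i z) = z) (x : J → Z) (B : UB J Z x) :
    ∃ idx : J → I, ∀ i,
      Nonempty ((Submodule.span ℝ (x '' {j | idx j = i})).topologicalClosure ≃L[ℝ] W i) := by
  classical
  let E : I → Z →L[ℝ] Z := fun i => ι i ∘L π i
  have hEa : ∀ i z, E i z = ι i (π i z) := fun i z => rfl
  have idem : ∀ i, E i * E i = E i := fun i => by
    ext z; simp [hEa, hπι]
  have orth : ∀ i k, i ≠ k → E i * E k = 0 := fun i k h => by
    ext z; simp [hEa, horth i k h]
  have hEsum : ∑ i, E i = 1 := by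
    ext z; simp only [sum_apply, hEa, hsum]; rfl
  have hEn : ∀ i, ‖E i‖ ≤ 1 := fun i =>
    (ContinuousLinearMap.opNorm_comp_le _ _).trans (mul_le_one₀ (hιn i) (norm_nonneg _) (hπn i))
  obtain ⟨δ, hδ, hV⟩ := left_inv_aux E r hr idem orth hEsum hEn B.C B.hC
  set N : ℝ := ((Fintype.card I : ℕ) : ℝ) with hN
  have hN0 : 0 ≤ N := by positivity
  obtain ⟨J0, idx, hidx⟩ := split_core B E r hr idem hEsum hEn (by
    intro k l hkl δ hδ
    obtain ⟨J0, hJ0⟩ := key_lemma B (H k) (H l) hkl (hr1 k) (π k) (ι l) δ hδ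
    refine ⟨J0, fun S hS => ?_⟩
    have e : E k * B.M S * E l = ι k ∘L (π k ∘L B.M S ∘L ι l) ∘L π l := rfl
    rw [e]
    refine (ContinuousLinearMap.opNorm_comp_le _ _).trans ?_
    have h1 := (ContinuousLinearMap.opNorm_comp_le (π k ∘L B.M S ∘L ι l) (π l))
    have h2 : ‖(π k ∘L B.M S ∘L ι l) ∘L π l‖ ≤ δ := by
      calc _ ≤ ‖π k ∘L B.M S ∘L ι l‖ * ‖π l‖ := h1
        _ ≤ δ * 1 := by gcongr; exacts [hJ0 S hS, hπn l]
        _ = δ := mul_one _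
    calc _ ≤ 1 * δ := by gcongr; exact hιn k
      _ = δ := one_mul _) (min δ (1 / (2 * (N + 1)))) (by positivity)
  refine ⟨idx, fun i => ?_⟩
  let S : I → Set J := fun k => {j | j ∉ J0 ∧ idx j = k}
  have hS : ∀ k, ∀ j ∈ S k, j ∉ J0 ∧ idx j = k := fun k j hj => hj
  have hinf : {j | idx j = i}.Infinite := by
    intro hfin
    let G : Finset J := J0 ∪ hfin.toFinset
    have h1 : ∃ w : W i, w ≠ 0 ∧ ∀ j ∈ G, B.c j (ι i w) = 0 := by
      by_contra! hcon
      apply (H i).not_fd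
      let f : W i →ₗ[ℝ] (G → ℝ) := LinearMap.pi fun j =>
        ((B.c j ∘L ι i : W i →L[ℝ] ℝ) : W i →ₗ[ℝ] ℝ)
      refine FiniteDimensional.of_injective f ?_
      rw [← LinearMap.ker_eq_bot, LinearMap.ker_eq_bot']
      intro w hw
      by_contra hw0
      obtain ⟨j, hj, hj'⟩ := hcon w hw0
      exact hj' (congrFun hw ⟨j, hj⟩)
    obtain ⟨w, hw0, hw⟩ := h1
    set z := ι i w with hz
    have hz0 : 0 < ‖z‖ := by
      rw [norm_pos_iff]
      intro h
      apply hw0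
      rw [← hπι i w, ← hz, h, map_zero]
    have hEz : E i z = z := by rw [hEa, hz, hπι]
    have h2 : ∑ k, B.M (S k) z = z := by
      refine B.ext_c fun j => ?_
      rw [map_sum]
      simp only [B.c_M]
      by_cases hj : j ∈ J0
      · rw [hw j (Finset.mem_union_left _ hj)]
        refine Finset.sum_eq_zero fun k _ => ?_
        exact Set.indicator_of_notMem (fun h => (hS k j h).1 hj) _
      · rw [Finset.sum_eq_single (idx j)]
        · exact Set.indicator_of_mem (show j ∈ S (idx j) from ⟨hj, rfl⟩) _
        · intro k _ hk
          exact Set.indicator_of_notMem (fun h => hk (hS k j h).2.symm) _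
        · exact fun h => absurd (Finset.mem_univ _) h
    have h3 : B.M (S i) z = 0 := by
      refine B.ext_c fun j => ?_
      rw [B.c_M, map_zero]
      by_cases hj : j ∈ S i
      · rw [Set.indicator_of_mem hj]
        exact hw j (Finset.mem_union_right _ (hfin.mem_toFinset.2 hj.2))
      · exact Set.indicator_of_notMem hj _
    have h4 : ∀ k ∈ Finset.univ, ‖E i (B.M (S k) z)‖ ≤ 1 / (2 * (N + 1)) * ‖z‖ := by
      intro k _
      by_cases hk : k = i
      · rw [hk, h3, map_zero, norm_zero]; positivity
      · have h5 := (hidx k (S k) (hS k)).2 i (Ne.symm hk)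
        have h6 := ContinuousLinearMap.le_of_opNorm_le _ (h5.trans (min_le_right _ _)) z
        have h7 : (E i * B.M (S k) * E i) z = E i (B.M (S k) z) := by
          change E i (B.M (S k) (E i z)) = _
          rw [hEz]
        rwa [h7] at h6
    have h5 := norm_sum_le_of_le _ h4
    rw [← map_sum, h2, hEz, Finset.sum_const, Finset.card_univ, nsmul_eq_mul, ← hN] at h5
    have h6 : N * (1 / (2 * (N + 1)) * ‖z‖) = N / (2 * (N + 1)) * ‖z‖ := by ring
    have h7 : N / (2 * (N + 1)) < 1 := by rw [div_lt_one (by positivity)]; linarith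
    rw [h6] at h5
    nlinarith
  refine B.iso (H i) _ hinf ?_
  obtain ⟨g1, g2⟩ := hidx i (S i) (hS i)
  obtain ⟨V, hV⟩ := hV (B.M (S i)) (B.M_idem _) (B.normM _) i
    (fun k l h => (g1 k l h).trans (min_le_left _ _)) (fun k h => (g2 k h).trans (min_le_left _ _))
  have hfac : Fac (W i) (B.M (S i)) :=
    ⟨π i ∘L B.M (S i), V ∘L B.M (S i) ∘L ι i, fun z => DFunLike.congr_fun hV z⟩
  have hdec : {j | idx j = i} = S i ∪ ((J0.filter fun j => idx j = i : Finset J) : Set J) := by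
    ext j
    by_cases h : j ∈ J0 <;> simp [S, h]
  have hdis : Disjoint (S i) ((J0.filter fun j => idx j = i : Finset J) : Set J) := by
    rw [Set.disjoint_left]
    intro j hj hj'
    exact hj.1 (Finset.mem_filter.1 (Finset.mem_coe.1 hj')).1
  rw [hdec, B.M_union hdis]
  exact Fac.add (H i) hfac (Fac.finite (H i) B _)


def Wf (A : Finset {q : ℝ // 1 ≤ q}) : Option A → Type
  | none => C₀(ℕ, ℝ)
  | some p => ellp p.1.1

instance Wf.instN (A : Finset {q : ℝ // 1 ≤ q}) : ∀ i, NormedAddCommGroup (Wf A i)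
  | none => inferInstanceAs (NormedAddCommGroup C₀(ℕ, ℝ))
  | some p => inferInstanceAs (NormedAddCommGroup (ellp p.1.1))

instance Wf.instS (A : Finset {q : ℝ // 1 ≤ q}) : ∀ i, NormedSpace ℝ (Wf A i)
  | none => inferInstanceAs (NormedSpace ℝ C₀(ℕ, ℝ))
  | some p => inferInstanceAs (NormedSpace ℝ (ellp p.1.1))

instance Wf.instC (A : Finset {q : ℝ // 1 ≤ q}) : ∀ i, CompleteSpace (Wf A i)
  | none => inferInstanceAs (CompleteSpace C₀(ℕ, ℝ))
  | some p => inferInstanceAs (CompleteSpace (ellp p.1.1))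

def Wf.r (A : Finset {q : ℝ // 1 ≤ q}) : Option A → ℝ
  | none => 0
  | some p => 1 / p.1.1

abbrev Zf (A : Finset {q : ℝ // 1 ≤ q}) : Type := (PiLp ⊤ (fun p : A => ellp p.1.1)) × C₀(ℕ, ℝ)

theorem Wf.exists_inc (A : Finset {q : ℝ // 1 ≤ q}) (p : A) : ∃ T : ellp p.1.1 →L[ℝ] Zf A,
    (∀ w, T w = (WithLp.toLp ⊤ (Pi.single p w), 0)) ∧ ‖T‖ ≤ 1 := by
  have h : ∀ w : ellp p.1.1, ‖((WithLp.toLp ⊤ (Pi.single p w), 0) : Zf A)‖ ≤ 1 * ‖w‖ := by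
    intro w
    rw [Prod.norm_mk, norm_zero, one_mul]
    refine max_le ?_ (norm_nonneg _)
    exact (PiLp.norm_single ⊤ (fun p : A => ellp p.1.1) p w).le
  refine ⟨LinearMap.mkContinuous ⟨⟨fun w => (WithLp.toLp ⊤ (Pi.single p w), 0), ?_⟩, ?_⟩ 1 h,
    fun w => rfl, LinearMap.mkContinuous_norm_le _ zero_le_one _⟩
  · intro a b
    rw [Pi.single_add, WithLp.toLp_add, Prod.mk_add_mk, add_zero]
  · intro t a
    change ((WithLp.toLp ⊤ (Pi.single p (t • a)), 0) : Zf A) = t • (WithLp.toLp ⊤ (Pi.single p a), 0)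
    rw [Pi.single_smul, WithLp.toLp_smul, Prod.smul_mk, smul_zero]

theorem Wf.exists_proj (A : Finset {q : ℝ // 1 ≤ q}) (p : A) : ∃ T : Zf A →L[ℝ] ellp p.1.1,
    (∀ z, T z = z.1 p) ∧ ‖T‖ ≤ 1 := by
  have h : ∀ z : Zf A, ‖z.1 p‖ ≤ 1 * ‖z‖ := by
    intro z
    rw [one_mul]
    exact (PiLp.norm_apply_le z.1 p).trans (norm_fst_le z)
  refine ⟨LinearMap.mkContinuous ⟨⟨fun z => z.1 p, fun _ _ => rfl⟩, fun _ _ => rfl⟩ 1 h,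
    fun w => rfl, LinearMap.mkContinuous_norm_le _ zero_le_one _⟩

def Wf.inc (A : Finset {q : ℝ // 1 ≤ q}) : ∀ i, Wf A i →L[ℝ] Zf A
  | none => ContinuousLinearMap.inr ℝ (PiLp ⊤ (fun p : A => ellp p.1.1)) C₀(ℕ, ℝ)
  | some p => (Wf.exists_inc A p).choose

def Wf.prj (A : Finset {q : ℝ // 1 ≤ q}) : ∀ i, Zf A →L[ℝ] Wf A i
  | none => ContinuousLinearMap.snd ℝ (PiLp ⊤ (fun p : A => ellp p.1.1)) C₀(ℕ, ℝ)
  | some p => (Wf.exists_proj A p).choose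

theorem Wf.inc_some (A : Finset {q : ℝ // 1 ≤ q}) (p : A) (w : Wf A (some p)) :
    Wf.inc A (some p) w = (WithLp.toLp ⊤ (Pi.single p (show ellp p.1.1 from w)), 0) :=
  (Wf.exists_inc A p).choose_spec.1 w

theorem Wf.inc_none (A : Finset {q : ℝ // 1 ≤ q}) (w : Wf A none) :
    Wf.inc A none w = (0, (show C₀(ℕ, ℝ) from w)) := rfl

theorem Wf.prj_some (A : Finset {q : ℝ // 1 ≤ q}) (p : A) (z : Zf A) :
    Wf.prj A (some p) z = z.1 p :=
  (Wf.exists_proj A p).choose_spec.1 z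

theorem Wf.prj_none (A : Finset {q : ℝ // 1 ≤ q}) (z : Zf A) :
    Wf.prj A none z = z.2 := rfl

theorem Wf.main (A : Finset {q : ℝ // 1 ≤ q}) {J : Type} (x : J → Zf A) (B : UB J (Zf A) x) :
    ∃ idx : J → Option A, ∀ i,
      Nonempty ((Submodule.span ℝ (x '' {j | idx j = i})).topologicalClosure ≃L[ℝ] Wf A i) := by
  classical
  have hpos : ∀ p : A, (0 : ℝ) < p.1.1 := fun p => lt_of_lt_of_le one_pos p.1.2
  have H : ∀ i, Nonempty (SeqSp (Wf A i) (Wf.r A i)) := by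
    rintro (_ | p)
    · exact c0_seqSp
    · exact lp_seqSp p.1.2
  refine abstract_main (Wf A) (Wf.r A) ?_ ?_ (fun i => (H i).some) (Wf.inc A) (Wf.prj A)
    ?_ ?_ ?_ ?_ ?_ x B
  · rintro (_ | p) (_ | q) h
    · rfl
    · exact absurd h (ne_of_lt (one_div_pos.2 (hpos q)))
    · exact absurd h (ne_of_gt (one_div_pos.2 (hpos p)))
    · have h' : 1 / p.1.1 = 1 / q.1.1 := h
      rw [one_div, one_div, inv_inj] at h'
      rw [Subtype.ext (Subtype.ext h')]
  · rintro (_ | p)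
    · exact zero_le_one
    · change 1 / p.1.1 ≤ 1
      rw [div_le_one (hpos p)]; exact p.1.2
  · rintro (_ | p)
    · exact ContinuousLinearMap.norm_inr_le_one _ _ _
    · exact (Wf.exists_inc A p).choose_spec.2
  · rintro (_ | p)
    · exact ContinuousLinearMap.norm_snd_le _ _ _
    · exact (Wf.exists_proj A p).choose_spec.2
  · rintro (_ | p) w
    · rfl
    · rw [Wf.inc_some, Wf.prj_some]
      exact Pi.single_eq_same (M := fun p : A => ellp p.1.1) p (show ellp p.1.1 from w)
  · rintro (_ | p) (_ | q) h w
    · exact absurd rfl h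
    · rw [Wf.inc_some, Wf.prj_none]; rfl
    · rw [Wf.inc_none, Wf.prj_some]; rfl
    · rw [Wf.inc_some, Wf.prj_some]
      have hpq : p ≠ q := fun e => h (congrArg some e)
      exact Pi.single_eq_of_ne (M := fun p : A => ellp p.1.1) hpq (show ellp q.1.1 from w)
  · intro z
    have h1 : Wf.inc A none (Wf.prj A none z) = (0, z.2) := rfl
    have h2 : ∀ p, Wf.inc A (some p) (Wf.prj A (some p) z)
        = (WithLp.toLp ⊤ (Pi.single p (z.1 p)), 0) := fun p =>
      (congrArg (Wf.inc A (some p)) (Wf.prj_some A p z)).trans (Wf.inc_some A p _)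
    rw [Fintype.sum_option, h1, Finset.sum_congr rfl fun p _ => h2 p]
    refine Prod.ext ?_ ?_
    · rw [Prod.fst_add, Prod.fst_sum, zero_add]
      ext1
      rw [WithLp.ofLp_sum]
      exact congrFun (Finset.univ_sum_single (fun p => z.1 p)) _
    · rw [Prod.snd_add, Prod.snd_sum]
      simp

/-- If `A ⊆ [1,∞)` is a finite set of exponents and `(x_j)_{j ∈ J}` is an
unconditional basis of `Z = (⨁_{p ∈ A} ℓ_p) ⊕ c₀` (sup norms throughout), then `J` splits
into a partition `(J_p)_{p ∈ A}` together with `J_∞` such that for each `p ∈ A` the closed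
linear span of `{x_j : j ∈ J_p}` is isomorphic to `ℓ_p`, and the closed linear span of
`{x_j : j ∈ J_∞}` is isomorphic to `c₀`. -/
theorem unconditional_basis_of_direct_sum_lp_c0_splits
    (A : Finset {q : ℝ // 1 ≤ q}) {J : Type}
    (x : J → (PiLp ⊤ (fun p : A => ellp p.1.1)) × C₀(ℕ, ℝ))
    (hx : ∀ f : (PiLp ⊤ (fun p : A => ellp p.1.1)) × C₀(ℕ, ℝ),
      ∃! a : J → ℝ, HasSum (fun j => a j • x j) f) :
    ∃ (Jp : A → Set J) (Jinf : Set J),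
      (Pairwise fun p q => Disjoint (Jp p) (Jp q)) ∧
      (∀ p : A, Disjoint (Jp p) Jinf) ∧
      (Jinf ∪ ⋃ p, Jp p) = Set.univ ∧
      (∀ p : A,
        Nonempty (((Submodule.span ℝ (x '' Jp p)).topologicalClosure) ≃L[ℝ] ellp p.1.1)) ∧
      Nonempty (((Submodule.span ℝ (x '' Jinf)).topologicalClosure) ≃L[ℝ] C₀(ℕ, ℝ)) := by
  obtain ⟨B⟩ := exists_UB x hx
  obtain ⟨idx, h⟩ := Wf.main A x B
  refine ⟨fun p => {j | idx j = some p}, {j | idx j = none}, ?_, ?_, ?_,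
    fun p => h (some p), h none⟩
  · intro p q hpq
    rw [Set.disjoint_left]
    intro j hj hj'
    exact hpq (Option.some.inj ((show idx j = some p from hj).symm.trans hj'))
  · intro p
    rw [Set.disjoint_left]
    intro j hj hj'
    exact Option.some_ne_none p ((show idx j = some p from hj).symm.trans hj')
  · ext j
    simp only [Set.mem_union, Set.mem_iUnion, Set.mem_univ, iff_true]
    cases hj : idx j with
    | none => exact Or.inl hj
    | some p => exact Or.inr ⟨p, hj⟩

end
end

section
/- Let A and B be finite subsets of [1,∞). If the Banach spaces ⨁_{p∈A} ℓ_p and ⨁_{p∈B} ℓ_p are isomorphic (linearly homeomorphic), then A = B. -/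
open scoped ENNReal

noncomputable section

open Filter Topology

lemma aux_toReal (q : {r : ℝ // 1 ≤ r}) : (ENNReal.ofReal q.1).toReal = q.1 :=
  ENNReal.toReal_ofReal (zero_le_one.trans q.2)

lemma aux_pos (q : {r : ℝ // 1 ≤ r}) : 0 < q.1 := lt_of_lt_of_le zero_lt_one q.2

lemma aux_hasSum (q : {r : ℝ // 1 ≤ r}) (x : ellp q.1) :
    HasSum (fun i => ‖x i‖ ^ q.1) (‖x‖ ^ q.1) := by
  have h := lp.hasSum_norm (p := ENNReal.ofReal q.1) (by rw [aux_toReal]; exact aux_pos q) x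
  rwa [aux_toReal] at h

def gap (q : {r : ℝ // 1 ≤ r}) (y x : ellp q.1) : ℝ := ‖y + x‖ ^ q.1 - ‖y‖ ^ q.1 - ‖x‖ ^ q.1

lemma gap_fin (q : {r : ℝ // 1 ≤ r}) (y : ellp q.1) (s : Finset ℕ) (hs : ∀ i ∉ s, y i = 0)
    (x : ℕ → ellp q.1) (hx : ∀ i, Tendsto (fun k => x k i) atTop (𝓝 0)) :
    Tendsto (fun k => gap q y (x k)) atTop (𝓝 0) := by
  have hq := aux_pos q
  have key : ∀ k, gap q y (x k) =
      ∑ i ∈ s, (‖y i + x k i‖ ^ q.1 - ‖y i‖ ^ q.1 - ‖x k i‖ ^ q.1) := by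
    intro k
    have h1 := ((aux_hasSum q (y + x k)).sub (aux_hasSum q y)).sub (aux_hasSum q (x k))
    refine h1.unique ?_
    apply hasSum_sum_of_ne_finset_zero
    intro i hi
    simp [hs i hi, Real.zero_rpow hq.ne']
  simp_rw [key]
  have : (0:ℝ) = ∑ i ∈ s, (‖y i + 0‖ ^ q.1 - ‖y i‖ ^ q.1 - ‖(0:ℝ)‖ ^ q.1) := by
    simp [Real.zero_rpow hq.ne']
  rw [this]
  refine tendsto_finsetSum _ fun i _ => ?_
  refine Tendsto.sub (Tendsto.sub ?_ tendsto_const_nhds) ?_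
  · exact ((tendsto_const_nhds.add (hx i)).norm).rpow_const (Or.inr hq.le)
  · exact ((hx i).norm).rpow_const (Or.inr hq.le)

lemma exists_fin_approx (q : {r : ℝ // 1 ≤ r}) (y : ellp q.1) (d : ℝ) (hd : 0 < d) :
    ∃ (y' : ellp q.1) (s : Finset ℕ), (∀ i ∉ s, y' i = 0) ∧ ‖y - y'‖ < d := by
  have h := lp.hasSum_single (p := ENNReal.ofReal q.1) ENNReal.ofReal_ne_top y
  have h2 := (Metric.tendsto_nhds.1 h d hd).exists
  obtain ⟨s, hs⟩ := h2
  refine ⟨_, s, ?_, by rwa [dist_comm, dist_eq_norm] at hs⟩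
  intro i hi
  rw [lp.coeFn_sum, Finset.sum_apply]
  refine Finset.sum_eq_zero fun j hj => ?_
  rw [lp.single_apply_ne]
  rintro rfl; exact hi hj

lemma gap_tendsto (q : {r : ℝ // 1 ≤ r}) (y : ellp q.1)
    (x : ℕ → ellp q.1) (M : ℝ) (hM : ∀ k, ‖x k‖ ≤ M)
    (hx : ∀ i, Tendsto (fun k => x k i) atTop (𝓝 0)) :
    Tendsto (fun k => gap q y (x k)) atTop (𝓝 0) := by
  have hq := aux_pos q
  rw [Metric.tendsto_nhds]
  intro ε hε
  have hM0 : 0 ≤ M := (norm_nonneg _).trans (hM 0)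
  have huc : UniformContinuousOn (fun t : ℝ => t ^ q.1) (Set.Icc 0 (‖y‖ + M + 1)) :=
    isCompact_Icc.uniformContinuousOn_of_continuous
      (Real.continuous_rpow_const hq.le).continuousOn
  rw [Metric.uniformContinuousOn_iff] at huc
  obtain ⟨d, hd, hdd⟩ := huc (ε / 3) (by positivity)
  obtain ⟨y', s, hs, hy'⟩ := exists_fin_approx q y (min d 1) (by positivity)
  have hyd : ‖y - y'‖ < d := hy'.trans_le (min_le_left _ _)
  have hy1 : ‖y - y'‖ < 1 := hy'.trans_le (min_le_right _ _)
  have hy'n : ‖y'‖ ≤ ‖y‖ + 1 := by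
    have := norm_sub_norm_le y' y
    rw [norm_sub_rev] at this; linarith
  filter_upwards [Metric.tendsto_nhds.1 (gap_fin q y' s hs x hx) (ε / 3) (by positivity)] with k hk
  have h1 := hdd ‖y + x k‖ ⟨norm_nonneg _, by linarith [norm_add_le y (x k), hM k]⟩
    ‖y' + x k‖ ⟨norm_nonneg _, by linarith [norm_add_le y' (x k), hM k]⟩ (by
      rw [Real.dist_eq]
      refine (abs_norm_sub_norm_le _ _).trans_lt ?_
      rwa [add_sub_add_right_eq_sub])
  have h2 := hdd ‖y‖ ⟨norm_nonneg _, by linarith⟩ ‖y'‖ ⟨norm_nonneg _, by linarith⟩ (by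
      rw [Real.dist_eq]
      exact (abs_norm_sub_norm_le _ _).trans_lt hyd)
  simp only [Real.dist_eq, gap, sub_zero, abs_lt] at *
  constructor <;> linarith [h1.1, h1.2, h2.1, h2.2, hk.1, hk.2]

lemma select {E : Type*} [AddCommMonoid E] (u : ℕ → E) (F : ℕ → E → ℕ → Prop)
    (hF : ∀ j S, ∀ᶠ k in atTop, F j S k) :
    ∃ (S : ℕ → E) (κ : ℕ → ℕ), S 0 = 0 ∧ (∀ j, S (j+1) = S j + u (κ j)) ∧
      ∀ j, F j (S j) (κ j) := by
  have : ∀ j S, ∃ k, F j S k := fun j S => (hF j S).exists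
  choose c hc using this
  let S : ℕ → E := fun n => Nat.rec 0 (fun j s => s + u (c j s)) n
  exact ⟨S, fun j => c j (S j), rfl, fun j => rfl, fun j => hc _ _⟩

lemma decay {a b : ℝ} (h : a < b) :
    Tendsto (fun n : ℕ => ((n:ℝ)) ^ (a - b)) atTop (𝓝 0) := by
  have := (tendsto_rpow_neg_atTop (sub_pos.2 h)).comp (tendsto_natCast_atTop_atTop (R := ℝ))
  simpa [Function.comp_def] using this

/-- From `‖x‖^q ≤ n K` to `‖x‖ ≤ K^(1/q) n^(1/q)`. -/
lemma root_le {t K q : ℝ} (n : ℕ) (ht : 0 ≤ t) (hK : 0 ≤ K) (hq : 0 < q) (h : t ^ q ≤ n * K) :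
    t ≤ K ^ (1/q) * (n:ℝ) ^ (1/q) := by
  have := Real.rpow_le_rpow (by positivity) h (z := 1/q) (by positivity)
  rw [← Real.rpow_mul ht, mul_one_div_cancel hq.ne', Real.rpow_one,
    Real.mul_rpow (by positivity) hK] at this
  linarith

lemma le_root {t K q : ℝ} (n : ℕ) (ht : 0 ≤ t) (hK : 0 ≤ K) (hq : 0 < q) (h : n * K ≤ t ^ q) :
    K ^ (1/q) * (n:ℝ) ^ (1/q) ≤ t := by
  have := Real.rpow_le_rpow (by positivity) h (z := 1/q) (by positivity)
  rw [← Real.rpow_mul ht, mul_one_div_cancel hq.ne', Real.rpow_one,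
    Real.mul_rpow (by positivity) hK] at this
  linarith

lemma T_coord_bound (p q : {r : ℝ // 1 ≤ r}) (T : ellp p.1 →L[ℝ] ellp q.1) (u : ℕ → ellp p.1)
    (hub : ∀ k, ‖u k‖ ≤ 2) (k : ℕ) : ‖T (u k)‖ ≤ ‖T‖ * 2 :=
  (T.le_opNorm _).trans (mul_le_mul_of_nonneg_left (hub k) (norm_nonneg _))

lemma step1 (p q : {r : ℝ // 1 ≤ r}) (hqp : q.1 < p.1) (T : ellp p.1 →L[ℝ] ellp q.1)
    (u : ℕ → ellp p.1) (hub : ∀ k, ‖u k‖ ≤ 2)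
    (hu : ∀ i, Tendsto (fun k => u k i) atTop (𝓝 0))
    (hTu : ∀ i, Tendsto (fun k => T (u k) i) atTop (𝓝 0)) :
    Tendsto (fun k => ‖T (u k)‖) atTop (𝓝 0) := by
  have hq := aux_pos q
  have hp := aux_pos p
  by_contra hcon
  rw [Metric.tendsto_nhds] at hcon
  push Not at hcon
  obtain ⟨δ, hδ, hfr⟩ := hcon
  obtain ⟨φ, hφ, hφδ⟩ := extraction_of_frequently_atTop hfr
  have hge : ∀ k, δ ≤ ‖T (u (φ k))‖ := by
    intro k; simpa using hφδ k
  have hφt := hφ.tendsto_atTop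
  set c : ℝ := δ ^ q.1 / 2 with hc
  have hcpos : 0 < c := by positivity
  obtain ⟨S, κ, hS0, hS, hF⟩ := select (fun k => u (φ k))
    (fun _ S k => |gap p S (u (φ k))| < 1 ∧ |gap q (T S) (T (u (φ k)))| < c) (by
      intro _ S
      have h1 := gap_tendsto p S (fun k => u (φ k)) 2 (fun k => hub _) (fun i => (hu i).comp hφt)
      have h2 := gap_tendsto q (T S) (fun k => T (u (φ k))) _
        (fun k => T_coord_bound p q T u hub _) (fun i => (hTu i).comp hφt)
      filter_upwards [Metric.tendsto_nhds.1 h1 1 one_pos, Metric.tendsto_nhds.1 h2 c hcpos]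
        with k a b
      simp only [Real.dist_eq, sub_zero] at a b
      exact ⟨a, b⟩)
  set K : ℝ := 2 ^ p.1 + 1 with hK
  have hKpos : 0 < K := by positivity
  have hup : ∀ n : ℕ, ‖S n‖ ^ p.1 ≤ n * K := by
    intro n
    induction n with
    | zero => simp [hS0, Real.zero_rpow hp.ne']
    | succ n ih =>
      have a := (abs_lt.1 (hF n).1).2
      have b := Real.rpow_le_rpow (norm_nonneg _) (hub (φ (κ n))) hp.le
      rw [hS]; simp only [gap] at a; push_cast
      linarith
  have hlo : ∀ n : ℕ, n * c ≤ ‖T (S n)‖ ^ q.1 := by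
    intro n
    induction n with
    | zero => simp; positivity
    | succ n ih =>
      have a := (abs_lt.1 (hF n).2).1
      have b := Real.rpow_le_rpow hδ.le (hge (κ n)) hq.le
      rw [hS, map_add]; simp only [gap] at a; push_cast
      have : δ ^ q.1 = 2 * c := by rw [hc]; ring
      linarith
  have hlim : Tendsto (fun n : ℕ => ‖T‖ * K ^ (1/p.1) * (n:ℝ) ^ (1/p.1 - 1/q.1)) atTop (𝓝 0) := by
    simpa using (decay (one_div_lt_one_div_of_lt hq hqp)).const_mul (‖T‖ * K ^ (1/p.1))
  have hle : ∀ᶠ n : ℕ in atTop, c ^ (1/q.1) ≤ ‖T‖ * K ^ (1/p.1) * (n:ℝ) ^ (1/p.1 - 1/q.1) := by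
    filter_upwards [eventually_gt_atTop 0] with n hn
    have hn' : (0:ℝ) < n := by exact_mod_cast hn
    have h1 := le_root n (norm_nonneg _) hcpos.le hq (hlo n)
    have h2 := root_le n (norm_nonneg _) hKpos.le hp (hup n)
    have h3 := T.le_opNorm (S n)
    have h4 := mul_le_mul_of_nonneg_left h2 (norm_nonneg T)
    rw [Real.rpow_sub hn', ← mul_div_assoc, le_div_iff₀ (by positivity)]
    linarith
  have := ge_of_tendsto hlim hle
  have : 0 < c ^ (1/q.1) := by positivity
  linarith

lemma main_seq {ι : Type*} [Fintype ι] (p : {r : ℝ // 1 ≤ r}) (q : ι → {r : ℝ // 1 ≤ r})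
    (hne : ∀ b, q b ≠ p)
    (T : ∀ b, ellp p.1 →L[ℝ] ellp (q b).1) (C : ι → ℝ) (hC0 : ∀ b, 0 ≤ C b)
    (hC : ∀ x, ‖x‖ ≤ ∑ b, C b * ‖T b x‖)
    (u : ℕ → ellp p.1) (hub : ∀ k, ‖u k‖ ≤ 2) (hul : ∀ k, 1 ≤ ‖u k‖)
    (hu : ∀ i, Tendsto (fun k => u k i) atTop (𝓝 0))
    (hTu : ∀ b i, Tendsto (fun k => T b (u k) i) atTop (𝓝 0)) : False := by
  have hp := aux_pos p
  obtain ⟨S, κ, hS0, hS, hF⟩ := select u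
    (fun j S k => |gap p S (u k)| < 1/2 ∧ ∀ b, |gap (q b) (T b S) (T b (u k))| < 1 ∧
      ((q b).1 < p.1 → ‖T b (u k)‖ < (1/2) ^ j)) (by
      intro j S
      have h1 := gap_tendsto p S u 2 hub hu
      have h1' := Metric.tendsto_nhds.1 h1 (1/2) (by norm_num)
      simp only [Real.dist_eq, sub_zero] at h1'
      refine h1'.and (eventually_all.2 fun b => ?_)
      have h2 := gap_tendsto (q b) (T b S) (fun k => T b (u k)) _
        (fun k => T_coord_bound p (q b) (T b) u hub _) (hTu b)
      have h2' := Metric.tendsto_nhds.1 h2 1 one_pos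
      simp only [Real.dist_eq, sub_zero] at h2'
      refine h2'.and ?_
      by_cases hlt : (q b).1 < p.1
      · have h3 := step1 p (q b) hlt (T b) u hub hu (hTu b)
        filter_upwards [h3.eventually_lt_const (show (0:ℝ) < (1/2)^j by positivity)] with k hk _
        exact hk
      · exact Eventually.of_forall fun k h => absurd h hlt)
  have hlo : ∀ n : ℕ, n * (1/2 : ℝ) ≤ ‖S n‖ ^ p.1 := by
    intro n
    induction n with
    | zero => simp; positivity
    | succ n ih =>
      have a := (abs_lt.1 (hF n).1).1
      have b := Real.one_le_rpow (hul (κ n)) hp.le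
      rw [hS]; simp only [gap] at a; push_cast
      linarith
  have hTlim : ∀ b, Tendsto (fun n : ℕ => ‖T b (S n)‖ * (n:ℝ) ^ (-(1/p.1))) atTop (𝓝 0) := by
    intro b
    have hq := aux_pos (q b)
    rcases lt_or_gt_of_ne (fun h => hne b (Subtype.ext h)) with hlt | hgt
    · have hb : ∀ n, ‖T b (S n)‖ ≤ 2 - 2 * (1/2)^n := by
        intro n
        induction n with
        | zero => simp [hS0]
        | succ n ih =>
          have a := ((hF n).2 b).2 hlt
          rw [hS, map_add, pow_succ]
          linarith [norm_add_le (T b (S n)) (T b (u (κ n)))]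
      have hl : Tendsto (fun n : ℕ => 2 * (n:ℝ) ^ (-(1/p.1))) atTop (𝓝 0) := by
        simpa using (decay (a := 0) (b := 1/p.1) (by positivity)).const_mul 2
      refine squeeze_zero (fun n => by positivity) (fun n => ?_) hl
      refine mul_le_mul_of_nonneg_right ((hb n).trans ?_) (by positivity)
      have : (0:ℝ) ≤ (1/2)^n := by positivity
      linarith
    · set K : ℝ := (‖T b‖ * 2) ^ (q b).1 + 1 with hK
      have hKpos : 0 < K := by positivity
      have hup : ∀ n : ℕ, ‖T b (S n)‖ ^ (q b).1 ≤ n * K := by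
        intro n
        induction n with
        | zero => simp [hS0, Real.zero_rpow hq.ne']
        | succ n ih =>
          have a := (abs_lt.1 ((hF n).2 b).1).2
          have c := Real.rpow_le_rpow (norm_nonneg _)
            (T_coord_bound p (q b) (T b) u hub (κ n)) hq.le
          rw [hS, map_add]; simp only [gap] at a; push_cast
          linarith
      have hl : Tendsto (fun n : ℕ => K ^ (1/(q b).1) * (n:ℝ) ^ (1/(q b).1 - 1/p.1))
          atTop (𝓝 0) := by
        simpa using (decay (one_div_lt_one_div_of_lt hp hgt)).const_mul (K ^ (1/(q b).1))
      refine squeeze_zero' (Eventually.of_forall fun n => by positivity) ?_ hl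
      filter_upwards [eventually_gt_atTop 0] with n hn
      have hn' : (0:ℝ) < n := by exact_mod_cast hn
      have h2 := root_le n (norm_nonneg _) hKpos.le hq (hup n)
      rw [sub_eq_add_neg, Real.rpow_add hn', ← mul_assoc]
      exact mul_le_mul_of_nonneg_right h2 (by positivity)
  have hsum : Tendsto (fun n : ℕ => ∑ b, C b * (‖T b (S n)‖ * (n:ℝ) ^ (-(1/p.1))))
      atTop (𝓝 0) := by
    have := tendsto_finsetSum Finset.univ (fun b _ => (hTlim b).const_mul (C b))
    simpa using this
  have hle : ∀ᶠ n : ℕ in atTop, ((1/2 : ℝ)) ^ (1/p.1) ≤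
      ∑ b, C b * (‖T b (S n)‖ * (n:ℝ) ^ (-(1/p.1))) := by
    filter_upwards [eventually_gt_atTop 0] with n hn
    have hn' : (0:ℝ) < n := by exact_mod_cast hn
    have h1 := le_root n (norm_nonneg _) (by norm_num) hp (hlo n)
    have h2 := h1.trans (hC (S n))
    simp_rw [← mul_assoc]
    rw [← Finset.sum_mul, Real.rpow_neg hn'.le, ← div_eq_mul_inv, le_div_iff₀ (by positivity)]
    exact h2
  have h1 := ge_of_tendsto hsum hle
  have h2 : 0 < ((1/2 : ℝ)) ^ (1/p.1) := by positivity
  linarith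

lemma main_emb {ι : Type*} [Fintype ι] (p : {r : ℝ // 1 ≤ r}) (q : ι → {r : ℝ // 1 ≤ r})
    (hne : ∀ b, q b ≠ p)
    (T : ∀ b, ellp p.1 →L[ℝ] ellp (q b).1) (C : ι → ℝ) (hC0 : ∀ b, 0 ≤ C b)
    (hC : ∀ x, ‖x‖ ≤ ∑ b, C b * ‖T b x‖) : False := by
  have hpE : 0 < ENNReal.ofReal p.1 := ENNReal.ofReal_pos.2 (aux_pos p)
  let e : ℕ → ellp p.1 := fun k => lp.single (ENNReal.ofReal p.1) k (1:ℝ)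
  have he : ∀ k, ‖e k‖ = 1 := fun k => by
    simp only [e]; rw [lp.norm_single hpE]; simp
  have heq : ∀ k, e k k = 1 := fun k => by simp [e]
  have hene : ∀ k i, i ≠ k → e k i = 0 := fun k i h => by
    simp only [e]; exact lp.single_apply_ne _ _ _ h
  let f : ℕ → (ι × ℕ → ℝ) := fun k bi => T bi.1 (e k) bi.2
  have hcomp : IsCompact (Set.pi Set.univ (fun bi : ι × ℕ => Set.Icc (-‖T bi.1‖) ‖T bi.1‖)) :=
    isCompact_univ_pi fun _ => isCompact_Icc
  have hmem : ∀ k, f k ∈ Set.pi Set.univ (fun bi : ι × ℕ => Set.Icc (-‖T bi.1‖) ‖T bi.1‖) := by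
    intro k bi _
    have h1 : ‖T bi.1 (e k) bi.2‖ ≤ ‖T bi.1 (e k)‖ :=
      lp.norm_apply_le_norm (ENNReal.ofReal_pos.2 (aux_pos (q bi.1))).ne' _ _
    have h2 := (T bi.1).le_opNorm (e k)
    rw [he, mul_one] at h2
    exact abs_le.1 (h1.trans h2)
  obtain ⟨L, _, φ, hφ, hL⟩ := hcomp.tendsto_subseq hmem
  have t0 : Tendsto (fun k : ℕ => 2 * k) atTop atTop :=
    tendsto_atTop_mono (fun k => by simp only [id]; omega) tendsto_id
  have t1 : Tendsto (fun k : ℕ => 2 * k + 1) atTop atTop :=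
    tendsto_atTop_mono (fun k => by simp only [id]; omega) tendsto_id
  have hcoord : ∀ i, Tendsto (fun k => e k i) atTop (𝓝 0) := by
    intro i
    refine tendsto_const_nhds.congr' ?_
    filter_upwards [eventually_gt_atTop i] with k hk
    exact (hene k i hk.ne).symm
  refine main_seq p q hne T C hC0 hC (fun k => e (φ (2*k)) - e (φ (2*k+1))) ?_ ?_ ?_ ?_
  · intro k
    refine (norm_sub_le _ _).trans ?_
    rw [he, he]; norm_num
  · intro k
    have h := lp.norm_apply_le_norm hpE.ne' (e (φ (2*k)) - e (φ (2*k+1))) (φ (2*k))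
    have hn : φ (2*k) ≠ φ (2*k+1) := fun h => by have := hφ.injective h; omega
    have h3 : (e (φ (2*k)) - e (φ (2*k+1))) (φ (2*k)) = 1 := by
      rw [lp.coeFn_sub, Pi.sub_apply, heq, hene _ _ hn, sub_zero]
    rw [h3] at h
    simpa using h
  · intro i
    have := ((hcoord i).comp (hφ.tendsto_atTop.comp t0)).sub
      ((hcoord i).comp (hφ.tendsto_atTop.comp t1))
    simpa [Function.comp_def] using this
  · intro b i
    have hl := (tendsto_pi_nhds.1 hL) (b, i)
    have := (hl.comp t0).sub (hl.comp t1)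
    simpa [Function.comp_def, f] using this

lemma sub_of_iso (A B : Finset {q : ℝ // 1 ≤ q})
    (h : (PiLp ⊤ (fun p : A => ellp p.1.1)) ≃L[ℝ]
      (PiLp ⊤ (fun p : B => ellp p.1.1))) : A ⊆ B := by
  classical
  intro p hp
  by_contra hpB
  let eA := PiLp.continuousLinearEquiv ⊤ ℝ (fun p : A => ellp p.1.1)
  let eB := PiLp.continuousLinearEquiv ⊤ ℝ (fun p : B => ellp p.1.1)
  let e : (∀ p : A, ellp p.1.1) ≃L[ℝ] (∀ p : B, ellp p.1.1) := (eA.symm.trans h).trans eB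
  let J : ellp p.1 →L[ℝ] (∀ p : A, ellp p.1.1) :=
    ContinuousLinearMap.single ℝ (fun p : A => ellp p.1.1) ⟨p, hp⟩
  let T : ∀ b : B, ellp p.1 →L[ℝ] ellp b.1.1 := fun b =>
    (ContinuousLinearMap.proj (R := ℝ) (φ := fun p : B => ellp p.1.1) b).comp
      (e.toContinuousLinearMap.comp J)
  let R : ∀ b : B, ellp b.1.1 →L[ℝ] ellp p.1 := fun b =>
    (ContinuousLinearMap.proj (R := ℝ) (φ := fun p : A => ellp p.1.1) (⟨p, hp⟩ : A)).comp
      (e.symm.toContinuousLinearMap.comp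
      (ContinuousLinearMap.single ℝ (fun p : B => ellp p.1.1) b))
  refine main_emb p (fun b : B => b.1) (fun b hb => hpB (hb ▸ b.2)) T (fun b => ‖R b‖)
    (fun b => norm_nonneg _) (fun x => ?_)
  have hx : x = ∑ b, R b (T b x) := by
    have h1 : e (J x) = ∑ b, Pi.single b (e (J x) b) := (Finset.univ_sum_single _).symm
    have h2 : J x = ∑ b, e.symm (Pi.single b (e (J x) b)) := by
      rw [← map_sum, ← h1, e.symm_apply_apply]
    have h3 : (J x) ⟨p, hp⟩ = x := by simp [J]
    have h4 := congrFun h2 ⟨p, hp⟩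
    rw [h3, Finset.sum_apply] at h4
    exact h4
  calc ‖x‖ = ‖∑ b, R b (T b x)‖ := by rw [← hx]
    _ ≤ ∑ b, ‖R b (T b x)‖ := norm_sum_le _ _
    _ ≤ _ := Finset.sum_le_sum fun b _ => (R b).le_opNorm _

/-- If `A, B ⊆ [1,∞)` are finite sets of exponents and the Banach spaces
`⨁_{p ∈ A} ℓ_p` and `⨁_{p ∈ B} ℓ_p` (with sup norms) are linearly homeomorphic, then `A = B`. -/
theorem direct_sum_lp_isomorphic_iff_eq
    (A B : Finset {q : ℝ // 1 ≤ q})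
    (h : Nonempty ((PiLp ⊤ (fun p : A => ellp p.1.1)) ≃L[ℝ]
      (PiLp ⊤ (fun p : B => ellp p.1.1)))) :
    A = B := by
  obtain ⟨e⟩ := h
  exact Finset.Subset.antisymm (sub_of_iso A B e) (sub_of_iso B A e.symm)

end
end

section
/- Let F be a finite nonempty index set and, for each i ∈ F, let B_i = (x_{i,n})_{n∈ℕ} be a subsymmetric basis of a real Banach space X_i. Let B = ⨁_{i∈F} B_i be the direct-sum basis of X = ⨁_{i∈F} X_i, indexed by the disjoint union ⊔_{i∈F} ℕ. Then for every infinite subset S of ⊔_{i∈F} ℕ, the subfamily of B indexed by S is permutatively equivalent to ⨁_{i∈G} B_i for some nonempty subset G ⊆ F. -/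
open scoped ENNReal

noncomputable section

/-- The closed linear span of a family of vectors. -/
def closedSpan {X : Type*} [NormedAddCommGroup X] [NormedSpace ℝ X]
    {J : Type*} (x : J → X) : Submodule ℝ X :=
  (Submodule.span ℝ (Set.range x)).topologicalClosure

theorem mem_closedSpan {X : Type*} [NormedAddCommGroup X] [NormedSpace ℝ X]
    {J : Type*} (x : J → X) (j : J) : x j ∈ closedSpan x :=
  Submodule.le_topologicalClosure _ (Submodule.subset_span ⟨j, rfl⟩)

/-- Two families of vectors (with the same index set) are equivalent if the correspondence
`x_j ↦ y_j` extends to a linear homeomorphism between their closed linear spans. -/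
def FamiliesEquivalent {X Y : Type*} [NormedAddCommGroup X] [NormedSpace ℝ X]
    [NormedAddCommGroup Y] [NormedSpace ℝ Y]
    {J : Type*} (x : J → X) (y : J → Y) : Prop :=
  ∃ T : closedSpan x ≃L[ℝ] closedSpan y,
    ∀ j : J, (T ⟨x j, mem_closedSpan x j⟩ : Y) = y j

/-- Two families of vectors are permutatively equivalent if some bijection of the index sets
is implemented by a linear homeomorphism between their closed linear spans. -/
def PermutativelyEquivalent {X Y : Type*} [NormedAddCommGroup X] [NormedSpace ℝ X]
    [NormedAddCommGroup Y] [NormedSpace ℝ Y]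
    {J I : Type*} (x : J → X) (y : I → Y) : Prop :=
  ∃ (π : J ≃ I) (T : closedSpan x ≃L[ℝ] closedSpan y),
    ∀ j : J, (T ⟨x j, mem_closedSpan x j⟩ : Y) = y (π j)

/-- A family `(x_j)_{j ∈ J}` is an unconditional basis of `X` when every vector of `X` admits
a unique representation as an unconditionally convergent series `Σ_j a_j x_j`. -/
def IsUnconditionalBasis {X : Type*} [NormedAddCommGroup X] [NormedSpace ℝ X]
    {J : Type*} (x : J → X) : Prop :=
  ∀ f : X, ∃! a : J → ℝ, HasSum (fun j => a j • x j) f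

/-- A subsymmetric basis: an unconditional basis equivalent to each of its subsequences. -/
def IsSubsymmetricBasis {X : Type*} [NormedAddCommGroup X] [NormedSpace ℝ X]
    (x : ℕ → X) : Prop :=
  IsUnconditionalBasis x ∧ ∀ φ : ℕ → ℕ, StrictMono φ → FamiliesEquivalent x (x ∘ φ)

/-- The direct-sum basis `⨁_{i ∈ F} B_i` of `⨁_{i ∈ F} X_i`, indexed by the disjoint union
`Σ i, ℕ`: its `(i, n)`-th member is `B_i(n)` placed in the `i`-th coordinate, `0` elsewhere. -/
def directSumBasis {F : Type*} [Fintype F] [DecidableEq F]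
    (X : F → Type*) [∀ i, NormedAddCommGroup (X i)] [∀ i, NormedSpace ℝ (X i)]
    (B : ∀ i : F, ℕ → X i) : (Σ i : F, ℕ) → PiLp ⊤ X :=
  fun s => (WithLp.equiv ⊤ (∀ i, X i)).symm (Pi.single s.1 (B s.1 s.2))

/-- Domination of families via finitely supported coefficients. -/
def FDom {X Y : Type*} [NormedAddCommGroup X] [NormedSpace ℝ X]
    [NormedAddCommGroup Y] [NormedSpace ℝ Y] {J : Type*} (x : J → X) (y : J → Y) : Prop :=
  ∃ C : ℝ, 0 ≤ C ∧ ∀ a : J →₀ ℝ,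
    ‖Finsupp.linearCombination ℝ y a‖ ≤ C * ‖Finsupp.linearCombination ℝ x a‖

section aux

variable {X Y Z : Type*} [NormedAddCommGroup X] [NormedSpace ℝ X]
    [NormedAddCommGroup Y] [NormedSpace ℝ Y] [NormedAddCommGroup Z] [NormedSpace ℝ Z]
    {J I : Type*}

theorem FDom.trans {x : J → X} {y : J → Y} {z : J → Z} (h : FDom x y) (h' : FDom y z) :
    FDom x z := by
  obtain ⟨C, hC, h⟩ := h
  obtain ⟨D, hD, h'⟩ := h'
  refine ⟨D * C, by positivity, fun a => (h' a).trans ?_⟩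
  rw [mul_assoc]
  exact mul_le_mul_of_nonneg_left (h a) hD

theorem FDom.comp {x : J → X} {y : J → Y} (h : FDom x y) (f : I → J) :
    FDom (x ∘ f) (y ∘ f) := by
  obtain ⟨C, hC, h⟩ := h
  refine ⟨C, hC, fun a => ?_⟩
  have := h (a.mapDomain f)
  rwa [Finsupp.linearCombination_mapDomain, Finsupp.linearCombination_mapDomain] at this

/-- linear combinations as elements of the closed span -/
def lcClosed (x : J → X) : (J →₀ ℝ) →ₗ[ℝ] closedSpan x :=
  (Finsupp.linearCombination ℝ x).codRestrict _ (fun a => by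
    apply Submodule.le_topologicalClosure
    rw [← Finsupp.range_linearCombination]
    exact ⟨a, rfl⟩)

theorem lcClosed_dense (x : J → X) : DenseRange (lcClosed x) := by
  rw [DenseRange, Subtype.dense_iff]
  intro v hv
  have : (Subtype.val '' Set.range (lcClosed x)) = (Submodule.span ℝ (Set.range x) : Set X) := by
    rw [← Finsupp.range_linearCombination, ← Set.range_comp]
    rfl
  change v ∈ closure (Subtype.val '' Set.range (lcClosed x))
  exact this.symm ▸ hv

theorem lcClosed_single (x : J → X) (j : J) :
    lcClosed x (Finsupp.single j 1) = ⟨x j, mem_closedSpan x j⟩ := by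
  apply Subtype.ext
  change Finsupp.linearCombination ℝ x (Finsupp.single j 1) = x j
  simp

theorem permEquiv_of_FDom [CompleteSpace X] [CompleteSpace Y] {x : J → X} {y : I → Y}
    (π : J ≃ I) (h : FDom x (y ∘ π)) (h' : FDom (y ∘ π) x) : PermutativelyEquivalent x y := by
  have : CompleteSpace (closedSpan x) :=
    (Submodule.isClosed_topologicalClosure _).completeSpace_coe
  have : CompleteSpace (closedSpan y) :=
    (Submodule.isClosed_topologicalClosure _).completeSpace_coe
  obtain ⟨C, hC, h⟩ := h
  obtain ⟨D, hD, h'⟩ := h'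
  let f : (J →₀ ℝ) ≃ₗ[ℝ] (I →₀ ℝ) := Finsupp.domLCongr π
  have hf : ∀ a, Finsupp.linearCombination ℝ y (f a) = Finsupp.linearCombination ℝ (y ∘ π) a := by
    intro a
    rw [← Finsupp.linearCombination_mapDomain]
    congr 1
    simp [f, Finsupp.domLCongr_apply, Finsupp.equivMapDomain_eq_mapDomain]
  have h1 : ∃ C, ∀ a, ‖lcClosed y (f a)‖ ≤ C * ‖lcClosed x a‖ := by
    refine ⟨C, fun a => ?_⟩
    have := h a
    rw [← hf] at this
    exact this
  have h2 : ∃ C, ∀ a, ‖lcClosed x (f.symm a)‖ ≤ C * ‖lcClosed y a‖ := by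
    refine ⟨D, fun a => ?_⟩
    have := h' (f.symm a)
    rw [← hf, LinearEquiv.apply_symm_apply] at this
    exact this
  refine ⟨π, f.extend (lcClosed x) (lcClosed y) (lcClosed_dense x) h1 (lcClosed_dense y) h2, ?_⟩
  intro j
  rw [← lcClosed_single, LinearEquiv.extend_eq]
  simp [f, lcClosed_single, Finsupp.domLCongr_single]

theorem FDom.of_clm {x : J → X} {y : J → Y} (T : closedSpan x →L[ℝ] closedSpan y)
    (hT : ∀ j : J, (T ⟨x j, mem_closedSpan x j⟩ : Y) = y j) : FDom x y := by
  refine ⟨‖T‖, T.opNorm_nonneg, fun a => ?_⟩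
  have h : (closedSpan y).subtype ∘ₗ T.toLinearMap ∘ₗ lcClosed x =
      Finsupp.linearCombination ℝ y := by
    ext j
    simp [lcClosed_single, hT]
  have h2 := LinearMap.congr_fun h a
  rw [← h2]
  exact T.le_opNorm (lcClosed x a)

theorem FamiliesEquivalent.fdom {x : J → X} {y : J → Y} (h : FamiliesEquivalent x y) :
    FDom x y ∧ FDom y x := by
  obtain ⟨T, hT⟩ := h
  refine ⟨FDom.of_clm T.toContinuousLinearMap hT, FDom.of_clm T.symm.toContinuousLinearMap ?_⟩
  intro j
  have : (⟨y j, mem_closedSpan y j⟩ : closedSpan y) = T ⟨x j, mem_closedSpan x j⟩ :=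
    Subtype.ext (hT j).symm
  rw [this]
  simp

theorem lc_sum_elim {R : Type*} [Fintype R] (u : R → X) (y : J → X)
    (a : (R ⊕ J) →₀ ℝ) : Finsupp.linearCombination ℝ (Sum.elim u y) a =
      ∑ r, a (Sum.inl r) • u r + Finsupp.linearCombination ℝ y
        (Finsupp.sumFinsuppLEquivProdFinsupp ℝ a).2 := by
  classical
  induction a using Finsupp.induction_linear with
  | zero => simp
  | add a b ha hb =>
    simp only [map_add, ha, hb, Finsupp.add_apply, add_smul, Finset.sum_add_distrib, Prod.snd_add]
    abel
  | single s c =>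
    rcases s with r | j
    · have : (Finsupp.sumFinsuppLEquivProdFinsupp ℝ
          (Finsupp.single (Sum.inl r : R ⊕ J) c)).2 = 0 := by
        ext j; simp
      rw [this]
      simp [Finsupp.single_apply, ite_smul]
    · have : (Finsupp.sumFinsuppLEquivProdFinsupp ℝ
          (Finsupp.single (Sum.inr j : R ⊕ J) c)).2 = Finsupp.single j c := by
        ext j'; simp [Finsupp.single_apply]
      rw [this]
      simp [Finsupp.single_apply]

theorem sum_bd {R : Type*} [Fintype R] (δ : R → X →L[ℝ] ℝ) (v : X) (c : R → ℝ)
    (hc : ∀ r, δ r v = c r) (u : R → Y) :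
    ‖∑ r, c r • u r‖ ≤ (∑ r, ‖δ r‖ * ‖u r‖) * ‖v‖ := by
  rw [Finset.sum_mul]
  refine (norm_sum_le _ _).trans (Finset.sum_le_sum fun r _ => ?_)
  rw [norm_smul, ← hc r]
  calc _ ≤ (‖δ r‖ * ‖v‖) * ‖u r‖ := by
        gcongr; exact (δ r).le_opNorm v
    _ = _ := by ring

theorem FDom.sum_elim {R : Type*} [Fintype R] {u : R → X} {y : J → X} {u' : R → Y} {y' : J → Y}
    (δ : R → X →L[ℝ] ℝ) (h1 : ∀ r, δ r (u r) = 1) (h2 : ∀ r s, r ≠ s → δ r (u s) = 0)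
    (h3 : ∀ r j, δ r (y j) = 0) (h : FDom y y') :
    FDom (Sum.elim u y) (Sum.elim u' y') := by
  classical
  obtain ⟨C, hC, h⟩ := h
  have hδ : ∀ r (a : (R ⊕ J) →₀ ℝ),
      δ r (Finsupp.linearCombination ℝ (Sum.elim u y) a) = a (Sum.inl r) := by
    intro r a
    rw [lc_sum_elim, map_add, map_sum]
    have : δ r (Finsupp.linearCombination ℝ y
        (Finsupp.sumFinsuppLEquivProdFinsupp ℝ a).2) = 0 := by
      rw [Finsupp.linearCombination_apply, Finsupp.sum, map_sum]
      simp [h3]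
    rw [this, Finset.sum_eq_single r]
    · simp [h1]
    · intro s _ hs
      simp [h2 r s hs.symm]
    · simp
  refine ⟨∑ r, ‖δ r‖ * ‖u' r‖ + C * (1 + ∑ r, ‖δ r‖ * ‖u r‖), by positivity, fun a => ?_⟩
  set v := Finsupp.linearCombination ℝ (Sum.elim u y) a with hv
  have e1 : Finsupp.linearCombination ℝ y (Finsupp.sumFinsuppLEquivProdFinsupp ℝ a).2
      = v - ∑ r, a (Sum.inl r) • u r := by
    rw [hv, lc_sum_elim]; abel
  have hh := h (Finsupp.sumFinsuppLEquivProdFinsupp ℝ a).2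
  rw [e1] at hh
  rw [lc_sum_elim]
  calc _ ≤ _ := norm_add_le _ _
    _ ≤ (∑ r, ‖δ r‖ * ‖u' r‖) * ‖v‖ + C * (‖v‖ + (∑ r, ‖δ r‖ * ‖u r‖) * ‖v‖) := by
        gcongr
        · exact sum_bd δ v _ (fun r => hδ r a) u'
        · refine hh.trans ?_
          gcongr
          exact (norm_sub_le _ _).trans (by gcongr; exact sum_bd δ v _ (fun r => hδ r a) u)
    _ = _ := by ring

theorem IsSubsymmetricBasis.exists_dual {x : ℕ → X} (hx : IsSubsymmetricBasis x) (n : ℕ) :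
    ∃ δ : X →L[ℝ] ℝ, δ (x n) = 1 ∧ ∀ k, k ≠ n → δ (x k) = 0 := by
  let φ : ℕ → ℕ := fun j => if j < n then j else j + 1
  have hφ : StrictMono φ := by
    intro a b hab
    simp only [φ]
    split_ifs <;> omega
  have hφn : n ∉ Set.range φ := by
    rintro ⟨j, hj⟩
    simp only [φ] at hj
    split_ifs at hj <;> omega
  have hφk : ∀ k, k ≠ n → k ∈ Set.range φ := by
    intro k hk
    rcases lt_or_gt_of_ne hk with h | h
    · exact ⟨k, by simp [φ, h]⟩
    · refine ⟨k - 1, ?_⟩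
      simp only [φ]
      split_ifs <;> omega
  obtain ⟨hb, hs⟩ := hx
  obtain ⟨T, hT⟩ := hs φ hφ
  have hnot : x n ∉ closedSpan (x ∘ φ) := by
    intro hmem
    obtain ⟨a, ha, -⟩ := hb ((T.symm ⟨x n, hmem⟩ : closedSpan x) : X)
    have ha' : HasSum (fun j => a j • (⟨x j, mem_closedSpan x j⟩ : closedSpan x))
        (T.symm ⟨x n, hmem⟩) := by
      exact (Topology.IsInducing.hasSum_iff (g := (closedSpan x).subtype)
        Topology.IsInducing.subtypeVal _ _).1 ha
    have h1 := (ha'.mapL T.toContinuousLinearMap).mapL (closedSpan (x ∘ φ)).subtypeL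
    have h2 : HasSum (fun j => a j • x (φ j)) (x n) := by
      convert h1 using 1
      · ext j
        rw [map_smul, map_smul]
        exact congrArg (fun z => a j • z) (hT j).symm
      · simp
    have h3 : HasSum (fun k => (Function.extend φ a 0) k • x k) (x n) := by
      rw [← hφ.injective.hasSum_iff] 
      · convert h2 using 2 with j
        simp [hφ.injective.extend_apply]
      · intro k hk
        rw [Function.extend_apply' _ _ _ (by simpa using hk)]
        simp
    have h4 : HasSum (fun k => (Pi.single n (1:ℝ) : ℕ → ℝ) k • x k) (x n) := by
      convert hasSum_single n _ using 1
      · simp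
      · intro k hk
        simp [hk]
    have h5 := congrFun ((hb (x n)).unique h3 h4) n
    rw [Function.extend_apply' _ _ _ (by simpa using hφn)] at h5
    simp at h5
  obtain ⟨f, u, hfu, hu⟩ := geometric_hahn_banach_closed_point
    (closedSpan (x ∘ φ)).convex (Submodule.isClosed_topologicalClosure _) hnot
  have hz : ∀ v ∈ closedSpan (x ∘ φ), f v = 0 := by
    intro v hv
    by_contra hne
    have := hfu (((u + 1) / f v) • v) (Submodule.smul_mem _ _ hv)
    rw [map_smul, smul_eq_mul, div_mul_cancel₀ _ hne] at this
    linarith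
  have h0 : 0 < f (x n) := by
    have := hfu 0 (Submodule.zero_mem _)
    simp at this
    linarith
  refine ⟨(f (x n))⁻¹ • f, by simp [h0.ne'], ?_⟩
  intro k hk
  obtain ⟨j, rfl⟩ := hφk k hk
  have := hz _ (mem_closedSpan (x ∘ φ) j)
  simp only [Function.comp_apply] at this
  simp [this]

end aux

section ds

variable {F : Type*} [Fintype F] [DecidableEq F]
    {X : F → Type*} [∀ i, NormedAddCommGroup (X i)] [∀ i, NormedSpace ℝ (X i)]
    {B : ∀ i : F, ℕ → X i}

theorem directSumBasis_apply (s : Σ _ : F, ℕ) (j : F) :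
    (directSumBasis X B s) j = (Pi.single s.1 (B s.1 s.2) : ∀ i, X i) j := rfl

theorem directSumBasis_dual (hB : ∀ i, IsSubsymmetricBasis (B i)) (s : Σ _ : F, ℕ) :
    ∃ δ : PiLp ⊤ X →L[ℝ] ℝ, δ (directSumBasis X B s) = 1 ∧
      ∀ t, t ≠ s → δ (directSumBasis X B t) = 0 := by
  obtain ⟨i, n⟩ := s
  obtain ⟨d, hd, hd'⟩ := (hB i).exists_dual n
  refine ⟨d.comp (PiLp.proj ⊤ X i), ?_, ?_⟩
  · simp [directSumBasis_apply, hd]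
  · rintro ⟨j, m⟩ ht
    by_cases hj : j = i
    · subst hj
      simp [directSumBasis_apply]
      apply hd'
      rintro rfl
      exact ht rfl
    · simp [directSumBasis_apply, Pi.single_eq_of_ne (Ne.symm hj)]

variable {G : Type*} [Fintype G]

theorem ds_coord (h : G → F) (hh : Function.Injective h) (e : G → ℕ → ℕ)
    (a : (Σ _ : G, ℕ) →₀ ℝ) (g : G) :
    (Finsupp.linearCombination ℝ
      (fun s : Σ _ : G, ℕ => directSumBasis X B ⟨h s.1, e s.1 s.2⟩) a) (h g) =
    Finsupp.linearCombination ℝ (B (h g) ∘ e g) (Finsupp.sigmaFinsuppLEquivPiFinsupp ℝ a g) := by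
  classical
  induction a using Finsupp.induction_linear with
  | zero => simp
  | add a b ha hb => simp only [map_add, PiLp.add_apply, ha, hb, Pi.add_apply]
  | single s c =>
    obtain ⟨g', n⟩ := s
    have : (Finsupp.sigmaFinsuppLEquivPiFinsupp ℝ (Finsupp.single (⟨g', n⟩ : Σ _ : G, ℕ) c) g) =
      if g' = g then Finsupp.single n c else 0 := by
      ext m
      simp only [Finsupp.sigmaFinsuppLEquivPiFinsupp_apply]
      split_ifs with hg
      · subst hg; simp [Finsupp.single_apply]
      · simp [Finsupp.single_apply, hg]
    rw [this]
    simp only [Finsupp.linearCombination_single, PiLp.smul_apply, directSumBasis_apply]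
    split_ifs with hg
    · subst hg; simp
    · rw [Pi.single_eq_of_ne (fun hc => hg (hh hc).symm)]; simp

theorem ds_coord_zero (h : G → F) (e : G → ℕ → ℕ)
    (a : (Σ _ : G, ℕ) →₀ ℝ) (j : F) (hj : j ∉ Set.range h) :
    (Finsupp.linearCombination ℝ
      (fun s : Σ _ : G, ℕ => directSumBasis X B ⟨h s.1, e s.1 s.2⟩) a) j = 0 := by
  induction a using Finsupp.induction_linear with
  | zero => simp
  | add a b ha hb => simp only [map_add, PiLp.add_apply, ha, hb, add_zero]
  | single s c =>
    simp only [Finsupp.linearCombination_single, PiLp.smul_apply, directSumBasis_apply]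
    rw [Pi.single_eq_of_ne (fun hc => hj ⟨_, hc.symm⟩)]; simp

end ds

theorem ds_FDom {F F' G : Type*} [Fintype F] [DecidableEq F] [Fintype F'] [DecidableEq F']
    [Fintype G]
    {X : F → Type*} [∀ i, NormedAddCommGroup (X i)] [∀ i, NormedSpace ℝ (X i)]
    {B : ∀ i : F, ℕ → X i}
    {X' : F' → Type*} [∀ i, NormedAddCommGroup (X' i)] [∀ i, NormedSpace ℝ (X' i)]
    {B' : ∀ i : F', ℕ → X' i}
    (h : G → F) (hh : Function.Injective h) (e : G → ℕ → ℕ)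
    (h' : G → F') (hh' : Function.Injective h') (e' : G → ℕ → ℕ)
    (H : ∀ g, FDom (B (h g) ∘ e g) (B' (h' g) ∘ e' g)) :
    FDom (fun s : Σ _ : G, ℕ => directSumBasis X B ⟨h s.1, e s.1 s.2⟩)
      (fun s : Σ _ : G, ℕ => directSumBasis X' B' ⟨h' s.1, e' s.1 s.2⟩) := by
  choose C hC H using H
  refine ⟨∑ g, C g, Finset.sum_nonneg fun g _ => hC g, fun a => ?_⟩
  set v := Finsupp.linearCombination ℝ
    (fun s : Σ _ : G, ℕ => directSumBasis X B ⟨h s.1, e s.1 s.2⟩) a with hv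
  have h0 : 0 ≤ (∑ g, C g) * ‖v‖ := 
    mul_nonneg (Finset.sum_nonneg fun g _ => hC g) (norm_nonneg _)
  rw [PiLp.norm_eq_ciSup]
  refine Real.iSup_le (fun j => ?_) h0
  by_cases hj : j ∈ Set.range h'
  · obtain ⟨g, rfl⟩ := hj
    rw [ds_coord h' hh']
    refine (H g _).trans ?_
    rw [← ds_coord h hh]
    apply mul_le_mul _ _ (norm_nonneg _) (Finset.sum_nonneg fun g _ => hC g)
    · exact Finset.single_le_sum (fun g _ => hC g) (Finset.mem_univ g)
    · exact PiLp.norm_apply_le v (h g)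
  · rw [ds_coord_zero h' _ _ _ hj, norm_zero]
    exact h0

/-- If each `B_i` is a subsymmetric basis of `X_i` (`i` in a finite nonempty
set `F`), then every infinite subfamily of the direct-sum basis `⨁_{i ∈ F} B_i` of
`⨁_{i ∈ F} X_i` is permutatively equivalent to `⨁_{i ∈ G} B_i` for some nonempty `G ⊆ F`. -/
theorem subfamily_of_direct_sum_of_subsymmetric_bases
    {F : Type} [Fintype F] [DecidableEq F] [Nonempty F]
    (X : F → Type) [∀ i, NormedAddCommGroup (X i)] [∀ i, NormedSpace ℝ (X i)]
    [∀ i, CompleteSpace (X i)]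
    (B : ∀ i : F, ℕ → X i) (hB : ∀ i, IsSubsymmetricBasis (B i))
    (S : Set (Σ i : F, ℕ)) (hS : S.Infinite) :
    ∃ G : Finset F, G.Nonempty ∧
      PermutativelyEquivalent (fun s : S => directSumBasis X B s.1)
        (directSumBasis (fun i : G => X i.1) (fun i : G => B i.1)) := by
  classical
  have fib : ∀ T : Set (Σ i : F, ℕ), T.Infinite → ∃ i, {n | (⟨i, n⟩ : Σ i : F, ℕ) ∈ T}.Infinite := by
    intro T hT
    by_contra hcon
    push Not at hcon
    apply hT
    have := Set.finite_iUnion (fun i => (Set.not_infinite.1 (by simpa using hcon i) :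
      {n | (⟨i, n⟩ : Σ i : F, ℕ) ∈ T}.Finite).image (fun n => (⟨i, n⟩ : Σ i : F, ℕ)))
    refine this.subset ?_
    rintro ⟨i, n⟩ h
    exact Set.mem_iUnion.2 ⟨i, n, h, rfl⟩
  let G : Finset F := Finset.univ.filter (fun i => {n | (⟨i, n⟩ : Σ i : F, ℕ) ∈ S}.Infinite)
  have hG : ∀ i, i ∈ G ↔ {n | (⟨i, n⟩ : Σ i : F, ℕ) ∈ S}.Infinite := by simp [G]
  obtain ⟨i0, hi0⟩ := fib S hS
  have hi0G : i0 ∈ G := (hG i0).2 hi0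
  refine ⟨G, ⟨i0, hi0G⟩, ?_⟩
  let R : Type := {s : Σ i : F, ℕ // s ∈ S ∧ s.1 ∉ G}
  have hRfin : {s : Σ i : F, ℕ | s ∈ S ∧ s.1 ∉ G}.Finite := by
    by_contra hinf
    obtain ⟨i, hi⟩ := fib _ hinf
    have hiS : i ∈ G := (hG i).2 (hi.mono fun n hn => hn.1)
    obtain ⟨n, hn⟩ := hi.nonempty
    exact hn.2 hiS
  have : Finite R := hRfin
  have := Fintype.ofFinite R
  let m := Fintype.card R
  let k : R ≃ Fin m := Fintype.equivFin R
  let e : G → ℕ → ℕ := fun g => Nat.nth (fun n => (⟨g.1, n⟩ : Σ i : F, ℕ) ∈ S)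
  have heI : ∀ g : G, {n | (⟨g.1, n⟩ : Σ i : F, ℕ) ∈ S}.Infinite := fun g => (hG g.1).1 g.2
  have he : ∀ g, StrictMono (e g) := fun g => Nat.nth_strictMono (heI g)
  have heS : ∀ (g : G) n, (⟨g.1, e g n⟩ : Σ i : F, ℕ) ∈ S := fun g n =>
    Nat.nth_mem_of_infinite (heI g) n
  have heR : ∀ (g : G) n, (⟨g.1, n⟩ : Σ i : F, ℕ) ∈ S → ∃ l, e g l = n := by
    intro g n hn
    have := Nat.range_nth_of_infinite (heI g)
    have h2 : n ∈ Set.range (e g) := by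
      rw [this]; exact hn
    exact h2
  let g0 : G := ⟨i0, hi0G⟩
  let φ : G → ℕ → ℕ := fun g n => if g = g0 then n + m else n
  have hφ : ∀ g, StrictMono (φ g) := by
    intro g a b hab
    simp only [φ]
    split_ifs <;> omega
  let f1 : R ⊕ (Σ _ : G, ℕ) → S :=
    Sum.elim (fun r => ⟨r.1, r.2.1⟩) (fun s => ⟨⟨s.1.1, e s.1 s.2⟩, heS s.1 s.2⟩)
  have hf1 : Function.Bijective f1 := by
    constructor
    · rintro (r | ⟨g, n⟩) (r' | ⟨g', n'⟩) hrr
      · have := congrArg Subtype.val hrr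
        exact congrArg Sum.inl (Subtype.ext this)
      · have := congrArg Subtype.val hrr
        exact absurd g'.2 (by have h2 := r.2.2; rw [show r.1 = _ from this] at h2; exact h2)
      · have := congrArg Subtype.val hrr
        exact absurd g.2 (by have h2 := r'.2.2; rw [show r'.1 = _ from this.symm] at h2; exact h2)
      · have := congrArg Subtype.val hrr
        simp only [f1, Sum.elim_inr, Sigma.mk.injEq] at this
        obtain ⟨h1, h2⟩ := this
        obtain rfl : g = g' := Subtype.ext h1
        rw [(he g).injective (eq_of_heq h2)]
    · rintro ⟨⟨i, n⟩, hs⟩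
      by_cases hi : i ∈ G
      · obtain ⟨l, hl⟩ := heR ⟨i, hi⟩ n hs
        exact ⟨Sum.inr ⟨⟨i, hi⟩, l⟩, by simp [f1, hl]⟩
      · exact ⟨Sum.inl ⟨⟨i, n⟩, hs, hi⟩, rfl⟩
  let f2 : R ⊕ (Σ _ : G, ℕ) → (Σ _ : G, ℕ) :=
    Sum.elim (fun r => ⟨g0, (k r : ℕ)⟩) (fun s => ⟨s.1, φ s.1 s.2⟩)
  have hf2 : Function.Bijective f2 := by
    constructor
    · rintro (r | ⟨g, n⟩) (r' | ⟨g', n'⟩) hrr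
      · simp only [f2, Sum.elim_inl, Sigma.mk.injEq, heq_eq_eq, true_and] at hrr
        exact congrArg Sum.inl (k.injective (Fin.ext hrr))
      · simp only [f2, Sum.elim_inl, Sum.elim_inr, Sigma.mk.injEq, heq_eq_eq] at hrr
        obtain ⟨h1, h2⟩ := hrr
        have := (k r).2
        simp only [φ, ← h1, if_true] at h2
        omega
      · simp only [f2, Sum.elim_inl, Sum.elim_inr, Sigma.mk.injEq, heq_eq_eq] at hrr
        obtain ⟨h1, h2⟩ := hrr
        have := (k r').2
        simp only [φ, h1, if_true] at h2
        omega
      · simp only [f2, Sum.elim_inr, Sigma.mk.injEq, heq_eq_eq] at hrr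
        obtain ⟨h1, h2⟩ := hrr
        subst h1
        rw [(hφ g).injective h2]
    · rintro ⟨g, n⟩
      by_cases hg : g = g0
      · subst hg
        by_cases hn : n < m
        · exact ⟨Sum.inl (k.symm ⟨n, hn⟩), by simp [f2]⟩
        · refine ⟨Sum.inr ⟨g0, n - m⟩, ?_⟩
          simp only [f2, Sum.elim_inr, φ, if_true]
          rw [Nat.sub_add_cancel (not_lt.1 hn)]
      · exact ⟨Sum.inr ⟨g, n⟩, by simp [f2, φ, hg]⟩
  let E1 := Equiv.ofBijective f1 hf1
  let E2 := Equiv.ofBijective f2 hf2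
  let x : S → PiLp ⊤ X := fun s => directSumBasis X B s.1
  let y := directSumBasis (fun i : G => X i.1) (fun i : G => B i.1)
  have hsub : ∀ (g : G) (α β : ℕ → ℕ), StrictMono α → StrictMono β →
      FDom (B g.1 ∘ α) (B g.1 ∘ β) := fun g α β hα hβ =>
    ((hB g.1).2 α hα).fdom.2.trans ((hB g.1).2 β hβ).fdom.1
  choose δ hδ1 hδ2 using directSumBasis_dual hB
  choose δ' hδ1' hδ2' using directSumBasis_dual (X := fun i : G => X i.1)
    (B := fun i : G => B i.1) (fun i => hB i.1)
  have ex : x ∘ f1 = Sum.elim (fun r : R => directSumBasis X B r.1)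
      (fun s : Σ _ : G, ℕ => directSumBasis X B ⟨s.1.1, e s.1 s.2⟩) := by
    ext1 s; rcases s with r | s <;> rfl
  have ey : y ∘ f2 = Sum.elim (fun r : R => y ⟨g0, (k r : ℕ)⟩)
      (fun s : Σ _ : G, ℕ => y ⟨s.1, φ s.1 s.2⟩) := by
    ext1 s; rcases s with r | s <;> rfl
  have D1 : FDom (x ∘ f1) (y ∘ f2) := by
    rw [ex, ey]
    refine FDom.sum_elim (fun r => δ r.1) (fun r => hδ1 _)
      (fun r s hrs => hδ2 _ _ fun hc => hrs (Subtype.ext hc.symm))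
      (fun r s => hδ2 _ _ fun hc => r.2.2 (by rw [← hc]; exact s.1.2)) ?_
    exact ds_FDom (fun g : G => g.1) Subtype.val_injective e (fun g : G => g)
      Function.injective_id φ (fun g => hsub g _ _ (he g) (hφ g))
  have D2 : FDom (y ∘ f2) (x ∘ f1) := by
    rw [ex, ey]
    refine FDom.sum_elim (fun r => δ' (f2 (Sum.inl r))) (fun r => hδ1' _)
      (fun r s hrs => hδ2' (f2 (Sum.inl r)) (f2 (Sum.inl s)) fun hc =>
        hrs (Sum.inl_injective (hf2.1 hc)).symm)
      (fun r s => hδ2' (f2 (Sum.inl r)) (f2 (Sum.inr s)) fun hc =>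
        Sum.inr_ne_inl (hf2.1 hc)) ?_
    exact ds_FDom (fun g : G => g) Function.injective_id φ (fun g : G => g.1)
      Subtype.val_injective e (fun g => hsub g _ _ (hφ g) (he g))
  have hx : (x ∘ f1) ∘ E1.symm = x := by
    ext1 s
    exact congrArg x (E1.apply_symm_apply s)
  have D1' := D1.comp E1.symm
  have D2' := D2.comp E1.symm
  rw [hx] at D1' D2'
  exact permEquiv_of_FDom (E1.symm.trans E2) D1' D2'

end
end

section
/- The Banach space ℓ₁ is anti-Euclidean: for every constant C ≥ 1 there exists n ∈ ℕ such that there are no bounded linear operators I : ℓ₂ⁿ → ℓ₁ and P : ℓ₁ → ℓ₂ⁿ satisfying P ∘ I = Id_{ℓ₂ⁿ} and ‖I‖ · ‖P‖ ≤ C. -/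
open scoped ENNReal

noncomputable section

def sgB (b : Bool) : ℝ := if b then 1 else -1

lemma rad_split (n : ℕ) (F : (Fin (n+1) → Bool) → ℝ) :
    ∑ e, F e = ∑ e : Fin n → Bool, (F (Fin.cons true e) + F (Fin.cons false e)) := by
  rw [← (Fin.consEquiv (fun _ : Fin (n+1) => Bool)).sum_comp, Fintype.sum_prod_type,
    Fintype.sum_bool, ← Finset.sum_add_distrib]
  rfl

lemma rad_two (n : ℕ) (v : Fin n → ℝ) :
    ∑ e : Fin n → Bool, (∑ i, v i * sgB (e i))^2 = 2^n * ∑ i, v i ^ 2 := by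
  induction n with
  | zero => simp
  | succ n ih =>
    rw [rad_split]
    have h := ih (fun i => v i.succ)
    simp only [Fin.sum_univ_succ, Fin.cons_zero, Fin.cons_succ]
    have : ∀ e : Fin n → Bool,
        (v 0 * sgB true + ∑ i : Fin n, v i.succ * sgB (e i))^2
        + (v 0 * sgB false + ∑ i : Fin n, v i.succ * sgB (e i))^2
        = 2 * v 0 ^ 2 + 2 * (∑ i : Fin n, v i.succ * sgB (e i))^2 := by
      intro e; simp only [sgB]; norm_num; ring
    rw [Finset.sum_congr rfl (fun e _ => this e), Finset.sum_add_distrib,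
      ← Finset.mul_sum Finset.univ (fun e : Fin n → Bool => (∑ i : Fin n, v i.succ * sgB (e i))^2), h]
    simp; ring

lemma rad_four (n : ℕ) (v : Fin n → ℝ) :
    ∑ e : Fin n → Bool, (∑ i, v i * sgB (e i))^4 ≤ 2^n * (3 * (∑ i, v i ^ 2)^2) := by
  induction n with
  | zero => simp
  | succ n ih =>
    rw [rad_split]
    have h := ih (fun i => v i.succ)
    have h2 := rad_two n (fun i => v i.succ)
    simp only [Fin.sum_univ_succ, Fin.cons_zero, Fin.cons_succ]
    have : ∀ e : Fin n → Bool,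
        (v 0 * sgB true + ∑ i : Fin n, v i.succ * sgB (e i))^4
        + (v 0 * sgB false + ∑ i : Fin n, v i.succ * sgB (e i))^4
        = 2 * v 0 ^ 4 + 12 * v 0 ^ 2 * (∑ i : Fin n, v i.succ * sgB (e i))^2
          + 2 * (∑ i : Fin n, v i.succ * sgB (e i))^4 := by
      intro e; simp only [sgB]; norm_num; ring
    rw [Finset.sum_congr rfl (fun e _ => this e), Finset.sum_add_distrib, Finset.sum_add_distrib,
      ← Finset.mul_sum Finset.univ (fun e : Fin n → Bool => (∑ i : Fin n, v i.succ * sgB (e i))^2),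
      ← Finset.mul_sum Finset.univ (fun e : Fin n → Bool => (∑ i : Fin n, v i.succ * sgB (e i))^4),
      h2]
    simp only [Finset.sum_const, Finset.card_univ, Fintype.card_fun, Fintype.card_bool,
      Fintype.card_fin, nsmul_eq_mul]
    push_cast
    have hp : (0:ℝ) ≤ 2^n * v 0 ^ 4 := by positivity
    rw [pow_succ (2:ℝ) n]
    nlinarith

lemma pt_ineq (s t : ℝ) (hs : 0 ≤ s) : t^2 * s^2 - t^4/6 ≤ s^3 * |t| := by
  rw [← sq_abs t, ← (by rw [← abs_pow, abs_of_nonneg (by positivity)] : |t|^4 = t^4)]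
  have ht := abs_nonneg t
  generalize |t| = y at *
  have : 0 ≤ s^3 - y * s^2 + y^3/6 := by
    nlinarith [mul_nonneg hs (sq_nonneg (s - y/2)), mul_nonneg ht (sq_nonneg (s - 2*y/3)), mul_nonneg hs (sq_nonneg (s - 2*y/3)), mul_nonneg hs (sq_nonneg (s - 3*y/4)), mul_nonneg ht (sq_nonneg (s - 3*y/4)), mul_nonneg ht (sq_nonneg (s - 7*y/10)), mul_nonneg hs (sq_nonneg (s - 7*y/10)), pow_nonneg hs 3, pow_nonneg ht 3]
  nlinarith [mul_nonneg ht this]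

lemma khin (n : ℕ) (v : Fin n → ℝ) :
    2^n * √(∑ i, v i ^ 2) ≤ 2 * ∑ e : Fin n → Bool, |∑ i, v i * sgB (e i)| := by
  have h0 : 0 ≤ ∑ i, v i ^ 2 := Finset.sum_nonneg fun i _ => sq_nonneg _
  have hs2 := Real.sq_sqrt h0
  have hs := Real.sqrt_nonneg (∑ i, v i ^ 2)
  set s := √(∑ i, v i ^ 2)
  rcases hs.eq_or_lt with h | h
  · rw [← h]; simp; positivity
  have key := Finset.sum_le_sum (s := Finset.univ)
    (fun (e : Fin n → Bool) _ => pt_ineq s (∑ i, v i * sgB (e i)) hs)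
  rw [Finset.sum_sub_distrib, ← Finset.sum_mul, ← Finset.sum_div, ← Finset.mul_sum, rad_two] at key
  have h4 := rad_four n v
  rw [← hs2] at key h4
  have : s^3 * (2^n * s) ≤ s^3 * (2 * ∑ e : Fin n → Bool, |∑ i, v i * sgB (e i)|) := by
    nlinarith
  exact le_of_mul_le_mul_left this (by positivity)

lemma l1_hasSum (x : lp (fun _ : ℕ => ℝ) 1) : HasSum (fun j => |x j|) ‖x‖ := by
  have := lp.hasSum_norm (p := 1) (by simp) x
  simpa using this

lemma main_bd (n : ℕ) (I : EuclideanSpace ℝ (Fin n) →L[ℝ] lp (fun _ : ℕ => ℝ) 1)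
    (P : lp (fun _ : ℕ => ℝ) 1 →L[ℝ] EuclideanSpace ℝ (Fin n))
    (h : P.comp I = ContinuousLinearMap.id ℝ (EuclideanSpace ℝ (Fin n))) :
    (n : ℝ) ≤ 2 * (‖I‖ * ‖P‖) * √n := by
  let b : Fin n → EuclideanSpace ℝ (Fin n) := fun i => EuclideanSpace.single i 1
  let q : ℕ → EuclideanSpace ℝ (Fin n) := fun j => P (lp.single 1 j (1:ℝ))
  let w : (Fin n → Bool) → EuclideanSpace ℝ (Fin n) := fun e => WithLp.toLp 2 (fun i => sgB (e i))
  have hq : ∀ j, ‖q j‖ ≤ ‖P‖ := by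
    intro j
    refine (P.le_opNorm _).trans ?_
    rw [lp.norm_single (by simp)]; simp
  have hw : ∀ e, ‖w e‖ = √n := by
    intro e
    rw [EuclideanSpace.norm_eq]
    congr 1
    have : ∀ i, ‖w e i‖^2 = 1 := by
      intro i; simp only [w, sgB]; split_ifs <;> simp
    rw [Finset.sum_congr rfl (fun i _ => this i)]; simp
  have hIw : ∀ e j, (I (w e)) j = ∑ i, (I (b i)) j * sgB (e i) := by
    intro e j
    have : w e = ∑ i, sgB (e i) • b i := by
      ext k
      simp [w, b, Finset.sum_apply, Pi.single_apply]
    rw [this, map_sum, lp.coeFn_sum, Finset.sum_apply]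
    refine Finset.sum_congr rfl fun i _ => ?_
    rw [map_smul, lp.coeFn_smul, Pi.smul_apply, smul_eq_mul, mul_comm]
  have h1 : HasSum (fun j => ∑ i, (I (b i)) j * q j i) (n:ℝ) := by
    have hi : ∀ i, HasSum (fun j => (I (b i)) j * q j i) 1 := by
      intro i
      have h1 := lp.hasSum_single (p := 1) (by simp) (I (b i))
      have h2 := ((EuclideanSpace.proj (𝕜 := ℝ) i).comp P).hasSum h1
      have h3 : P (I (b i)) = b i := by
        have := congrArg (fun f => f (b i)) h
        simpa using this
      have e1 : (1:ℝ) = ((EuclideanSpace.proj (𝕜 := ℝ) i).comp P) (I (b i)) := by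
        rw [ContinuousLinearMap.comp_apply, h3]; simp [b]
      have e2 : (fun j => (I (b i)) j * q j i) = fun j => ((EuclideanSpace.proj (𝕜 := ℝ) i).comp P)
          (lp.single (E := fun _ : ℕ => ℝ) 1 j ((I (b i)) j)) := by
        funext j
        have : lp.single (E := fun _ : ℕ => ℝ) 1 j ((I (b i)) j)
            = ((I (b i)) j) • lp.single (E := fun _ : ℕ => ℝ) 1 j (1:ℝ) := by
          rw [← lp.single_smul]; simp
        rw [this, map_smul]
        simp [q]
      rw [e1, e2]
      exact h2
    have := hasSum_sum (s := Finset.univ) (fun i _ => hi i)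
    simpa using this
  have h2 : HasSum (fun j => (2 * ‖P‖ / 2^n) * ∑ e, |(I (w e)) j|)
      ((2 * ‖P‖ / 2^n) * ∑ e, ‖I (w e)‖) :=
    (hasSum_sum (s := Finset.univ) (fun e _ => l1_hasSum (I (w e)))).mul_left _
  have h3 := hasSum_le (fun j => ?_) h1 h2
  · refine h3.trans ?_
    have : ∑ e, ‖I (w e)‖ ≤ 2^n * (‖I‖ * √n) := by
      refine (Finset.sum_le_sum (fun e _ => (I.le_opNorm (w e)).trans_eq (by rw [hw e]))).trans ?_
      simp
    calc _ ≤ (2 * ‖P‖ / 2^n) * (2^n * (‖I‖ * √n)) := by gcongr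
      _ = _ := by field_simp
  · have hk := khin n (fun i => (I (b i)) j)
    simp only [← hIw] at hk
    have hcs := Real.sum_mul_le_sqrt_mul_sqrt Finset.univ (fun i => (I (b i)) j) (fun i => q j i)
    have hqj : √(∑ i, q j i ^ 2) ≤ ‖P‖ := by
      refine le_trans (le_of_eq ?_) (hq j)
      rw [EuclideanSpace.norm_eq]; simp
    refine hcs.trans ?_
    calc _ ≤ √(∑ i, (I (b i)) j ^ 2) * ‖P‖ := by gcongr
      _ = (‖P‖ / 2^n) * (2^n * √(∑ i, (I (b i)) j ^ 2)) := by field_simp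
      _ ≤ (‖P‖ / 2^n) * (2 * ∑ e, |(I (w e)) j|) := by gcongr
      _ = _ := by ring

/-- `ℓ₁` is anti-Euclidean: for every `C ≥ 1` there is `n` such that no
factorization of the identity of `ℓ₂ⁿ` through `ℓ₁` exists with `‖I‖ ⬝ ‖P‖ ≤ C`. -/
theorem l1_anti_euclidean :
    ∀ C : ℝ, 1 ≤ C → ∃ n : ℕ,
      ¬ ∃ (I : EuclideanSpace ℝ (Fin n) →L[ℝ] lp (fun _ : ℕ => ℝ) 1)
          (P : lp (fun _ : ℕ => ℝ) 1 →L[ℝ] EuclideanSpace ℝ (Fin n)),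
          P.comp I = ContinuousLinearMap.id ℝ (EuclideanSpace ℝ (Fin n)) ∧
          ‖I‖ * ‖P‖ ≤ C := by
  intro C hC
  obtain ⟨n, hn⟩ := exists_nat_gt (4 * C^2)
  refine ⟨n, ?_⟩
  rintro ⟨I, P, h, hIP⟩
  have h1 := main_bd n I P h
  have hs := Real.sqrt_nonneg (n:ℝ)
  have hs2 := Real.sq_sqrt (Nat.cast_nonneg (α := ℝ) n)
  have h2 : (n:ℝ) ≤ 2 * C * √n := h1.trans (by gcongr)
  have h3 : 2 * C < √n := by
    apply Real.lt_sqrt_of_sq_lt; nlinarith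
  nlinarith

end
end
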